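/- Assume conditions (★) and in addition that m = O(n^{1/2+ε}) and x_{m+1} = ⋯ = x_n = 0 (all edges of X lie inside {1,…,m}). Then the probability that a uniformly random graph with degree sequence d has X^{[m]} as an induced subgraph is λ^X (1−λ)^{binom(m,2)−X} · exp( (2ω_{1,1} − ω_{0,2})/(4An) + m²/(2n) + (1−2λ)ω_{0,1}/(4An) + (4ω_{1,0}ω_{0,1} − ω_{0,1}² − 2ω_{1,0}²)/(8An²) + (2ω_{1,1} − ω_{2,0} − ω_{0,2})m/(4An²) − (1−2λ)(ω_{0,3} + 3ω_{2,1} − 3ω_{1,2})/(24A²n²) + O(n^{−b}) ). -/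

import Mathlib

open Filter Finset Asymptotics MeasureTheory
open scoped Classical Topology

noncomputable section

/-- The number of simple graphs on `Fin n` with degree sequence `d` having
no edge in common with the graph `X`. -/
def gCount {n : ℕ} (d : Fin n → ℕ) (X : SimpleGraph (Fin n)) : ℕ :=
  Nat.card {H : SimpleGraph (Fin n) //
    (∀ v, Nat.card (H.neighborSet v) = d v) ∧ Disjoint H.edgeSet X.edgeSet}

/-- The degree `x_j` of vertex `j` in the graph `X`. -/
def xDeg {n : ℕ} (X : SimpleGraph (Fin n)) (j : Fin n) : ℕ :=
  Nat.card (X.neighborSet j)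

/-- The number of edges of `X`. -/
def xEdges {n : ℕ} (X : SimpleGraph (Fin n)) : ℕ := Nat.card X.edgeSet

/-- The average degree `d̄ = 2E/n`. -/
def dBar {n : ℕ} (d : Fin n → ℕ) : ℝ := (∑ j, (d j : ℝ)) / n

/-- The density `λ = d̄/(n-1)`. -/
def lamb {n : ℕ} (d : Fin n → ℕ) : ℝ := dBar d / ((n : ℝ) - 1)

/-- `A = λ(1-λ)/2`. -/
def aPar {n : ℕ} (d : Fin n → ℕ) : ℝ := lamb d * (1 - lamb d) / 2

/-- `δ_j = d_j - d̄ + λ x_j`. -/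
def deltaPar {n : ℕ} (d : Fin n → ℕ) (X : SimpleGraph (Fin n)) (j : Fin n) : ℝ :=
  (d j : ℝ) - dBar d + lamb d * (xDeg X j : ℝ)

/-- The sum over unordered pairs `{j,k}` with `X.Adj j k` of `f j * f k`. -/
def pairSum {n : ℕ} (X : SimpleGraph (Fin n)) (f : Fin n → ℝ) : ℝ :=
  (∑ j, ∑ k, if X.Adj j k then f j * f k else 0) / 2

/-- `R = Σ_j (d_j - d̄)²`. -/
def rPar {n : ℕ} (d : Fin n → ℕ) : ℝ := ∑ j, ((d j : ℝ) - dBar d)^2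

/-- The naive estimate `Ĝ(d,X)`. -/
def gHat {n : ℕ} (d : Fin n → ℕ) (X : SimpleGraph (Fin n)) : ℝ :=
  (1 - lamb d) ^ (-(xEdges X : ℝ)) *
  (lamb d ^ lamb d * (1 - lamb d) ^ (1 - lamb d)) ^ n.choose 2 *
  ∏ j, ((n - 1 - xDeg X j).choose (d j) : ℝ)

/-- The number of graphs with degree sequence `d` whose induced subgraph on the
first `m` vertices equals that of `X`. -/
def gInd {n : ℕ} (d : Fin n → ℕ) (X : SimpleGraph (Fin n)) (m : ℕ) : ℕ :=
  Nat.card {H : SimpleGraph (Fin n) //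
    (∀ v, Nat.card (H.neighborSet v) = d v) ∧
    ∀ j k : Fin n, (j : ℕ) < m → (k : ℕ) < m → (H.Adj j k ↔ X.Adj j k)}

/-- `ω_{k,ℓ} = Σ_{j=1}^m (d_j - d̄)^k (x_j - λ(m-1))^ℓ`. -/
def omegaPar {n : ℕ} (d : Fin n → ℕ) (X : SimpleGraph (Fin n)) (m k ℓ : ℕ) : ℝ :=
  ∑ j : Fin n, if (j : ℕ) < m then
    ((d j : ℝ) - dBar d)^k * ((xDeg X j : ℝ) - lamb d * ((m : ℝ) - 1))^ℓ else 0

namespace DegEnum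

section

variable {n : ℕ}

/-- Real-valued adjacency indicator. -/
def adj (H : SimpleGraph (Fin n)) (u v : Fin n) : ℝ := if H.Adj u v then 1 else 0

/-- Real-valued degree. -/
def fdeg (H : SimpleGraph (Fin n)) (u : Fin n) : ℝ := ∑ v, adj H u v

/-- Graphs with degree sequence `d` avoiding all edges of `F`. -/
def cls (d : Fin n → ℝ) (F : SimpleGraph (Fin n)) : Finset (SimpleGraph (Fin n)) :=
  univ.filter fun H => (∀ v, fdeg H v = d v) ∧ ∀ u v, F.Adj u v → ¬ H.Adj u v

/-- The unit vector at a vertex. -/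
def ev (j : Fin n) : Fin n → ℝ := fun v => if v = j then 1 else 0

/-- `F` with the pair `jk` added. -/
def addE (F : SimpleGraph (Fin n)) (j k : Fin n) : SimpleGraph (Fin n) := F ⊔ SimpleGraph.edge j k

lemma mem_cls {d : Fin n → ℝ} {F H : SimpleGraph (Fin n)} :
    H ∈ cls d F ↔ (∀ v, fdeg H v = d v) ∧ ∀ u v, F.Adj u v → ¬ H.Adj u v := by
  simp [cls]

lemma addE_adj {F : SimpleGraph (Fin n)} {j k u v : Fin n} (hjk : j ≠ k) :
    (addE F j k).Adj u v ↔ F.Adj u v ∨ (u = j ∧ v = k) ∨ (u = k ∧ v = j) := by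
  simp only [addE, SimpleGraph.sup_adj, SimpleGraph.edge_adj]
  constructor
  · rintro (h | ⟨h, -⟩)
    · exact Or.inl h
    · tauto
  · rintro (h | ⟨rfl, rfl⟩ | ⟨rfl, rfl⟩)
    · exact Or.inl h
    · exact Or.inr ⟨by tauto, hjk⟩
    · exact Or.inr ⟨by tauto, hjk.symm⟩

lemma adj_nonneg (H : SimpleGraph (Fin n)) (u v : Fin n) : 0 ≤ adj H u v := by
  unfold adj; split_ifs <;> norm_num

lemma adj_le_one (H : SimpleGraph (Fin n)) (u v : Fin n) : adj H u v ≤ 1 := by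
  unfold adj; split_ifs <;> norm_num

lemma adj_comm (H : SimpleGraph (Fin n)) (u v : Fin n) : adj H u v = adj H v u := by
  unfold adj; rw [SimpleGraph.adj_comm]

@[simp] lemma adj_self (H : SimpleGraph (Fin n)) (u : Fin n) : adj H u u = 0 := by
  simp [adj]

lemma adj_sq (H : SimpleGraph (Fin n)) (u v : Fin n) : adj H u v * adj H u v = adj H u v := by
  unfold adj; split_ifs <;> norm_num

lemma adj_of {H : SimpleGraph (Fin n)} {u v : Fin n} (h : H.Adj u v) : adj H u v = 1 := by
  simp [adj, h]

lemma adj_of_not {H : SimpleGraph (Fin n)} {u v : Fin n} (h : ¬ H.Adj u v) : adj H u v = 0 := by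
  simp [adj, h]

lemma fdeg_nonneg (H : SimpleGraph (Fin n)) (u : Fin n) : 0 ≤ fdeg H u :=
  sum_nonneg fun _ _ => adj_nonneg _ _ _

lemma adj_addE {F : SimpleGraph (Fin n)} {j k : Fin n} (hjk : j ≠ k) (hF : ¬ F.Adj j k)
    (u v : Fin n) :
    adj (addE F j k) u v = adj F u v + (ev j u * ev k v + ev k u * ev j v) := by
  have hF' : ¬ F.Adj k j := fun h => hF h.symm
  unfold adj
  simp only [addE_adj hjk, ev]
  by_cases h1 : u = j
  · subst h1
    by_cases h2 : v = k
    · subst h2; simp [hF, hjk, hjk.symm]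
    · simp [h2, hjk]
  · by_cases h2 : u = k
    · subst h2
      by_cases h3 : v = j
      · subst h3; simp [hF', hjk, hjk.symm]
      · simp [h3, h1]
    · simp [h1, h2]

@[simp] lemma sum_ev (j : Fin n) : ∑ v, ev j v = 1 := by simp [ev]

@[simp] lemma sum_ev_mul (j : Fin n) (g : Fin n → ℝ) : ∑ v, ev j v * g v = g j := by simp [ev]

@[simp] lemma sum_mul_ev (j : Fin n) (g : Fin n → ℝ) : ∑ v, g v * ev j v = g j := by simp [ev]

lemma fdeg_addE {F : SimpleGraph (Fin n)} {j k : Fin n} (hjk : j ≠ k) (hF : ¬ F.Adj j k)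
    (u : Fin n) : fdeg (addE F j k) u = fdeg F u + ev j u + ev k u := by
  simp only [fdeg, adj_addE hjk hF, sum_add_distrib, ← mul_sum, sum_ev]
  ring

lemma addE_mem_cls {d : Fin n → ℝ} {F H : SimpleGraph (Fin n)} {j k : Fin n} (hjk : j ≠ k)
    (hF : ¬ F.Adj j k) (hH : H ∈ cls (d - ev j - ev k) (addE F j k)) :
    addE H j k ∈ cls d F := by
  rw [mem_cls] at hH ⊢
  have h0 : ¬ H.Adj j k := hH.2 j k (by rw [addE_adj hjk]; tauto)
  refine ⟨fun v => ?_, fun u v h1 h2 => ?_⟩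
  · rw [fdeg_addE hjk h0, hH.1]; simp only [Pi.sub_apply]; ring
  · rw [addE_adj hjk] at h2
    rcases h2 with h2 | ⟨rfl, rfl⟩ | ⟨rfl, rfl⟩
    · exact hH.2 u v (by rw [addE_adj hjk]; tauto) h2
    · exact hF h1
    · exact hF h1.symm

lemma sum_cls_adj {d : Fin n → ℝ} {F : SimpleGraph (Fin n)} {j k : Fin n} (hjk : j ≠ k)
    (hF : ¬ F.Adj j k) (g : SimpleGraph (Fin n) → ℝ) :
    ∑ H ∈ cls d F, adj H j k * g H =
      ∑ H ∈ cls (d - ev j - ev k) (addE F j k), g (addE H j k) := by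
  have : ∑ H ∈ cls d F, adj H j k * g H = ∑ H ∈ (cls d F).filter (fun H => H.Adj j k), g H := by
    rw [sum_filter]
    refine sum_congr rfl fun H _ => ?_
    unfold adj; split_ifs <;> simp
  rw [this]
  symm
  refine sum_bij (fun H _ => addE H j k) ?_ ?_ ?_ ?_
  · intro H hH
    rw [mem_filter]
    exact ⟨addE_mem_cls hjk hF hH, by rw [addE_adj hjk]; tauto⟩
  · intro H hH H' hH' he
    rw [mem_cls] at hH hH'
    ext u v
    have h1 : (addE H j k).Adj u v ↔ (addE H' j k).Adj u v := by rw [he]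
    rw [addE_adj hjk, addE_adj hjk] at h1
    have h2 := hH.2 u v
    have h3 := hH'.2 u v
    rw [addE_adj hjk] at h2 h3
    tauto
  · intro H hH
    rw [mem_filter, mem_cls] at hH
    obtain ⟨⟨h1, h2⟩, h3⟩ := hH
    have h3' := h3.symm
    have hne : ¬ (H \ SimpleGraph.edge j k).Adj j k := by
      simp [SimpleGraph.sdiff_adj, SimpleGraph.edge_adj, hjk]
    have heq : addE (H \ SimpleGraph.edge j k) j k = H := by
      unfold addE
      rw [sdiff_sup_self, sup_eq_left]
      intro u v h
      rw [SimpleGraph.edge_adj] at h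
      rcases h.1 with ⟨rfl, rfl⟩ | ⟨rfl, rfl⟩
      · exact h3
      · exact h3'
    refine ⟨H \ SimpleGraph.edge j k, ?_, heq⟩
    rw [mem_cls]
    refine ⟨fun v => ?_, fun u v h4 h5 => ?_⟩
    · have := fdeg_addE hjk hne v
      rw [heq, h1] at this
      simp only [Pi.sub_apply]; linarith
    · rw [SimpleGraph.sdiff_adj, SimpleGraph.edge_adj] at h5
      rw [addE_adj hjk] at h4
      rcases h4 with h4 | h4
      · exact h2 u v h4 h5.1
      · exact h5.2 ⟨by tauto, h5.1.ne⟩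
  · intro H _; rfl

lemma sum_cls_nadj {d : Fin n → ℝ} {F : SimpleGraph (Fin n)} {j k : Fin n} (hjk : j ≠ k)
    (g : SimpleGraph (Fin n) → ℝ) :
    ∑ H ∈ cls d F, (1 - adj H j k) * g H = ∑ H ∈ cls d (addE F j k), g H := by
  have : cls d (addE F j k) = (cls d F).filter (fun H => ¬ H.Adj j k) := by
    ext H
    rw [mem_filter, mem_cls, mem_cls]
    simp only [addE_adj hjk]
    constructor
    · rintro ⟨h1, h2⟩
      exact ⟨⟨h1, fun u v h => h2 u v (Or.inl h)⟩, h2 j k (by tauto)⟩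
    · rintro ⟨⟨h1, h2⟩, h3⟩
      refine ⟨h1, fun u v h h4 => ?_⟩
      rcases h with h | ⟨rfl, rfl⟩ | ⟨rfl, rfl⟩
      · exact h2 u v h h4
      · exact h3 h4
      · exact h3 h4.symm
  rw [this, sum_filter]
  refine sum_congr rfl fun H _ => ?_
  unfold adj; split_ifs <;> simp_all

end

section

variable {n : ℕ}

/-- Indicator function of a finite set. -/
def ind (B : Finset (Fin n)) (v : Fin n) : ℝ := if v ∈ B then 1 else 0

/-- Toggle all pairs between `{a, c}` and `B`. -/
def sw (a c : Fin n) (B : Finset (Fin n)) (H : SimpleGraph (Fin n)) : SimpleGraph (Fin n) where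
  Adj u v := u ≠ v ∧
    Xor (H.Adj u v) (((u = a ∨ u = c) ∧ v ∈ B) ∨ ((v = a ∨ v = c) ∧ u ∈ B))
  symm := ⟨fun u v h => by
    refine ⟨h.1.symm, ?_⟩
    have := h.2
    rw [H.adj_comm v u]
    unfold Xor at *
    tauto⟩
  loopless := ⟨fun u h => h.1 rfl⟩

lemma sw_adj {a c u v : Fin n} {B : Finset (Fin n)} {H : SimpleGraph (Fin n)} :
    (sw a c B H).Adj u v ↔ u ≠ v ∧
      Xor (H.Adj u v) (((u = a ∨ u = c) ∧ v ∈ B) ∨ ((v = a ∨ v = c) ∧ u ∈ B)) := Iff.rfl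

lemma sw_comm (a c : Fin n) (B : Finset (Fin n)) (H : SimpleGraph (Fin n)) :
    sw a c B H = sw c a B H := by
  ext u v
  rw [sw_adj, sw_adj, or_comm (a := u = a), or_comm (a := v = a)]

lemma sw_sw (a c : Fin n) (B : Finset (Fin n)) (H : SimpleGraph (Fin n)) :
    sw a c B (sw a c B H) = H := by
  ext u v
  rw [sw_adj, sw_adj]
  have : H.Adj u v → u ≠ v := fun h => h.ne
  unfold Xor
  tauto

lemma sw_adj_left {a c v : Fin n} {B : Finset (Fin n)} {H : SimpleGraph (Fin n)}
    (ha : a ∉ B) : (sw a c B H).Adj a v ↔ Xor (H.Adj a v) (v ∈ B) := by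
  rw [sw_adj]
  unfold Xor
  have : H.Adj a v → a ≠ v := fun h => h.ne
  have h2 : v ∈ B → a ≠ v := by rintro h rfl; exact ha h
  tauto

lemma sw_adj_other {a c u v : Fin n} {B : Finset (Fin n)} {H : SimpleGraph (Fin n)}
    (hu : u ∉ B) (hua : u ≠ a) (huc : u ≠ c) : (sw a c B H).Adj u v ↔ H.Adj u v := by
  rw [sw_adj]
  unfold Xor
  have : H.Adj u v → u ≠ v := fun h => h.ne
  tauto

lemma adj_sw {a c : Fin n} {B : Finset (Fin n)} (hac : a ≠ c) (ha : a ∉ B) (hc : c ∉ B)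
    (H : SimpleGraph (Fin n)) (u v : Fin n) :
    adj (sw a c B H) u v = adj H u v +
      ((ev a u + ev c u) * ind B v + (ev a v + ev c v) * ind B u) * (1 - 2 * adj H u v) := by
  by_cases huv : u = v
  · subst huv
    rw [adj_self, adj_self]
    unfold ev ind
    by_cases h1 : u = a
    · subst h1; simp [ha]
    · by_cases h2 : u = c
      · subst h2; simp [hc]
      · simp [h1, h2]
  have key : ((ev a u + ev c u) * ind B v + (ev a v + ev c v) * ind B u) =
      if (((u = a ∨ u = c) ∧ v ∈ B) ∨ ((v = a ∨ v = c) ∧ u ∈ B)) then 1 else 0 := by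
    unfold ev ind
    by_cases h1 : u = a
    · subst h1; simp [ha, hac]
    · by_cases h2 : u = c
      · subst h2; simp [hc, h1]
      · by_cases h3 : v = a
        · subst h3; simp [h1, h2, hac]
        · by_cases h4 : v = c
          · subst h4; simp [h1, h2, h3]
          · simp [h1, h2, h3, h4]
  rw [key]
  unfold adj
  rw [sw_adj]
  unfold Xor
  by_cases h1 : H.Adj u v <;>
    by_cases h2 : (((u = a ∨ u = c) ∧ v ∈ B) ∨ ((v = a ∨ v = c) ∧ u ∈ B)) <;>
    simp [h1, h2, huv]; norm_num

lemma sum_ind_mul (B : Finset (Fin n)) (g : Fin n → ℝ) : ∑ v, ind B v * g v = ∑ v ∈ B, g v := by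
  simp [ind, sum_ite_mem]

lemma fdeg_sw {a c : Fin n} {B : Finset (Fin n)} (hac : a ≠ c) (ha : a ∉ B) (hc : c ∉ B)
    (H : SimpleGraph (Fin n)) (u : Fin n) :
    fdeg (sw a c B H) u = fdeg H u + (ev a u + ev c u) * ∑ v ∈ B, (1 - 2 * adj H u v)
      + ind B u * (2 - 2 * adj H a u - 2 * adj H c u) := by
  simp only [fdeg, adj_sw hac ha hc, sum_add_distrib, add_mul, mul_assoc]
  simp only [← mul_sum, sum_ind_mul, sum_ev_mul]
  rw [adj_comm H u a, adj_comm H u c]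
  ring

/-- Number of vertices available for moving an edge end from `a` to `b`. -/
def mov (a b : Fin n) (F H : SimpleGraph (Fin n)) : ℝ :=
  ∑ v, if H.Adj a v ∧ ¬ H.Adj b v ∧ ¬ F.Adj b v ∧ v ≠ b then 1 else 0

lemma sw_single_mem {a b v : Fin n} (hab : a ≠ b) {d : Fin n → ℝ} {F H : SimpleGraph (Fin n)}
    (hH : H ∈ cls (d - ev b) F) (h1 : H.Adj a v) (h2 : ¬ H.Adj b v) (h3 : ¬ F.Adj b v)
    (h4 : v ≠ b) :
    sw a b {v} H ∈ cls (d - ev a) F ∧ (sw a b {v} H).Adj b v ∧ ¬ (sw a b {v} H).Adj a v ∧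
      ¬ F.Adj a v ∧ v ≠ a ∧ mov b a F (sw a b {v} H) = mov b a F H + 1 := by
  have hav : a ∉ ({v} : Finset (Fin n)) := by simpa using h1.ne
  have hbv : b ∉ ({v} : Finset (Fin n)) := by simpa using h4.symm
  rw [mem_cls] at hH
  have hFa : ¬ F.Adj a v := fun h => hH.2 a v h h1
  have ea : ∀ w, (sw a b {v} H).Adj a w ↔ Xor (H.Adj a w) (w = v) := fun w => by
    rw [sw_adj_left hav]; simp
  have eb : ∀ w, (sw a b {v} H).Adj b w ↔ Xor (H.Adj b w) (w = v) := fun w => by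
    rw [sw_comm, sw_adj_left hbv]; simp
  refine ⟨?_, ?_, ?_, hFa, h1.ne', ?_⟩
  · rw [mem_cls]
    refine ⟨fun u => ?_, fun u w hF hw => ?_⟩
    · rw [fdeg_sw hab hav hbv, hH.1]
      simp only [sum_singleton, Pi.sub_apply]
      unfold ind
      by_cases hu : u = v
      · subst hu
        simp [ev, h1.ne', h4, adj_of h1, adj_of_not h2]
      · by_cases hua : u = a
        · subst hua; simp [ev, hu, hab, adj_of h1]; ring
        · by_cases hub : u = b
          · subst hub; simp [ev, hu, hua, adj_of_not h2]
          · simp [ev, hu, hua, hub]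
    · rw [sw_adj] at hw
      have hw1 : ¬ H.Adj u w := hH.2 u w hF
      have hw2 := hw.2
      unfold Xor at hw2
      simp only [hw1, false_and, not_false_eq_true, and_true, false_or] at hw2
      simp only [mem_singleton] at hw2
      rcases hw2 with ⟨rfl | rfl, rfl⟩ | ⟨rfl | rfl, rfl⟩
      · exact hFa hF
      · exact h3 hF
      · exact hFa hF.symm
      · exact h3 hF.symm
  · rw [eb]; simp [Xor, h2]
  · rw [ea]; simp [Xor, h1]
  · unfold mov
    rw [← sum_ev v, ← sum_add_distrib]
    refine sum_congr rfl fun w _ => ?_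
    rw [ea, eb]
    by_cases hw : w = v
    · subst hw; simp [Xor, h1, h2, hFa, h1.ne', ev]
    · simp [Xor, hw, ev]

/-- Moving an edge end from `a` to `b`, weighted by a function of the number of reverse moves. -/
lemma move_identity {a b : Fin n} (hab : a ≠ b) (d : Fin n → ℝ) (F : SimpleGraph (Fin n))
    (φ : ℝ → ℝ) :
    ∑ H ∈ cls (d - ev b) F, mov a b F H * φ (mov b a F H + 1) =
      ∑ H ∈ cls (d - ev a) F, mov b a F H * φ (mov b a F H) := by
  have key : ∀ (a b : Fin n) (ψ : SimpleGraph (Fin n) → ℝ),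
      ∑ H ∈ cls (d - ev b) F, mov a b F H * ψ H =
      ∑ x ∈ (cls (d - ev b) F ×ˢ univ).filter (fun x : SimpleGraph (Fin n) × Fin n =>
        x.1.Adj a x.2 ∧ ¬ x.1.Adj b x.2 ∧ ¬ F.Adj b x.2 ∧ x.2 ≠ b), ψ x.1 := by
    intro a b ψ
    rw [sum_filter, sum_product]
    refine sum_congr rfl fun H _ => ?_
    rw [mov, sum_mul]
    exact sum_congr rfl fun v _ => by split_ifs <;> simp
  rw [key a b (fun H => φ (mov b a F H + 1)), key b a (fun H => φ (mov b a F H))]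
  refine sum_bij' (fun x _ => (sw a b {x.2} x.1, x.2)) (fun x _ => (sw a b {x.2} x.1, x.2))
    ?_ ?_ ?_ ?_ ?_
  · rintro ⟨H, v⟩ hx
    simp only [mem_filter, mem_product, mem_univ, and_true] at hx ⊢
    obtain ⟨h0, h1, h2, h3, h4⟩ := hx
    obtain ⟨g0, g1, g2, g3, g4, -⟩ := sw_single_mem hab h0 h1 h2 h3 h4
    exact ⟨g0, g1, g2, g3, g4⟩
  · rintro ⟨H, v⟩ hx
    simp only [mem_filter, mem_product, mem_univ, and_true] at hx ⊢
    obtain ⟨h0, h1, h2, h3, h4⟩ := hx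
    obtain ⟨g0, g1, g2, g3, g4, -⟩ := sw_single_mem hab.symm h0 h1 h2 h3 h4
    rw [sw_comm]
    exact ⟨g0, g1, g2, g3, g4⟩
  · rintro ⟨H, v⟩ _; simp [sw_sw]
  · rintro ⟨H, v⟩ _; simp [sw_sw]
  · rintro ⟨H, v⟩ hx
    simp only [mem_filter, mem_product, mem_univ, and_true] at hx ⊢
    obtain ⟨h0, h1, h2, h3, h4⟩ := hx
    rw [(sw_single_mem hab h0 h1 h2 h3 h4).2.2.2.2.2]

end

section

variable {n : ℕ}

/-- The mode of the binomial distribution with mean `s` is `s`. -/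
lemma binom_term_le {N s : ℕ} (hs : s ≤ N) (j : ℕ) (hj : j ≤ N) :
    (N.choose j : ℝ) * (s : ℝ) ^ j * ((N : ℝ) - s) ^ (N - j) ≤
      (N.choose s : ℝ) * (s : ℝ) ^ s * ((N : ℝ) - s) ^ (N - s) := by
  set T : ℕ → ℝ := fun j => (N.choose j : ℝ) * (s : ℝ) ^ j * ((N : ℝ) - s) ^ (N - j) with hT
  have hs' : (s : ℝ) ≤ N := by exact_mod_cast hs
  have hT0 : ∀ j, 0 ≤ T j := fun j => by
    have : (0 : ℝ) ≤ (N : ℝ) - s := by linarith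
    positivity
  have hrec : ∀ j, j < N → T (j + 1) * (((j : ℝ) + 1) * (N - s)) = T j * (((N : ℝ) - j) * s) := by
    intro j hj
    have h1 : ((N.choose (j + 1) : ℝ)) * (j + 1) = N.choose j * ((N : ℝ) - j) := by
      have := Nat.choose_succ_right_eq N j
      rw [← Nat.cast_sub hj.le]
      exact_mod_cast this
    have h2 : N - j = (N - (j + 1)) + 1 := by omega
    simp only [hT]
    rw [h2, pow_succ, pow_succ]
    linear_combination (s : ℝ) ^ j * s * ((N : ℝ) - s) ^ (N - (j + 1)) * (N - s) * h1
  rcases le_total s j with h | h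
  · induction j, h using Nat.le_induction with
    | base => exact le_rfl
    | succ j hsj ih =>
      refine le_trans ?_ (ih (by omega))
      have hsN : (s : ℝ) < N := by exact_mod_cast (by omega : s < N)
      have h1 := hrec j (by omega)
      have hsj' : (s : ℝ) ≤ j := by exact_mod_cast hsj
      have hpos : 0 < ((j : ℝ) + 1) * (N - s) :=
        mul_pos (by positivity) (by linarith)
      have h2 : ((N : ℝ) - j) * s ≤ ((j : ℝ) + 1) * (N - s) := by nlinarith
      have h3 : T (j + 1) * (((j : ℝ) + 1) * (N - s)) ≤ T j * (((j : ℝ) + 1) * (N - s)) := by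
        rw [h1]; exact mul_le_mul_of_nonneg_left h2 (hT0 j)
      exact le_of_mul_le_mul_right h3 hpos
  · have key : ∀ i, i ≤ s → T (s - i) ≤ T s := by
      intro i
      induction i with
      | zero => intro _; simp
      | succ i ih =>
        intro hi
        refine le_trans ?_ (ih (by omega))
        have hi' : s - i = (s - (i + 1)) + 1 := by omega
        set l := s - (i + 1) with hl
        rw [hi']
        have h1 := hrec l (by omega)
        have hls : (l : ℝ) + 1 ≤ s := by exact_mod_cast (by omega : l + 1 ≤ s)
        have hl0 : (0 : ℝ) ≤ l := Nat.cast_nonneg _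
        have hpos : 0 < ((N : ℝ) - l) * s := mul_pos (by linarith) (by linarith)
        have h2 : ((l : ℝ) + 1) * (N - s) ≤ ((N : ℝ) - l) * s := by nlinarith
        have h3 : T l * (((N : ℝ) - l) * s) ≤ T (l + 1) * (((N : ℝ) - l) * s) := by
          rw [← h1]; exact mul_le_mul_of_nonneg_left h2 (hT0 _)
        exact le_of_mul_le_mul_right h3 hpos
    have := key (s - j) (by omega)
    rwa [Nat.sub_sub_self h] at this

lemma one_le_binom_mode {N s : ℕ} (hs : s ≤ N) (hN : 0 < N) :
    1 ≤ ((N : ℝ) + 1) * ((N.choose s : ℝ) * ((s : ℝ) / N) ^ s * (1 - (s : ℝ) / N) ^ (N - s)) := by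
  have hN' : (0 : ℝ) < N := by exact_mod_cast hN
  have h1 : (N : ℝ) ^ N ≤
      ((N : ℝ) + 1) * ((N.choose s : ℝ) * (s : ℝ) ^ s * ((N : ℝ) - s) ^ (N - s)) := by
    calc (N : ℝ) ^ N = ((s : ℝ) + (N - s)) ^ N := by congr 1; ring
      _ = ∑ j ∈ range (N + 1), (N.choose j : ℝ) * (s : ℝ) ^ j * ((N : ℝ) - s) ^ (N - j) := by
          rw [add_pow]; exact sum_congr rfl fun j _ => by ring
      _ ≤ ∑ j ∈ range (N + 1), (N.choose s : ℝ) * (s : ℝ) ^ s * ((N : ℝ) - s) ^ (N - s) :=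
          sum_le_sum fun j hj => binom_term_le hs j (by simpa [Nat.lt_succ_iff] using hj)
      _ = _ := by simp
  have h2 : (1 - (s : ℝ) / N) = ((N : ℝ) - s) / N := by field_simp
  have h3 : (N : ℝ) ^ N = (N : ℝ) ^ s * (N : ℝ) ^ (N - s) := by rw [← pow_add]; congr 1; omega
  rw [h2, div_pow, div_pow]
  have h4 : ((N : ℝ) + 1) * ((N.choose s : ℝ) * ((s : ℝ) ^ s / (N : ℝ) ^ s) *
      (((N : ℝ) - s) ^ (N - s) / (N : ℝ) ^ (N - s))) =
      ((N : ℝ) + 1) * ((N.choose s : ℝ) * (s : ℝ) ^ s * ((N : ℝ) - s) ^ (N - s)) / (N : ℝ) ^ N := by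
    rw [h3]; field_simp
  rw [h4, le_div_iff₀ (by positivity), one_mul]
  exact h1

lemma bernoulli_mgf {π θ : ℝ} (h0 : 0 ≤ π) (h1 : π ≤ 1) (hθ : |θ| ≤ 1) :
    π * Real.exp (θ * (1 - π)) + (1 - π) * Real.exp (-θ * π) ≤ Real.exp (θ ^ 2) := by
  have hb : ∀ x : ℝ, |x| ≤ 1 → Real.exp x ≤ 1 + x + x ^ 2 := fun x hx => by
    have := (abs_le.mp (Real.abs_exp_sub_one_sub_id_le hx)).2; linarith
  have e1 := hb (θ * (1 - π)) (by
    rw [abs_mul, abs_of_nonneg (by linarith : 0 ≤ 1 - π)]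
    exact mul_le_one₀ hθ (by linarith) (by linarith))
  have e2 := hb (-θ * π) (by
    rw [abs_mul, abs_neg, abs_of_nonneg h0]
    exact mul_le_one₀ hθ h0 h1)
  have e3 := Real.add_one_le_exp (θ ^ 2)
  have e4 : π * (1 - π) ≤ 1 := by nlinarith
  calc _ ≤ π * (1 + θ * (1 - π) + (θ * (1 - π)) ^ 2) + (1 - π) * (1 + -θ * π + (-θ * π) ^ 2) :=
        add_le_add (mul_le_mul_of_nonneg_left e1 h0)
          (mul_le_mul_of_nonneg_left e2 (by linarith))
    _ = 1 + θ ^ 2 * (π * (1 - π)) := by ring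
    _ ≤ θ ^ 2 + 1 := by nlinarith [sq_nonneg θ]
    _ ≤ _ := e3

lemma hyper_mgf (D S : Finset (Fin n)) (s : ℕ) (hs : s ≤ #D) (hD : 0 < #D) {θ : ℝ}
    (hθ : |θ| ≤ 1) :
    ∑ A ∈ D.powersetCard s, Real.exp (θ * ((#(A ∩ S) : ℝ) - s * #(D ∩ S) / #D)) ≤
      ((#D : ℝ) + 1) * Real.exp (θ ^ 2 * n) * (#D).choose s := by
  have hN' : (0 : ℝ) < #D := by exact_mod_cast hD
  have hs' : (s : ℝ) ≤ #D := by exact_mod_cast hs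
  set π : ℝ := (s : ℝ) / #D with hπ
  have hπ0 : 0 ≤ π := by positivity
  have hπ1 : π ≤ 1 := by rw [hπ, div_le_one hN']; exact hs'
  set w : ℝ := π ^ s * (1 - π) ^ (#D - s) with hw
  have hmode := one_le_binom_mode hs hD
  rw [← hπ] at hmode
  have hprod : ∑ A ∈ D.powerset, (∏ v ∈ A, π * Real.exp (θ * (1 - π) * ind S v)) *
      ∏ v ∈ D \ A, (1 - π) * Real.exp (-θ * π * ind S v) ≤ Real.exp (θ ^ 2 * n) := by
    rw [← prod_add]
    calc _ ≤ ∏ v ∈ D, Real.exp (θ ^ 2) := by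
          refine prod_le_prod (fun v _ => ?_) (fun v _ => ?_)
          · have : 0 ≤ 1 - π := by linarith
            positivity
          · unfold ind
            split_ifs
            · simpa using bernoulli_mgf hπ0 hπ1 hθ
            · simpa using sq_nonneg θ
      _ = Real.exp (θ ^ 2 * #D) := by rw [prod_const, ← Real.exp_nat_mul]; congr 1; ring
      _ ≤ _ := by
          apply Real.exp_le_exp.mpr
          have : (#D : ℝ) ≤ n := by
            have := card_le_univ D
            rw [Fintype.card_fin] at this
            exact_mod_cast this
          exact mul_le_mul_of_nonneg_left this (sq_nonneg _)
  have hterm : ∀ A ∈ D.powersetCard s, (∏ v ∈ A, π * Real.exp (θ * (1 - π) * ind S v)) *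
      ∏ v ∈ D \ A, (1 - π) * Real.exp (-θ * π * ind S v) =
      w * Real.exp (θ * ((#(A ∩ S) : ℝ) - s * #(D ∩ S) / #D)) := by
    intro A hA
    rw [mem_powersetCard] at hA
    have hi : ∀ B : Finset (Fin n), ∑ v ∈ B, ind S v = #(B ∩ S) := fun B => by
      simp [ind]
    rw [prod_mul_distrib, prod_mul_distrib, prod_const, prod_const, ← Real.exp_sum,
      ← Real.exp_sum, ← mul_sum, ← mul_sum, hi, hi, hA.2, card_sdiff_of_subset hA.1, hA.2, hw]
    have hc : (#((D \ A) ∩ S) : ℝ) = #(D ∩ S) - #(A ∩ S) := by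
      rw [← hi, ← hi, ← hi, sum_sdiff_eq_sub hA.1]
    have he : θ * ((#(A ∩ S) : ℝ) - s * #(D ∩ S) / #D) =
        θ * (1 - π) * #(A ∩ S) + -θ * π * #((D \ A) ∩ S) := by
      rw [hc, hπ]; ring
    rw [he, Real.exp_add]
    ring
  have hsum : w * ∑ A ∈ D.powersetCard s, Real.exp (θ * ((#(A ∩ S) : ℝ) - s * #(D ∩ S) / #D)) ≤
      Real.exp (θ ^ 2 * n) := by
    refine le_trans ?_ hprod
    rw [mul_sum, ← sum_congr rfl hterm]
    refine sum_le_sum_of_subset_of_nonneg (fun A hA => ?_) (fun A _ _ => ?_)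
    · rw [mem_powersetCard] at hA; exact mem_powerset.mpr hA.1
    · have : 0 ≤ 1 - π := by linarith
      positivity
  set M := ∑ A ∈ D.powersetCard s, Real.exp (θ * ((#(A ∩ S) : ℝ) - s * #(D ∩ S) / #D))
  have hM : 0 ≤ M := sum_nonneg fun _ _ => (Real.exp_pos _).le
  calc M = 1 * M := (one_mul _).symm
    _ ≤ (((#D : ℝ) + 1) * (((#D).choose s : ℝ) * π ^ s * (1 - π) ^ (#D - s))) * M :=
        mul_le_mul_of_nonneg_right hmode hM
    _ = ((#D : ℝ) + 1) * (#D).choose s * (w * M) := by rw [hw]; ring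
    _ ≤ ((#D : ℝ) + 1) * (#D).choose s * Real.exp (θ ^ 2 * n) :=
        mul_le_mul_of_nonneg_left hsum (by positivity)
    _ = _ := by ring

lemma hyper_tail (D S : Finset (Fin n)) (s : ℕ) (hs : s ≤ #D) {τ : ℝ} (h0 : 0 ≤ τ)
    (hτ : τ ≤ 2 * n) :
    (#((D.powersetCard s).filter fun A => τ < |(#(A ∩ S) : ℝ) - s * #(D ∩ S) / #D|) : ℝ) ≤
      2 * ((n : ℝ) + 1) * Real.exp (-(τ ^ 2 / (4 * n))) * #(D.powersetCard s) := by
  rcases Nat.eq_zero_or_pos #D with hD | hD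
  · have : (D.powersetCard s).filter (fun A => τ < |(#(A ∩ S) : ℝ) - s * #(D ∩ S) / #D|) = ∅ := by
      refine filter_eq_empty_iff.mpr fun A hA => ?_
      rw [mem_powersetCard] at hA
      have hA0 : A = ∅ := by
        rw [card_eq_zero] at hD; rw [hD] at hA; exact subset_empty.mp hA.1
      rw [hA0, hD]; simpa using h0
    rw [this]; simp only [card_empty, Nat.cast_zero]; positivity
  have hDn : (#D : ℝ) ≤ n := by
    have := card_le_univ D
    rw [Fintype.card_fin] at this
    exact_mod_cast this
  have hn : (0 : ℝ) < n := lt_of_lt_of_le (by exact_mod_cast hD) hDn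
  set θ : ℝ := τ / (2 * n) with hθ
  have hθ0 : 0 ≤ θ := by positivity
  have hθ1 : θ ≤ 1 := by rw [hθ, div_le_one (by positivity)]; exact hτ
  have m1 := hyper_mgf D S s hs hD (θ := θ) (by rw [abs_of_nonneg hθ0]; exact hθ1)
  have m2 := hyper_mgf D S s hs hD (θ := -θ) (by rw [abs_neg, abs_of_nonneg hθ0]; exact hθ1)
  rw [neg_sq] at m2
  set f : Finset (Fin n) → ℝ := fun A => (#(A ∩ S) : ℝ) - s * #(D ∩ S) / #D with hf
  have hle : (#((D.powersetCard s).filter fun A => τ < |f A|) : ℝ) ≤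
      ∑ A ∈ D.powersetCard s, Real.exp (-(θ * τ)) *
        (Real.exp (θ * f A) + Real.exp (-θ * f A)) := by
    rw [card_filter, Nat.cast_sum]
    refine sum_le_sum fun A _ => ?_
    rw [mul_add, ← Real.exp_add, ← Real.exp_add]
    split_ifs with h
    · rw [Nat.cast_one]
      rcases lt_abs.mp h with h | h
      · have : 1 ≤ Real.exp (-(θ * τ) + θ * f A) := Real.one_le_exp (by nlinarith)
        have := Real.exp_pos (-(θ * τ) + -θ * f A)
        linarith
      · have : 1 ≤ Real.exp (-(θ * τ) + -θ * f A) := Real.one_le_exp (by nlinarith)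
        have := Real.exp_pos (-(θ * τ) + θ * f A)
        linarith
    · rw [Nat.cast_zero]; positivity
  refine hle.trans ?_
  rw [← mul_sum, sum_add_distrib, card_powersetCard]
  have hexp : Real.exp (-(θ * τ)) * Real.exp (θ ^ 2 * n) = Real.exp (-(τ ^ 2 / (4 * n))) := by
    rw [← Real.exp_add]; congr 1; rw [hθ]; field_simp; ring
  calc _ ≤ Real.exp (-(θ * τ)) * (((#D : ℝ) + 1) * Real.exp (θ ^ 2 * n) * (#D).choose s +
        ((#D : ℝ) + 1) * Real.exp (θ ^ 2 * n) * (#D).choose s) :=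
        mul_le_mul_of_nonneg_left (add_le_add m1 m2) (Real.exp_pos _).le
    _ = 2 * ((#D : ℝ) + 1) * (Real.exp (-(θ * τ)) * Real.exp (θ ^ 2 * n)) * (#D).choose s := by ring
    _ ≤ _ := by rw [hexp]; gcongr

end

section

variable {n : ℕ}

/-- Vertices outside `{a, b, c}` joined to exactly one of `a` and `c`, by pairs not in `F`. -/
def diffSet (a b c : Fin n) (F H : SimpleGraph (Fin n)) : Finset (Fin n) :=
  univ.filter fun v => v ≠ a ∧ v ≠ b ∧ v ≠ c ∧ ¬ F.Adj a v ∧ ¬ F.Adj c v ∧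
    Xor (H.Adj a v) (H.Adj c v)

/-- The members of `diffSet` joined to `a`. -/
def leftSet (a b c : Fin n) (F H : SimpleGraph (Fin n)) : Finset (Fin n) :=
  (diffSet a b c F H).filter fun v => H.Adj a v

/-- Neighbourhood as a finite set. -/
def nbh (H : SimpleGraph (Fin n)) (b : Fin n) : Finset (Fin n) := univ.filter fun v => H.Adj b v

lemma xor_xor_xor_cancel {P Q T : Prop} : Xor (Xor P T) (Xor Q T) ↔ Xor P Q := by
  by_cases hP : P <;> by_cases hQ : Q <;> by_cases hT : T <;> simp [Xor, hP, hQ, hT]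

lemma resample_props {a b c : Fin n} (hac : a ≠ c) (hab : b ≠ a) (hbc : b ≠ c)
    {d : Fin n → ℝ} {F H : SimpleGraph (Fin n)} (hH : H ∈ cls d F) {A' : Finset (Fin n)}
    (hA' : A' ∈ (diffSet a b c F H).powersetCard #(leftSet a b c F H)) :
    sw a c (symmDiff (leftSet a b c F H) A') H ∈ cls d F ∧
    diffSet a b c F (sw a c (symmDiff (leftSet a b c F H) A') H) = diffSet a b c F H ∧
    leftSet a b c F (sw a c (symmDiff (leftSet a b c F H) A') H) = A' ∧
    nbh (sw a c (symmDiff (leftSet a b c F H) A') H) b = nbh H b := by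
  set A := leftSet a b c F H with hA
  set D := diffSet a b c F H with hD
  set B := symmDiff A A' with hB
  rw [mem_powersetCard] at hA'
  have hAD : A ⊆ D := filter_subset _ _
  have hBD : B ⊆ D := by
    intro v hv
    rw [hB, mem_symmDiff] at hv
    rcases hv with hv | hv
    · exact hAD hv.1
    · exact hA'.1 hv.1
  have hDv : ∀ v ∈ D, v ≠ a ∧ v ≠ b ∧ v ≠ c ∧ ¬ F.Adj a v ∧ ¬ F.Adj c v ∧
      Xor (H.Adj a v) (H.Adj c v) := fun v hv => by simpa [hD, diffSet] using hv
  have haB : a ∉ B := fun h => (hDv a (hBD h)).1 rfl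
  have hbB : b ∉ B := fun h => (hDv b (hBD h)).2.1 rfl
  have hcB : c ∉ B := fun h => (hDv c (hBD h)).2.2.1 rfl
  have ea : ∀ v, (sw a c B H).Adj a v ↔ Xor (H.Adj a v) (v ∈ B) := fun v => sw_adj_left haB
  have ec : ∀ v, (sw a c B H).Adj c v ↔ Xor (H.Adj c v) (v ∈ B) := fun v => by
    rw [sw_comm]; exact sw_adj_left hcB
  have hD' : diffSet a b c F (sw a c B H) = D := by
    ext v
    rw [hD]
    unfold diffSet
    simp only [mem_filter, mem_univ, true_and]
    rw [ea, ec, xor_xor_xor_cancel]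
  have hmemA : ∀ v, v ∈ A ↔ v ∈ D ∧ H.Adj a v := fun v => by rw [hA, leftSet, mem_filter]
  refine ⟨?_, hD', ?_, ?_⟩
  · rw [mem_cls] at hH ⊢
    have hsum : ∀ (u : Fin n), (u = a ∨ u = c) → ∑ v ∈ B, (1 - 2 * adj H u v) = 0 := by
      have hsa : ∑ v ∈ B, (1 - 2 * adj H a v) = 0 := by
        have e1 : ∀ v ∈ B, (1 - 2 * adj H a v) = ind A' v - ind A v := by
          intro v hv
          have hvD := hBD hv
          have h1 := hmemA v
          rw [hB, mem_symmDiff] at hv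
          unfold ind adj
          by_cases h2 : H.Adj a v
          · have h3 : v ∈ A := h1.mpr ⟨hvD, h2⟩
            have h4 : v ∉ A' := by tauto
            simp [h2, h3, h4]; norm_num
          · have h3 : v ∉ A := fun h => h2 (h1.mp h).2
            have h4 : v ∈ A' := by tauto
            simp [h2, h3, h4]
        rw [sum_congr rfl e1]
        have e2 : ∑ v ∈ B, (ind A' v - ind A v) = ∑ v ∈ D, (ind A' v - ind A v) := by
          refine sum_subset hBD fun v _ hv => ?_
          rw [hB, mem_symmDiff] at hv
          unfold ind
          by_cases h3 : v ∈ A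
          · have h4 : v ∈ A' := by tauto
            simp [h3, h4]
          · have h4 : v ∉ A' := by tauto
            simp [h3, h4]
        have e3 : ∀ B' ⊆ D, ∑ v ∈ D, ind B' v = #B' := fun B' hB' => by
          simp [ind, inter_eq_right.mpr hB']
        rw [e2, sum_sub_distrib, e3 A' hA'.1, e3 A hAD, hA'.2, sub_self]
      rintro u (rfl | rfl)
      · exact hsa
      · rw [← neg_eq_zero, ← sum_neg_distrib, ← hsa]
        refine sum_congr rfl fun v hv => ?_
        have := (hDv v (hBD hv)).2.2.2.2.2
        unfold adj
        rcases this with ⟨h1, h2⟩ | ⟨h1, h2⟩ <;> simp [h1, h2] <;> norm_num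
    refine ⟨fun u => ?_, fun u v hF hw => ?_⟩
    · rw [fdeg_sw hac haB hcB, hH.1]
      have h1 : (ev a u + ev c u) * ∑ v ∈ B, (1 - 2 * adj H u v) = 0 := by
        by_cases hu : u = a ∨ u = c
        · rw [hsum u hu, mul_zero]
        · push Not at hu; simp [ev, hu.1, hu.2]
      have h2 : ind B u * (2 - 2 * adj H a u - 2 * adj H c u) = 0 := by
        by_cases hu : u ∈ B
        · have := (hDv u (hBD hu)).2.2.2.2.2
          unfold adj
          rcases this with ⟨h1, h2⟩ | ⟨h1, h2⟩ <;> simp [h1, h2]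
        · simp [ind, hu]
      rw [h1, h2]; ring
    · rw [sw_adj] at hw
      have hw1 : ¬ H.Adj u v := hH.2 u v hF
      have hw2 := hw.2
      unfold Xor at hw2
      simp only [hw1, false_and, not_false_eq_true, and_true, false_or] at hw2
      rcases hw2 with ⟨rfl | rfl, hv⟩ | ⟨rfl | rfl, hv⟩
      · exact (hDv _ (hBD hv)).2.2.2.1 hF
      · exact (hDv _ (hBD hv)).2.2.2.2.1 hF
      · exact (hDv _ (hBD hv)).2.2.2.1 hF.symm
      · exact (hDv _ (hBD hv)).2.2.2.2.1 hF.symm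
  · unfold leftSet
    rw [hD']
    ext v
    rw [mem_filter, ea]
    have h1 := hmemA v
    have h2 : v ∈ B ↔ (v ∈ A ∧ v ∉ A') ∨ (v ∈ A' ∧ v ∉ A) := mem_symmDiff
    have h3 : v ∈ A' → v ∈ D := fun h => hA'.1 h
    by_cases g1 : v ∈ D <;> by_cases g2 : H.Adj a v <;> by_cases g3 : v ∈ A' <;>
      simp_all [Xor]
  · ext v
    simp only [nbh, mem_filter, mem_univ, true_and]
    exact sw_adj_other hbB hab hbc

lemma resample_tail {a b c : Fin n} (hac : a ≠ c) (hab : b ≠ a) (hbc : b ≠ c)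
    (d : Fin n → ℝ) (F : SimpleGraph (Fin n)) {τ : ℝ} (h0 : 0 ≤ τ) (hτ : τ ≤ 2 * n) :
    (#((cls d F).filter fun H => τ < |(#(leftSet a b c F H ∩ nbh H b) : ℝ) -
      #(leftSet a b c F H) * #(diffSet a b c F H ∩ nbh H b) / #(diffSet a b c F H)|) : ℝ) ≤
      2 * ((n : ℝ) + 1) * Real.exp (-(τ ^ 2 / (4 * n))) * #(cls d F) := by
  set P : SimpleGraph (Fin n) → Finset (Finset (Fin n)) :=
    fun H => (diffSet a b c F H).powersetCard #(leftSet a b c F H) with hP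
  have hPpos : ∀ H, (0 : ℝ) < #(P H) := fun H => by
    have : 0 < #(P H) := by
      rw [hP]; simp only [card_powersetCard]
      exact Nat.choose_pos (card_le_card (filter_subset _ _))
    exact_mod_cast this
  set bad : SimpleGraph (Fin n) → Finset (Fin n) → Prop := fun H A =>
    τ < |(#(A ∩ nbh H b) : ℝ) -
      #(leftSet a b c F H) * #(diffSet a b c F H ∩ nbh H b) / #(diffSet a b c F H)| with hbad
  have e1 : (#((cls d F).filter fun H => bad H (leftSet a b c F H)) : ℝ) =
      ∑ H ∈ cls d F, ∑ A' ∈ P H, (if bad H (leftSet a b c F H) then 1 else 0) / (#(P H) : ℝ) := by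
    rw [card_filter, Nat.cast_sum]
    refine sum_congr rfl fun H _ => ?_
    rw [sum_const, nsmul_eq_mul, mul_div_cancel₀ _ (hPpos H).ne']
    split_ifs <;> simp
  have e2 : ∑ H ∈ cls d F, ∑ A' ∈ P H, (if bad H (leftSet a b c F H) then 1 else 0) / (#(P H) : ℝ)
      = ∑ H ∈ cls d F, ∑ A' ∈ P H, (if bad H A' then 1 else 0) / (#(P H) : ℝ) := by
    rw [sum_sigma', sum_sigma']
    have hmem : ∀ x ∈ (cls d F).sigma P,
        (⟨sw a c (symmDiff (leftSet a b c F x.1) x.2) x.1, leftSet a b c F x.1⟩ :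
          (_ : SimpleGraph (Fin n)) × Finset (Fin n)) ∈ (cls d F).sigma P := by
      rintro ⟨H, A'⟩ hx
      rw [mem_sigma] at hx ⊢
      obtain ⟨g1, g2, g3, -⟩ := resample_props hac hab hbc hx.1 hx.2
      refine ⟨g1, ?_⟩
      have h2 := hx.2
      simp only [hP, mem_powersetCard] at h2 ⊢
      rw [g2, g3]
      exact ⟨filter_subset _ _, h2.2.symm⟩
    have hinv : ∀ x ∈ (cls d F).sigma P,
        (⟨sw a c (symmDiff (leftSet a b c F (sw a c (symmDiff (leftSet a b c F x.1) x.2) x.1))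
            (leftSet a b c F x.1)) (sw a c (symmDiff (leftSet a b c F x.1) x.2) x.1),
          leftSet a b c F (sw a c (symmDiff (leftSet a b c F x.1) x.2) x.1)⟩ :
          (_ : SimpleGraph (Fin n)) × Finset (Fin n)) = x := by
      rintro ⟨H, A'⟩ hx
      rw [mem_sigma] at hx
      obtain ⟨g1, g2, g3, -⟩ := resample_props hac hab hbc hx.1 hx.2
      simp only [g3]
      rw [symmDiff_comm A', sw_sw]
    set T : (_ : SimpleGraph (Fin n)) × Finset (Fin n) →
        (_ : SimpleGraph (Fin n)) × Finset (Fin n) := fun x =>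
      ⟨sw a c (symmDiff (leftSet a b c F x.1) x.2) x.1, leftSet a b c F x.1⟩ with hT
    refine sum_nbij' T T hmem hmem hinv hinv ?_
    rintro ⟨H, A'⟩ hx
    rw [mem_sigma] at hx
    obtain ⟨g1, g2, g3, g4⟩ := resample_props hac hab hbc hx.1 hx.2
    have h2 := hx.2
    simp only [hP, mem_powersetCard] at h2
    simp only [hbad, hP, hT]
    dsimp only at g2 g3 g4
    rw [g2, g3, g4, h2.2]
  change (#((cls d F).filter fun H => bad H (leftSet a b c F H)) : ℝ) ≤ _
  rw [e1, e2]
  have e3 : ∀ q : ℝ, q * #(cls d F) = ∑ H ∈ cls d F, q := fun q => by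
    rw [sum_const, nsmul_eq_mul, mul_comm]
  rw [e3]
  refine sum_le_sum fun H _ => ?_
  rw [← sum_div, div_le_iff₀ (hPpos H)]
  have := hyper_tail (diffSet a b c F H) (nbh H b) #(leftSet a b c F H)
    (card_le_card (filter_subset _ _)) h0 hτ
  rw [card_filter, Nat.cast_sum] at this
  refine le_trans (le_of_eq ?_) this
  refine sum_congr rfl fun A _ => ?_
  simp only [hbad]
  split_ifs <;> simp

end

section

variable {n : ℕ}

/-- Parameters: density `p`, `y = n^{-1/2}`, and a slowly growing quantity `t`. -/
structure Par (n : ℕ) (t y p : ℝ) : Prop where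
  ht : 1000 ≤ t
  hy : 0 < y
  hny : (n : ℝ) * y ^ 2 = 1
  hty : t ^ 1000 * y ≤ 1
  hp0 : 1 ≤ t * p
  hp1 : 1 ≤ t * (1 - p)
  htail : Real.exp (-t) ≤ y ^ 100

/-- The degree sequence `d` is nearly regular of density `p`, and `F` is sparse. -/
structure Near (t y p c : ℝ) (d : Fin n → ℝ) (F : SimpleGraph (Fin n)) : Prop where
  par : Par n t y p
  hc0 : 0 ≤ c
  hc : c ≤ 100
  hd : ∀ v, |d v * y ^ 2 - p| ≤ t * y + c * y ^ 2
  hf : ∀ v, fdeg F v * y ^ 2 ≤ t * y + c * y ^ 2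
  hF : (∑ v, fdeg F v) * y ^ 4 ≤ t ^ 2 * y ^ 2 + c * y ^ 4
  hS : |∑ v, (d v * y ^ 2 - p)| * y ^ 2 ≤ t ^ 2 * y ^ 2 + c * y ^ 4

/-- `x = O(t^K y^r)`. -/
def Bd (t y : ℝ) (K r : ℕ) (x : ℝ) : Prop := |x| ≤ t ^ K * y ^ r

namespace Par

variable {t y p : ℝ}

lemma t_pos (P : Par n t y p) : 0 < t := by linarith [P.ht]

lemma t_one (P : Par n t y p) : 1 ≤ t := by linarith [P.ht]

lemma pow_y (P : Par n t y p) {K : ℕ} (hK : K ≤ 1000) : t ^ K * y ≤ 1 :=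
  (mul_le_mul_of_nonneg_right (pow_le_pow_right₀ P.t_one hK) P.hy.le).trans P.hty

lemma y_one (P : Par n t y p) : y ≤ 1 := by simpa using P.pow_y (K := 0) (by norm_num)

lemma p_pos (P : Par n t y p) : 0 < p := by
  by_contra h
  have := P.hp0
  nlinarith [P.t_pos]

lemma q_pos (P : Par n t y p) : 0 < 1 - p := by
  by_contra h
  have := P.hp1
  nlinarith [P.t_pos]

lemma n_eq (P : Par n t y p) : (n : ℝ) = (y ^ 2)⁻¹ := by
  have := P.hny
  have := P.hy
  field_simp
  linarith

lemma y_small (P : Par n t y p) : 1000 * y ≤ 1 := by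
  have h := P.pow_y (K := 1) (by norm_num)
  rw [pow_one] at h
  nlinarith [P.ht, P.hy]

lemma n_pos (P : Par n t y p) : (0 : ℝ) < n := by
  rw [P.n_eq]; have := P.hy; positivity

lemma bd_const (P : Par n t y p) {x : ℝ} (hx : |x| ≤ 1000) : Bd t y 1 0 x := by
  unfold Bd; simpa using hx.trans P.ht

lemma bd_p (P : Par n t y p) : Bd t y 0 0 p := by
  unfold Bd; rw [abs_of_pos P.p_pos]; simpa using P.q_pos.le

lemma bd_q (P : Par n t y p) : Bd t y 0 0 (1 - p) := by
  unfold Bd; rw [abs_of_pos P.q_pos]; simpa using P.p_pos.le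

lemma bd_pinv (P : Par n t y p) : Bd t y 1 0 p⁻¹ := by
  unfold Bd; rw [abs_of_pos (inv_pos.mpr P.p_pos)]
  rw [inv_le_iff_one_le_mul₀ P.p_pos]; simpa using P.hp0

lemma bd_qinv (P : Par n t y p) : Bd t y 1 0 (1 - p)⁻¹ := by
  unfold Bd; rw [abs_of_pos (inv_pos.mpr P.q_pos)]
  rw [inv_le_iff_one_le_mul₀ P.q_pos]; simpa using P.hp1

lemma bd_y (P : Par n t y p) (r : ℕ) : Bd t y 0 r (y ^ r) := by
  unfold Bd; rw [abs_of_pos (pow_pos P.hy r), pow_zero, one_mul]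

lemma bd_mono (P : Par n t y p) {K K' r r' : ℕ} {x : ℝ}
    (h : Bd t y K r x) (hK : K ≤ K') (hr : r' ≤ r) :
    Bd t y K' r' x := by
  have := P.hy
  have := P.t_pos
  refine le_trans h (mul_le_mul (pow_le_pow_right₀ P.t_one hK)
    (pow_le_pow_of_le_one P.hy.le P.y_one hr) (by positivity) (by positivity))

lemma bd_add (P : Par n t y p) {K K' r r' : ℕ} {x x' : ℝ}
    (h : Bd t y K r x) (h' : Bd t y K' r' x') :
    Bd t y (max K K' + 1) (min r r') (x + x') := by
  have h1 := P.bd_mono h (le_max_left K K') (min_le_left r r')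
  have h2 := P.bd_mono h' (le_max_right K K') (min_le_right r r')
  unfold Bd at *
  have := P.hy
  have := P.t_pos
  have h3 : 0 ≤ t ^ (max K K') * y ^ (min r r') := by positivity
  calc |x + x'| ≤ |x| + |x'| := abs_add_le _ _
    _ ≤ 2 * (t ^ (max K K') * y ^ (min r r')) := by linarith
    _ ≤ t * (t ^ (max K K') * y ^ (min r r')) :=
        mul_le_mul_of_nonneg_right (by linarith [P.ht]) h3
    _ = _ := by ring

lemma bd_sub (P : Par n t y p) {K K' r r' : ℕ} {x x' : ℝ}
    (h : Bd t y K r x) (h' : Bd t y K' r' x') :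
    Bd t y (max K K' + 1) (min r r') (x - x') := by
  rw [sub_eq_add_neg]
  exact P.bd_add h (by unfold Bd at *; rwa [abs_neg])

end Par

lemma Bd.mul {t y : ℝ} {K K' r r' : ℕ} {x x' : ℝ} (h : Bd t y K r x) (h' : Bd t y K' r' x') :
    Bd t y (K + K') (r + r') (x * x') := by
  unfold Bd at *
  rw [abs_mul, pow_add, pow_add]
  calc |x| * |x'| ≤ (t ^ K * y ^ r) * (t ^ K' * y ^ r') :=
        mul_le_mul h h' (abs_nonneg _) ((abs_nonneg _).trans h)
    _ = _ := by ring

lemma Bd.neg {t y : ℝ} {K r : ℕ} {x : ℝ} (h : Bd t y K r x) : Bd t y K r (-x) := by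
  unfold Bd at *; rwa [abs_neg]

/-- Number of common neighbours. -/
def cod (H : SimpleGraph (Fin n)) (a b : Fin n) : ℝ := ∑ v, adj H a v * adj H b v

lemma cod_nonneg (H : SimpleGraph (Fin n)) (a b : Fin n) : 0 ≤ cod H a b :=
  sum_nonneg fun _ _ => mul_nonneg (adj_nonneg _ _ _) (adj_nonneg _ _ _)

lemma cod_le (H : SimpleGraph (Fin n)) (a b : Fin n) : cod H a b ≤ n := by
  calc cod H a b ≤ ∑ _v : Fin n, (1 : ℝ) := sum_le_sum fun v _ =>
        mul_le_one₀ (adj_le_one _ _ _) (adj_nonneg _ _ _) (adj_le_one _ _ _)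
    _ = n := by simp

lemma cod_close {a b c : Fin n} {d : Fin n → ℝ} {F H : SimpleGraph (Fin n)}
    (hH : H ∈ cls d F) {τ : ℝ}
    (hg : |(#(leftSet a b c F H ∩ nbh H b) : ℝ) -
      #(leftSet a b c F H) * #(diffSet a b c F H ∩ nbh H b) / #(diffSet a b c F H)| ≤ τ) :
    |cod H a b - cod H c b| ≤ 2 * τ + |d a - d c| + 2 * (3 + fdeg F a + fdeg F c) := by
  set D := diffSet a b c F H with hD
  set A := leftSet a b c F H with hA
  set S := nbh H b with hS
  have hout : ∀ v, v ∉ D → |adj H a v - adj H c v| ≤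
      ev a v + ev b v + ev c v + adj F a v + adj F c v := by
    intro v hv
    have hnn : ∀ u, 0 ≤ ev u v := fun u => by unfold ev; split_ifs <;> norm_num
    have hle : |adj H a v - adj H c v| ≤ 1 := by
      rw [abs_le]; constructor <;>
      linarith [adj_nonneg H a v, adj_nonneg H c v, adj_le_one H a v, adj_le_one H c v]
    have hn1 := hnn a
    have hn2 := hnn b
    have hn3 := hnn c
    have hn4 := adj_nonneg F a v
    have hn5 := adj_nonneg F c v
    by_cases h1 : v = a
    · have : ev a v = 1 := by simp [ev, h1]
      linarith
    by_cases h2 : v = b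
    · have : ev b v = 1 := by simp [ev, h2]
      linarith
    by_cases h3 : v = c
    · have : ev c v = 1 := by simp [ev, h3]
      linarith
    by_cases h4 : F.Adj a v
    · have := adj_of h4
      linarith
    by_cases h5 : F.Adj c v
    · have := adj_of h5
      linarith
    have h6 : ¬ Xor (H.Adj a v) (H.Adj c v) := fun h => hv (by
      simp [hD, diffSet, h1, h2, h3, h4, h5, h])
    have : adj H a v = adj H c v := by
      unfold adj
      by_cases g1 : H.Adj a v <;> by_cases g2 : H.Adj c v <;> simp_all [Xor]
    rw [this, sub_self, abs_zero]
    linarith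
  have hres : ∀ w : Fin n → ℝ, (∀ v, |w v| ≤ 1) →
      |∑ v, (adj H a v - adj H c v) * w v - ∑ v ∈ D, (adj H a v - adj H c v) * w v| ≤
        3 + fdeg F a + fdeg F c := by
    intro w hw
    rw [← sum_sdiff (subset_univ D), add_sub_cancel_right]
    calc _ ≤ ∑ v ∈ univ \ D, |(adj H a v - adj H c v) * w v| := abs_sum_le_sum_abs _ _
      _ ≤ ∑ v ∈ univ \ D, (ev a v + ev b v + ev c v + adj F a v + adj F c v) := by
          refine sum_le_sum fun v hv => ?_
          rw [abs_mul]
          have h1 := hout v (by simpa using hv)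
          calc _ ≤ |adj H a v - adj H c v| * 1 :=
                mul_le_mul_of_nonneg_left (hw v) (abs_nonneg _)
            _ ≤ _ := by rw [mul_one]; exact h1
      _ ≤ ∑ v, (ev a v + ev b v + ev c v + adj F a v + adj F c v) := by
          refine sum_le_sum_of_subset_of_nonneg (subset_univ _) fun v _ _ => ?_
          have hnn : ∀ u, 0 ≤ ev u v := fun u => by unfold ev; split_ifs <;> norm_num
          have := adj_nonneg F a v
          have := adj_nonneg F c v
          have := hnn a
          have := hnn b
          have := hnn c
          linarith
      _ = _ := by simp only [sum_add_distrib, sum_ev, fdeg]; ring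
  have hDv : ∀ v ∈ D, adj H a v - adj H c v = 2 * ind A v - 1 := by
    intro v hv
    have h1 : Xor (H.Adj a v) (H.Adj c v) := by
      have : v ∈ diffSet a b c F H := hv
      simp only [diffSet, mem_filter] at this
      exact this.2.2.2.2.2.2
    have h2 : v ∈ A ↔ H.Adj a v := by rw [hA, leftSet, mem_filter]; simp [← hD, hv]
    unfold ind adj
    rcases h1 with ⟨h3, h4⟩ | ⟨h3, h4⟩ <;> simp [h2, h3, h4]; norm_num
  have hAD : A ⊆ D := filter_subset _ _
  have r1 := hres (fun _ => 1) (by simp)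
  have r2 := hres (fun v => adj H b v) (fun v => by
    rw [abs_of_nonneg (adj_nonneg _ _ _)]; exact adj_le_one _ _ _)
  have s1 : ∑ v, (adj H a v - adj H c v) * (1 : ℝ) = d a - d c := by
    rw [mem_cls] at hH
    simp only [mul_one, sum_sub_distrib]
    rw [← hH.1 a, ← hH.1 c]; rfl
  have s2 : ∑ v, (adj H a v - adj H c v) * adj H b v = cod H a b - cod H c b := by
    simp only [sub_mul, sum_sub_distrib]; rfl
  have s3 : ∑ v ∈ D, (adj H a v - adj H c v) * (1 : ℝ) = 2 * #A - #D := by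
    rw [sum_congr rfl (fun v hv => by rw [hDv v hv])]
    simp only [mul_one, sum_sub_distrib, ← mul_sum]
    simp [ind, inter_eq_right.mpr hAD]
  have s4 : ∑ v ∈ D, (adj H a v - adj H c v) * adj H b v = 2 * #(A ∩ S) - #(D ∩ S) := by
    have hb : ∀ v, adj H b v = ind S v := fun v => by simp [adj, ind, hS, nbh]
    rw [sum_congr rfl (fun v hv => by rw [hDv v hv, hb])]
    have : ∀ v, (2 * ind A v - 1) * ind S v = 2 * ind (A ∩ S) v - ind S v := fun v => by
      unfold ind
      by_cases g1 : v ∈ A <;> by_cases g2 : v ∈ S <;> simp [g1, g2]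
    simp only [this, sum_sub_distrib, ← mul_sum]
    have h1 : ∀ B : Finset (Fin n), ∑ v ∈ D, ind B v = #(D ∩ B) := fun B => by simp [ind]
    rw [h1, h1, inter_eq_right.mpr (inter_subset_left.trans hAD)]
  rw [s1, s3] at r1
  rw [s2, s4] at r2
  have key : |2 * (#(A ∩ S) : ℝ) - #(D ∩ S)| ≤ 2 * τ + |2 * (#A : ℝ) - #D| := by
    have hDS : (#(D ∩ S) : ℝ) ≤ #D := by exact_mod_cast card_le_card inter_subset_left
    have hAS : (#(A ∩ S) : ℝ) ≤ #(D ∩ S) := by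
      exact_mod_cast card_le_card (inter_subset_inter_right hAD)
    have hτ := (abs_nonneg _).trans hg
    rcases eq_or_lt_of_le (Nat.cast_nonneg (α := ℝ) #D) with h0 | h0
    · have h1 : (#(D ∩ S) : ℝ) = 0 := le_antisymm (by linarith) (Nat.cast_nonneg _)
      have h2 : (#(A ∩ S) : ℝ) = 0 := le_antisymm (by linarith) (Nat.cast_nonneg _)
      rw [h1, h2]; simp only [mul_zero, sub_zero, abs_zero]; positivity
    · have e1 : 2 * (#(A ∩ S) : ℝ) - #(D ∩ S) =
          2 * ((#(A ∩ S) : ℝ) - #A * #(D ∩ S) / #D) + #(D ∩ S) / #D * (2 * (#A : ℝ) - #D) := by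
        field_simp; ring
      rw [e1]
      refine (abs_add_le _ _).trans (add_le_add ?_ ?_)
      · rw [abs_mul, abs_two]; linarith
      · rw [abs_mul, abs_of_nonneg (by positivity)]
        have : (#(D ∩ S) : ℝ) / #D ≤ 1 := by rw [div_le_one h0]; exact hDS
        calc _ ≤ 1 * |2 * (#A : ℝ) - #D| := mul_le_mul_of_nonneg_right this (abs_nonneg _)
          _ = _ := one_mul _
  rw [abs_le] at r1 r2
  have g1 : |2 * (#A : ℝ) - #D| ≤ |d a - d c| + (3 + fdeg F a + fdeg F c) := by
    have := abs_le.mp (le_refl |d a - d c|)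
    rw [abs_le]; constructor <;> linarith
  have g2 := abs_le.mp key
  rw [abs_le]; constructor <;> linarith

end

section

variable {n : ℕ}

lemma conc {t y p c : ℝ} {d : Fin n → ℝ} {F : SimpleGraph (Fin n)} (N : Near t y p c d F)
    {a b : Fin n} (hab : a ≠ b) :
    (#((cls d F).filter fun H => t ^ 2 * y < |cod H a b * y ^ 2 - p ^ 2|) : ℝ) ≤
      y ^ 80 * #(cls d F) := by
  have P := N.par
  have hy := P.hy
  have ht := P.ht
  have hn := P.n_pos
  have hny := P.hny
  have hys := P.y_small
  have hty1 : t * y ≤ 1 := by simpa using P.pow_y (K := 1) (by norm_num)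
  have hc := N.hc
  have hc0 := N.hc0
  have hp0 := P.p_pos
  have hq0 := P.q_pos
  have hty0 : 0 < t * y := by nlinarith
  have hy2 : 1000 * y ^ 2 ≤ y := by nlinarith
  have hyty : 1000 * y ≤ t * y := by nlinarith
  set bad : Fin n → SimpleGraph (Fin n) → Prop := fun c H =>
    t / y < |(#(leftSet a b c F H ∩ nbh H b) : ℝ) -
      #(leftSet a b c F H) * #(diffSet a b c F H ∩ nbh H b) / #(diffSet a b c F H)| with hbad
  have hcy : c * y ^ 2 ≤ t * y := by nlinarith
  have hdev : ∀ v, |d v * y ^ 2 - p| ≤ 2 * (t * y) := fun v => (N.hd v).trans (by linarith)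
  have hfv : ∀ v, fdeg F v * y ^ 2 ≤ 2 * (t * y) := fun v => (N.hf v).trans (by linarith)
  have hgood : ∀ H ∈ cls d F, (∀ c, c ≠ a → c ≠ b → ¬ bad c H) →
      |cod H a b * y ^ 2 - p ^ 2| ≤ t ^ 2 * y := by
    intro H hH hg
    have h1 : ∀ c, |(cod H a b - cod H c b) * y ^ 2| ≤ 15 * (t * y) + (if c = b then 1 else 0) := by
      intro c
      rw [abs_mul, abs_of_pos (pow_pos hy 2)]
      by_cases hcb : c = b
      · subst hcb
        simp only [if_true]
        have : |cod H a c - cod H c c| ≤ n := by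
          rw [abs_le]; constructor <;>
          linarith [cod_nonneg H a c, cod_nonneg H c c, cod_le H a c, cod_le H c c]
        have := mul_le_mul_of_nonneg_right this (pow_pos hy 2).le
        rw [hny] at this
        linarith
      by_cases hca : c = a
      · subst hca
        simp [hcb]; positivity
      have h2 := cod_close hH (not_lt.mp (hg c hca hcb))
      have h3 := mul_le_mul_of_nonneg_right h2 (pow_pos hy 2).le
      refine h3.trans ?_
      have e1 : |d a - d c| * y ^ 2 ≤ 4 * (t * y) := by
        rw [← abs_of_pos (pow_pos hy 2), ← abs_mul]
        have h4 := abs_le.mp (hdev a)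
        have h5 := abs_le.mp (hdev c)
        rw [abs_le]; constructor <;> nlinarith
      have e2 : t / y * y ^ 2 = t * y := by field_simp
      have h4 := hfv a
      have h5 := hfv c
      simp only [hcb, if_false, add_zero]
      nlinarith
    have h2 : |∑ c, (cod H a b - cod H c b) * y ^ 2| ≤ n * (15 * (t * y)) + 1 := by
      refine (abs_sum_le_sum_abs _ _).trans ((sum_le_sum fun c _ => h1 c).trans ?_)
      rw [sum_add_distrib]; simp
    have hd : ∀ v, fdeg H v = d v := (mem_cls.mp hH).1
    have h3 : ∑ c, (cod H a b - cod H c b) * y ^ 2 =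
        n * (cod H a b * y ^ 2) - ∑ v, adj H b v * (d v * y ^ 2) := by
      rw [← sum_mul, sum_sub_distrib]
      have : ∑ c, cod H c b = ∑ v, adj H b v * d v := by
        unfold cod
        rw [sum_comm]
        refine sum_congr rfl fun v _ => ?_
        rw [← sum_mul, ← hd v, mul_comm]
        congr 1
        exact sum_congr rfl fun u _ => adj_comm _ _ _
      rw [this]
      simp only [sum_const, card_univ, Fintype.card_fin, nsmul_eq_mul, sub_mul, sum_mul, mul_assoc]
    have h4 : |∑ v, adj H b v * (d v * y ^ 2) - p * d b| ≤ n * (2 * (t * y)) := by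
      rw [← hd b, fdeg, mul_sum, ← sum_sub_distrib]
      calc _ ≤ ∑ v, |adj H b v * (d v * y ^ 2) - p * adj H b v| := abs_sum_le_sum_abs _ _
        _ ≤ ∑ _v : Fin n, 2 * (t * y) := by
            refine sum_le_sum fun v _ => ?_
            have : adj H b v * (d v * y ^ 2) - p * adj H b v =
              adj H b v * (d v * y ^ 2 - p) := by ring
            rw [this, abs_mul, abs_of_nonneg (adj_nonneg _ _ _)]
            calc _ ≤ 1 * |d v * y ^ 2 - p| :=
                  mul_le_mul_of_nonneg_right (adj_le_one _ _ _) (abs_nonneg _)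
              _ ≤ _ := by rw [one_mul]; exact hdev v
        _ = _ := by simp
    rw [h3] at h2
    have h5 : |n * (cod H a b * y ^ 2) - p * d b| ≤ n * (17 * (t * y)) + 1 := by
      rw [abs_le] at *; constructor <;> linarith
    have h6 := mul_le_mul_of_nonneg_right h5 (pow_pos hy 2).le
    rw [← abs_of_pos (pow_pos hy 2), ← abs_mul, abs_of_pos (pow_pos hy 2)] at h6
    have e1 : (n * (cod H a b * y ^ 2) - p * d b) * y ^ 2 =
        cod H a b * y ^ 2 - p * (d b * y ^ 2) := by
      linear_combination (cod H a b * y ^ 2) * hny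
    have e2 : (n * (17 * (t * y)) + 1) * y ^ 2 = 17 * (t * y) + y ^ 2 := by
      linear_combination (17 * (t * y)) * hny
    rw [e1, e2] at h6
    have h7 := abs_le.mp h6
    have h8 := abs_le.mp (hdev b)
    rw [abs_le]
    constructor <;> nlinarith
  have hsub : (cls d F).filter (fun H => t ^ 2 * y < |cod H a b * y ^ 2 - p ^ 2|) ⊆
      (univ.filter fun c => c ≠ a ∧ c ≠ b).biUnion fun c => (cls d F).filter (bad c) := by
    intro H hH
    rw [mem_filter] at hH
    by_contra hcon
    simp only [mem_biUnion, mem_filter, mem_univ, true_and, not_exists, not_and] at hcon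
    exact absurd hH.2 (not_lt.mpr (hgood H hH.1 fun c h1 h2 h3 => hcon c ⟨h1, h2⟩ hH.1 h3))
  have hτ : t / y ≤ 2 * n := by
    rw [P.n_eq, div_le_iff₀ hy]
    have : 2 * (y ^ 2)⁻¹ * y = 2 / y := by field_simp
    rw [this, le_div_iff₀ hy]; linarith
  calc (#((cls d F).filter fun H => t ^ 2 * y < |cod H a b * y ^ 2 - p ^ 2|) : ℝ)
      ≤ #((univ.filter fun c => c ≠ a ∧ c ≠ b).biUnion fun c => (cls d F).filter (bad c)) := by
        exact_mod_cast card_le_card hsub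
    _ ≤ ∑ c ∈ univ.filter (fun c => c ≠ a ∧ c ≠ b), (#((cls d F).filter (bad c)) : ℝ) := by
        exact_mod_cast card_biUnion_le
    _ ≤ ∑ c ∈ univ.filter (fun c : Fin n => c ≠ a ∧ c ≠ b), 2 * ((n : ℝ) + 1) *
          Real.exp (-((t / y) ^ 2 / (4 * n))) * #(cls d F) := by
        refine sum_le_sum fun c hc => ?_
        simp only [mem_filter, mem_univ, true_and] at hc
        exact resample_tail hc.1.symm hab.symm hc.2.symm d F (by positivity) hτ
    _ ≤ n * (2 * ((n : ℝ) + 1) * Real.exp (-((t / y) ^ 2 / (4 * n))) * #(cls d F)) := by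
        rw [sum_const, nsmul_eq_mul]
        refine mul_le_mul_of_nonneg_right ?_ (by positivity)
        have := card_le_univ (univ.filter (fun c : Fin n => c ≠ a ∧ c ≠ b))
        rw [Fintype.card_fin] at this
        exact_mod_cast this
    _ ≤ n * (2 * ((n : ℝ) + 1) * y ^ 100 * #(cls d F)) := by
        have : Real.exp (-((t / y) ^ 2 / (4 * n))) ≤ y ^ 100 := by
          refine le_trans (Real.exp_le_exp.mpr ?_) P.htail
          have : (t / y) ^ 2 / (4 * n) = t ^ 2 / 4 := by
            rw [P.n_eq]; field_simp
          rw [this]; nlinarith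
        gcongr
    _ ≤ _ := by
        have h1 : (1 : ℝ) ≤ n := by
          have : 0 < n := by exact_mod_cast hn
          exact_mod_cast this
        have h2 : n * (2 * ((n : ℝ) + 1) * y ^ 100) ≤ y ^ 80 := by
          calc n * (2 * ((n : ℝ) + 1) * y ^ 100) ≤ n * (2 * ((n : ℝ) + n) * y ^ 100) := by gcongr
            _ = 4 * ((n : ℝ) * y ^ 2) ^ 2 * y ^ 96 := by ring
            _ = 4 * y * y ^ 95 := by rw [hny]; ring
            _ ≤ 1 * y ^ 95 := by gcongr; linarith
            _ = y ^ 95 := one_mul _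
            _ ≤ y ^ 80 := pow_le_pow_of_le_one hy.le P.y_one (by norm_num)
        calc _ = n * (2 * ((n : ℝ) + 1) * y ^ 100) * #(cls d F) := by ring
          _ ≤ _ := mul_le_mul_of_nonneg_right h2 (by positivity)

end

section

variable {n : ℕ}

/-- Average of `g` over `cls d F` (zero if the class is empty). -/
def Ex (d : Fin n → ℝ) (F : SimpleGraph (Fin n)) (g : SimpleGraph (Fin n) → ℝ) : ℝ :=
  (∑ H ∈ cls d F, g H) / #(cls d F)

/-- Indicator that `uv` is a genuine pair not in `F`. -/
def gap (F : SimpleGraph (Fin n)) (u v : Fin n) : ℝ := 1 - adj F u v - ev u v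

/-- Centred edge indicator. -/
def zt (p : ℝ) (F H : SimpleGraph (Fin n)) (u v : Fin n) : ℝ := gap F u v * (adj H u v - p)

/-- Normalised excess degree. -/
def dl (y p : ℝ) (d : Fin n → ℝ) (F : SimpleGraph (Fin n)) (v : Fin n) : ℝ :=
  (d v - p * (n - 1 - fdeg F v)) * y ^ 2

section Ex

variable {d : Fin n → ℝ} {F : SimpleGraph (Fin n)} {g g' : SimpleGraph (Fin n) → ℝ}

lemma Ex_add : Ex d F (fun H => g H + g' H) = Ex d F g + Ex d F g' := by
  unfold Ex; rw [sum_add_distrib, add_div]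

lemma Ex_sub : Ex d F (fun H => g H - g' H) = Ex d F g - Ex d F g' := by
  unfold Ex; rw [sum_sub_distrib, sub_div]

lemma Ex_mul (a : ℝ) : Ex d F (fun H => a * g H) = a * Ex d F g := by
  unfold Ex; rw [← mul_sum, mul_div_assoc]

lemma Ex_sum {ι : Type*} (s : Finset ι) (g : ι → SimpleGraph (Fin n) → ℝ) :
    Ex d F (fun H => ∑ i ∈ s, g i H) = ∑ i ∈ s, Ex d F (g i) := by
  unfold Ex; rw [sum_comm, sum_div]

lemma Ex_congr (h : ∀ H ∈ cls d F, g H = g' H) : Ex d F g = Ex d F g' := by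
  unfold Ex; rw [sum_congr rfl h]

lemma Ex_mul_card : Ex d F g * #(cls d F) = ∑ H ∈ cls d F, g H := by
  unfold Ex
  rcases (cls d F).eq_empty_or_nonempty with h | h
  · simp [h]
  · have : (#(cls d F) : ℝ) ≠ 0 := by exact_mod_cast h.card_pos.ne'
    field_simp

lemma abs_Ex_le {b : ℝ} (hb : 0 ≤ b) (h : ∀ H ∈ cls d F, |g H| ≤ b) : |Ex d F g| ≤ b := by
  unfold Ex
  rw [abs_div, abs_of_nonneg (Nat.cast_nonneg (α := ℝ) _)]
  refine div_le_of_le_mul₀ (Nat.cast_nonneg _) hb ?_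
  calc _ ≤ ∑ H ∈ cls d F, |g H| := abs_sum_le_sum_abs _ _
    _ ≤ ∑ H ∈ cls d F, b := sum_le_sum h
    _ = _ := by rw [sum_const, nsmul_eq_mul, mul_comm]

lemma abs_Ex_le_of_sum {b : ℝ} (hb : 0 ≤ b) (h : |∑ H ∈ cls d F, g H| ≤ b * #(cls d F)) :
    |Ex d F g| ≤ b := by
  unfold Ex
  rw [abs_div, abs_of_nonneg (Nat.cast_nonneg (α := ℝ) _)]
  exact div_le_of_le_mul₀ (Nat.cast_nonneg _) hb h

lemma bd_Ex {t y p : ℝ} (P : Par n t y p) {K r : ℕ} (h : ∀ H ∈ cls d F, Bd t y K r (g H)) :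
    Bd t y K r (Ex d F g) :=
  abs_Ex_le (by have := P.hy; have := P.t_pos; positivity) h

lemma Ex_const (hne : (cls d F).Nonempty) (a : ℝ) : Ex d F (fun _ => a) = a := by
  unfold Ex
  have : (#(cls d F) : ℝ) ≠ 0 := by exact_mod_cast hne.card_pos.ne'
  rw [sum_const, nsmul_eq_mul]; field_simp

end Ex

section pointwise

variable {d : Fin n → ℝ} {F H : SimpleGraph (Fin n)}

lemma gap_comm (F : SimpleGraph (Fin n)) (u v : Fin n) : gap F u v = gap F v u := by
  unfold gap ev; rw [adj_comm]; simp only [eq_comm]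

lemma zt_comm (p : ℝ) (F H : SimpleGraph (Fin n)) (u v : Fin n) :
    zt p F H u v = zt p F H v u := by
  unfold zt; rw [gap_comm, adj_comm]

lemma gap_cases (F : SimpleGraph (Fin n)) (u v : Fin n) :
    (gap F u v = 1 ∧ u ≠ v ∧ ¬ F.Adj u v) ∨ (gap F u v = 0 ∧ (u = v ∨ F.Adj u v)) := by
  unfold gap
  by_cases h : u = v
  · right; subst h; simp [ev]
  · by_cases h2 : F.Adj u v
    · right; simp [ev, h2, adj_of h2, Ne.symm h]
    · left; simp [ev, h, h2, adj_of_not h2, Ne.symm h]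

lemma adj_eq_gap (hH : H ∈ cls d F) (p : ℝ) (u v : Fin n) :
    adj H u v = gap F u v * p + zt p F H u v := by
  unfold zt
  rcases gap_cases F u v with ⟨h, -⟩ | ⟨h, h2 | h2⟩
  · rw [h]; ring
  · rw [h]; subst h2; simp
  · rw [h, adj_of_not ((mem_cls.mp hH).2 u v h2)]; ring

lemma sum_gap (F : SimpleGraph (Fin n)) (u : Fin n) : ∑ v, gap F u v = n - 1 - fdeg F u := by
  unfold gap fdeg
  rw [sum_sub_distrib, sum_sub_distrib, sum_ev]
  simp only [sum_const, card_univ, Fintype.card_fin, nsmul_eq_mul, mul_one]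
  ring

lemma abs_zt_le {p : ℝ} (h0 : 0 ≤ p) (h1 : p ≤ 1) (u v : Fin n) : |zt p F H u v| ≤ 1 := by
  unfold zt
  have h2 := adj_nonneg H u v
  have h3 := adj_le_one H u v
  rcases gap_cases F u v with ⟨h, -⟩ | ⟨h, -⟩ <;> rw [h]
  · rw [one_mul, abs_le]; constructor <;> linarith
  · simp

lemma sum_zt (hH : H ∈ cls d F) (p : ℝ) (u : Fin n) :
    ∑ v, zt p F H u v = d u - p * (n - 1 - fdeg F u) := by
  have h1 : ∀ v, zt p F H u v = adj H u v - p * gap F u v := fun v => by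
    rw [adj_eq_gap hH p u v]; ring
  simp only [h1]
  rw [sum_sub_distrib, ← mul_sum, sum_gap, ← (mem_cls.mp hH).1 u]; rfl

lemma mov_eq (a b : Fin n) (F H : SimpleGraph (Fin n)) :
    mov a b F H = ∑ v, adj H a v * (1 - adj H b v) * gap F b v := by
  unfold mov
  refine sum_congr rfl fun v _ => ?_
  unfold adj
  rcases gap_cases F b v with ⟨h, h1, h2⟩ | ⟨h, h1 | h1⟩
  · rw [h]; by_cases g1 : H.Adj a v <;> by_cases g2 : H.Adj b v <;> simp [g1, g2, h1.symm, h2]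
  · rw [h]; subst h1; simp
  · rw [h]; simp [h1]

lemma sum_mul_gap (g : Fin n → ℝ) (F : SimpleGraph (Fin n)) (u : Fin n) :
    ∑ v, g v * gap F u v = ∑ v, g v - ∑ v, adj F u v * g v - g u := by
  unfold gap
  simp only [mul_sub, mul_one, sum_sub_distrib, sum_mul_ev]
  simp only [mul_comm]

/-- Difference of the numbers of moves in both directions. -/
lemma mov_sub_mov (hH : H ∈ cls d F) (p : ℝ) (k l : Fin n) :
    mov l k F H - mov k l F H = ∑ v, zt p F H l v - ∑ v, zt p F H k v
      - ∑ v, adj F k v * zt p F H l v + ∑ v, adj F l v * zt p F H k v := by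
  have h1 : mov l k F H - mov k l F H =
      ∑ v, zt p F H l v * gap F k v - ∑ v, zt p F H k v * gap F l v := by
    rw [mov_eq, mov_eq, ← sum_sub_distrib, ← sum_sub_distrib]
    refine sum_congr rfl fun v _ => ?_
    have e1 : adj H l v = adj H l v * gap F l v := by
      rw [adj_eq_gap hH p]; unfold zt
      rcases gap_cases F l v with ⟨h, -⟩ | ⟨h, -⟩ <;> rw [h] <;> ring
    have e2 : adj H k v = adj H k v * gap F k v := by
      rw [adj_eq_gap hH p]; unfold zt
      rcases gap_cases F k v with ⟨h, -⟩ | ⟨h, -⟩ <;> rw [h] <;> ring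
    unfold zt
    linear_combination adj H l v * e2 - adj H k v * e1 + gap F k v * e1 - gap F l v * e2
  rw [h1, sum_mul_gap, sum_mul_gap, zt_comm p F H l k]
  ring

/-- The number of moves, expanded in centred edge indicators. -/
lemma mov_expand (hH : H ∈ cls d F) (p : ℝ) (k l : Fin n) :
    mov k l F H = p * (1 - p) * ∑ v, gap F k v * gap F l v
      + (1 - p) * (∑ v, zt p F H k v - ∑ v, adj F l v * zt p F H k v - zt p F H k l)
      - p * (∑ v, zt p F H l v - ∑ v, adj F k v * zt p F H l v - zt p F H k l)
      - ∑ v, zt p F H k v * zt p F H l v := by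
  rw [zt_comm p F H k l]
  conv_rhs => rw [← zt_comm p F H k l]
  rw [← sum_mul_gap]
  conv_rhs => rw [zt_comm p F H k l]
  rw [← sum_mul_gap, mov_eq, mul_sum, mul_sum, mul_sum, ← sum_add_distrib, ← sum_sub_distrib,
    ← sum_sub_distrib]
  refine sum_congr rfl fun v _ => ?_
  have e1 : adj H l v = adj H l v * gap F l v := by
    rw [adj_eq_gap hH p]; unfold zt
    rcases gap_cases F l v with ⟨h, -⟩ | ⟨h, -⟩ <;> rw [h] <;> ring
  have e2 : (1 - adj H l v) * gap F l v = (1 - p) * gap F l v - zt p F H l v := by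
    unfold zt; ring
  rw [mul_assoc, e2, adj_eq_gap hH p k v]
  have e3 : zt p F H l v = zt p F H l v * gap F l v := by
    unfold zt
    rcases gap_cases F l v with ⟨h, -⟩ | ⟨h, -⟩ <;> rw [h] <;> ring
  ring

end pointwise

end

section

variable {n : ℕ}

lemma ev_nonneg (j v : Fin n) : 0 ≤ ev j v := by unfold ev; split_ifs <;> norm_num

lemma ev_le_one (j v : Fin n) : ev j v ≤ 1 := by unfold ev; split_ifs <;> norm_num

lemma ev_ne {j v : Fin n} (h : v ≠ j) : ev j v = 0 := by simp [ev, h]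

lemma ev_self (j : Fin n) : ev j j = 1 := by simp [ev]

section Bd

variable {t y p : ℝ}

lemma Bd.of_eq {K r : ℕ} {x x' : ℝ} (h : Bd t y K r x) (e : x' = x) : Bd t y K r x' := e ▸ h

lemma bd_of_le_one {x : ℝ} (hx : |x| ≤ 1) : Bd t y 0 0 x := by unfold Bd; simpa using hx

namespace Par

lemma bd_zero (P : Par n t y p) {K r : ℕ} : Bd t y K r 0 := by
  have := P.hy; have := P.t_pos
  unfold Bd; rw [abs_zero]; positivity

lemma bd_sum (P : Par n t y p) {K r : ℕ} {g : Fin n → ℝ} (h : ∀ v, Bd t y K r (g v)) :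
    Bd t y K r (y ^ 2 * ∑ v, g v) := by
  unfold Bd at *
  have hy := pow_pos P.hy 2
  rw [abs_mul, abs_of_pos hy]
  calc _ ≤ y ^ 2 * ∑ _v : Fin n, t ^ K * y ^ r := mul_le_mul_of_nonneg_left
        ((abs_sum_le_sum_abs _ _).trans (sum_le_sum fun v _ => h v)) hy.le
    _ = (n * y ^ 2) * (t ^ K * y ^ r) := by simp; ring
    _ = _ := by rw [P.hny, one_mul]

lemma kap_pos (P : Par n t y p) : 0 < p * (1 - p) := mul_pos P.p_pos P.q_pos

lemma bd_kinv (P : Par n t y p) : Bd t y 2 0 (p * (1 - p))⁻¹ :=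
  (P.bd_pinv.mul P.bd_qinv).of_eq (by rw [mul_inv])

lemma kap_ge (P : Par n t y p) : 1 ≤ t ^ 2 * (p * (1 - p)) := by
  nlinarith [mul_le_mul P.hp0 P.hp1 (by norm_num) (by linarith [P.hp0])]

end Par

end Bd

namespace Near

variable {t y p c : ℝ} {d : Fin n → ℝ} {F : SimpleGraph (Fin n)}

lemma mono (N : Near t y p c d F) {c' : ℝ} (h : c ≤ c') (h' : c' ≤ 100) : Near t y p c' d F := by
  have h2 := mul_le_mul_of_nonneg_right h (pow_pos N.par.hy 2).le
  have h4 := mul_le_mul_of_nonneg_right h (pow_pos N.par.hy 4).le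
  exact ⟨N.par, N.hc0.trans h, h', fun v => (N.hd v).trans (by linarith),
    fun v => (N.hf v).trans (by linarith), N.hF.trans (by linarith), N.hS.trans (by linarith)⟩

lemma sub_ev (N : Near t y p c d F) (hc : c + 1 ≤ 100) (k : Fin n) :
    Near t y p (c + 1) (d - ev k) F := by
  have hy2 := pow_pos N.par.hy 2
  have hy4 := pow_pos N.par.hy 4
  refine ⟨N.par, by linarith [N.hc0], hc, fun v => ?_, fun v => (N.hf v).trans (by linarith),
    N.hF.trans (by linarith), ?_⟩
  · have h0 := mul_nonneg (ev_nonneg k v) hy2.le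
    have h1 := mul_le_mul_of_nonneg_right (ev_le_one k v) hy2.le
    have h2 := abs_le.mp (N.hd v)
    rw [Pi.sub_apply, abs_le]; constructor <;> nlinarith
  · have e : ∑ v, ((d - ev k) v * y ^ 2 - p) = ∑ v, (d v * y ^ 2 - p) - y ^ 2 := by
      simp only [Pi.sub_apply, sub_mul, sum_sub_distrib, ← sum_mul, sum_ev]; ring
    rw [e]
    have h1 : |∑ v, (d v * y ^ 2 - p) - y ^ 2| ≤ |∑ v, (d v * y ^ 2 - p)| + y ^ 2 := by
      refine (abs_sub _ _).trans ?_
      rw [abs_of_pos hy2]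
    have h2 := N.hS
    nlinarith

lemma addE (N : Near t y p c d F) (hc : c + 2 ≤ 100) {j k : Fin n} (hjk : j ≠ k)
    (hF : ¬ F.Adj j k) : Near t y p (c + 2) d (addE F j k) := by
  have hy2 := pow_pos N.par.hy 2
  have hy4 := pow_pos N.par.hy 4
  refine ⟨N.par, by linarith [N.hc0], hc, fun v => (N.hd v).trans (by linarith), fun v => ?_, ?_,
    N.hS.trans (by linarith)⟩
  · rw [fdeg_addE hjk hF]
    have h1 := mul_le_mul_of_nonneg_right (ev_le_one j v) hy2.le
    have h2 := mul_le_mul_of_nonneg_right (ev_le_one k v) hy2.le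
    nlinarith [N.hf v]
  · simp only [fdeg_addE hjk hF, sum_add_distrib, sum_ev]
    nlinarith [N.hF]

lemma cy (N : Near t y p c d F) : t * y + c * y ^ 2 ≤ 2 * (t * y) := by
  have P := N.par
  have := mul_le_mul_of_nonneg_right N.hc (pow_pos P.hy 2).le
  nlinarith [P.y_small, P.hy, P.ht]

lemma bd_d (N : Near t y p c d F) (v : Fin n) : Bd t y 2 1 (d v * y ^ 2 - p) := by
  have P := N.par
  refine ((N.hd v).trans N.cy).trans ?_
  have := mul_pos P.t_pos P.hy
  nlinarith [P.ht]

lemma bd_f (N : Near t y p c d F) (v : Fin n) : Bd t y 2 1 (fdeg F v * y ^ 2) := by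
  have P := N.par
  unfold Bd
  rw [abs_of_nonneg (mul_nonneg (fdeg_nonneg _ _) (pow_pos P.hy 2).le)]
  refine ((N.hf v).trans N.cy).trans ?_
  have := mul_pos P.t_pos P.hy
  nlinarith [P.ht]

lemma bd_F (N : Near t y p c d F) : Bd t y 3 0 (y ^ 2 * ∑ v, fdeg F v) := by
  have P := N.par
  have hy2 := pow_pos P.hy 2
  unfold Bd
  rw [abs_of_nonneg (mul_nonneg hy2.le (sum_nonneg fun v _ => fdeg_nonneg F v))]
  have h1 : (y ^ 2 * ∑ v, fdeg F v) * y ^ 2 ≤ (t ^ 2 + c * y ^ 2) * y ^ 2 := by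
    linarith [N.hF]
  have h2 := le_of_mul_le_mul_right h1 hy2
  have := mul_le_mul_of_nonneg_right N.hc hy2.le
  nlinarith [P.y_small, P.hy, P.ht, sq_nonneg t]

lemma bd_dl (N : Near t y p c d F) (v : Fin n) : Bd t y 4 1 (dl y p d F v) := by
  have P := N.par
  have h := P.bd_add (P.bd_add (N.bd_d v) (P.bd_p.mul (N.bd_f v))) (P.bd_p.mul (P.bd_y 2))
  refine (P.bd_mono h (by norm_num) (by norm_num)).of_eq ?_
  unfold dl
  linear_combination -p * P.hny

lemma bd_S (N : Near t y p c d F) : Bd t y 6 2 (y ^ 2 * ∑ v, dl y p d F v) := by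
  have P := N.par
  have h1 : Bd t y 3 2 (y ^ 2 * ∑ v, (d v * y ^ 2 - p)) := by
    unfold Bd
    have hy2 := pow_pos P.hy 2
    rw [abs_mul, abs_of_pos hy2, mul_comm]
    refine N.hS.trans ?_
    have := mul_le_mul_of_nonneg_right N.hc hy2.le
    have h7 : c * y ^ 2 ≤ 1 := by nlinarith [P.y_small, P.hy]
    have h5 := mul_le_mul_of_nonneg_right h7 hy2.le
    have h6 : t ^ 2 + 1 ≤ t ^ 3 := by nlinarith [P.ht, sq_nonneg t]
    have h8 := mul_le_mul_of_nonneg_right h6 hy2.le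
    linarith
  have h := P.bd_add (P.bd_add h1 (P.bd_p.mul (N.bd_F.mul (P.bd_y 2)))) (P.bd_p.mul (P.bd_y 2))
  refine (P.bd_mono h (by norm_num) (by norm_num)).of_eq ?_
  have e : ∀ v, dl y p d F v = (d v * y ^ 2 - p) + p * y ^ 2 * fdeg F v + p * y ^ 2 := fun v => by
    unfold dl; linear_combination -p * P.hny
  simp only [e, sum_add_distrib, ← mul_sum, sum_const, card_univ, Fintype.card_fin, nsmul_eq_mul]
  linear_combination p * y ^ 2 * P.hny

lemma bd_adj_sum (N : Near t y p c d F) (k : Fin n) {K r : ℕ} {g : Fin n → ℝ}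
    (h : ∀ v, Bd t y K r (g v)) :
    Bd t y (K + 2) (r + 1) (y ^ 2 * ∑ v, adj F k v * g v) := by
  have P := N.par
  have hy2 := pow_pos P.hy 2
  have h0 : 0 ≤ t ^ K * y ^ r := (abs_nonneg _).trans (h k)
  have h1 := N.bd_f k
  unfold Bd at *
  rw [abs_of_nonneg (mul_nonneg (fdeg_nonneg _ _) hy2.le)] at h1
  rw [abs_mul, abs_of_pos hy2]
  calc _ ≤ y ^ 2 * ∑ v, adj F k v * (t ^ K * y ^ r) := by
        refine mul_le_mul_of_nonneg_left ((abs_sum_le_sum_abs _ _).trans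
          (sum_le_sum fun v _ => ?_)) hy2.le
        rw [abs_mul, abs_of_nonneg (adj_nonneg _ _ _)]
        exact mul_le_mul_of_nonneg_left (h v) (adj_nonneg _ _ _)
    _ = (fdeg F k * y ^ 2) * (t ^ K * y ^ r) := by rw [← sum_mul]; unfold fdeg; ring
    _ ≤ (t ^ 2 * y ^ 1) * (t ^ K * y ^ r) := mul_le_mul_of_nonneg_right h1 h0
    _ = _ := by ring

end Near

end

section

variable {n : ℕ} {t y p c : ℝ} {d : Fin n → ℝ} {F H : SimpleGraph (Fin n)}

/-- The number of moves is close to its typical value when codegrees are. -/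
lemma mov_close (N : Near t y p c d F) (hH : H ∈ cls d F) {k l : Fin n}
    (hg : |cod H k l * y ^ 2 - p ^ 2| ≤ t ^ 2 * y) :
    |mov k l F H * y ^ 2 - p * (1 - p)| ≤ t ^ 3 * y ∧
    |(mov k l F H + 1) * y ^ 2 - p * (1 - p)| ≤ t ^ 3 * y := by
  have P := N.par
  have hy2 := pow_pos P.hy 2
  have h1 : d k - cod H k l - mov k l F H =
      ∑ v, adj H k v * (1 - adj H l v) * (adj F l v + ev l v) := by
    rw [mov_eq, ← (mem_cls.mp hH).1 k]
    unfold cod fdeg gap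
    rw [← sum_sub_distrib, ← sum_sub_distrib]
    exact sum_congr rfl fun v _ => by ring
  have hterm : ∀ v, 0 ≤ adj H k v * (1 - adj H l v) ∧ adj H k v * (1 - adj H l v) ≤ 1 := fun v =>
    ⟨mul_nonneg (adj_nonneg _ _ _) (by linarith [adj_le_one H l v]),
      mul_le_one₀ (adj_le_one _ _ _) (by linarith [adj_le_one H l v])
        (by linarith [adj_nonneg H l v])⟩
  have h2 : 0 ≤ d k - cod H k l - mov k l F H := by
    rw [h1]
    exact sum_nonneg fun v _ => mul_nonneg (hterm v).1 (add_nonneg (adj_nonneg _ _ _)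
      (ev_nonneg _ _))
  have h3 : d k - cod H k l - mov k l F H ≤ fdeg F l + 1 := by
    rw [h1]
    calc _ ≤ ∑ v, (adj F l v + ev l v) := sum_le_sum fun v _ =>
          mul_le_of_le_one_left (add_nonneg (adj_nonneg _ _ _) (ev_nonneg _ _)) (hterm v).2
      _ = _ := by rw [sum_add_distrib, sum_ev]; rfl
  have h4 := mul_le_mul_of_nonneg_right h3 hy2.le
  have h5 := mul_nonneg h2 hy2.le
  have h6 := (N.hf l).trans N.cy
  have h7 := abs_le.mp ((N.hd k).trans N.cy)
  have h8 := abs_le.mp hg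
  have hys : y ^ 2 ≤ t * y := by nlinarith [P.y_small, P.hy, P.ht]
  have ht3 : t ^ 2 * y + 10 * (t * y) ≤ t ^ 3 * y := by
    have : t ^ 2 + 10 * t ≤ t ^ 3 := by nlinarith [P.ht, sq_nonneg t]
    nlinarith [mul_le_mul_of_nonneg_right this P.hy.le]
  constructor <;> rw [abs_le] <;> constructor <;> nlinarith

set_option maxHeartbeats 800000 in
/-- Comparison of two classes whose degree sequences differ by moving a unit of degree. -/
lemma ratio_core (N : Near t y p c d F) (hc : c + 1 ≤ 100) {k l : Fin n} (hkl : k ≠ l)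
    {K s : ℕ} (hK : K ≤ 100) (hs : s ≤ 3) (ψ : SimpleGraph (Fin n) → ℝ)
    (h1 : ∀ H ∈ cls (d - ev k) F, |(mov k l F H + 1) * y ^ 2 - p * (1 - p)| ≤ t ^ 3 * y →
      Bd t y K s ((mov l k F H - mov k l F H - 1) / (mov k l F H + 1) - ψ H))
    (h2 : ∀ H ∈ cls (d - ev k) F, Bd t y K 1 (ψ H)) {R e : ℝ} (he : 0 ≤ e)
    (hR : |Ex (d - ev k) F (fun H => ψ H - R)| ≤ e) :
    ∃ r, (#(cls (d - ev l) F) : ℝ) = #(cls (d - ev k) F) * (1 + r) ∧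
      |r - R| ≤ e + t ^ (K + 1) * y ^ s := by
  have P := N.par
  have hy := P.hy
  have ht := P.ht
  have hy2 := pow_pos P.hy 2
  have Nk := N.sub_ev hc k
  have Nl := N.sub_ev hc l
  set A := cls (d - ev k) F with hA
  set B := cls (d - ev l) F with hB
  have hκ : t ^ 3 * y < p * (1 - p) := by
    have h3 := P.kap_ge
    have h4 := P.pow_y (K := 6) (by norm_num)
    have h5 := P.t_pos
    by_contra hcon
    rw [not_lt] at hcon
    have h6 := mul_le_mul_of_nonneg_left hcon (pow_pos h5 2).le
    have h7 : t ^ 2 * (t ^ 3 * y) * t ≤ 1 := by linarith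
    nlinarith
  set good : ℝ → Prop := fun x => |x * y ^ 2 - p * (1 - p)| ≤ t ^ 3 * y with hgood
  have hpos : ∀ x, good x → 0 < x := fun x hx => by
    have h3 := (abs_le.mp hx).1
    by_contra hcon
    have h4 : x * y ^ 2 ≤ 0 := mul_nonpos_of_nonpos_of_nonneg (not_lt.mp hcon) hy2.le
    linarith
  have id := move_identity hkl.symm d F (fun x => if good x then 1 / x else 0)
  have eB : ∑ H ∈ B, mov k l F H * (if good (mov k l F H) then 1 / mov k l F H else 0) =
      #(B.filter fun H => good (mov k l F H)) := by
    rw [card_filter]; push_cast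
    refine sum_congr rfl fun H _ => ?_
    split_ifs with h
    · have := hpos _ h; field_simp
    · simp
  have cB : (#B : ℝ) - #(B.filter fun H => good (mov k l F H)) ≤ y ^ 80 * #B := by
    have h3 := card_filter_add_card_filter_not (s := B) (fun H => good (mov k l F H))
    have h4 : (#(B.filter fun H => ¬ good (mov k l F H)) : ℝ) ≤ y ^ 80 * #B := by
      refine le_trans ?_ (conc Nl hkl)
      norm_cast
      refine card_le_card fun H hH => ?_
      rw [mem_filter] at hH ⊢
      refine ⟨hH.1, ?_⟩
      by_contra hcon
      exact hH.2 (mov_close Nl hH.1 (not_lt.mp hcon)).1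
    have h5 : (#(B.filter fun H => good (mov k l F H)) : ℝ) +
      #(B.filter fun H => ¬ good (mov k l F H)) = #B := by exact_mod_cast h3
    linarith
  have cB' : (#(B.filter fun H => good (mov k l F H)) : ℝ) ≤ #B := by
    exact_mod_cast card_filter_le _ _
  have cA : (#(A.filter fun H => ¬ good (mov k l F H + 1)) : ℝ) ≤ y ^ 80 * #A := by
    refine le_trans ?_ (conc Nk hkl)
    norm_cast
    refine card_le_card fun H hH => ?_
    rw [mem_filter] at hH ⊢
    refine ⟨hH.1, ?_⟩
    by_contra hcon
    exact hH.2 (mov_close Nk hH.1 (not_lt.mp hcon)).2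
  have hKy : t ^ K * y ^ 1 ≤ 1 := by rw [pow_one]; exact P.pow_y (by linarith)
  have hKs : 0 < t ^ K * y ^ s := by have := P.t_pos; positivity
  have eA : |∑ H ∈ A, mov l k F H * (if good (mov k l F H + 1) then 1 / (mov k l F H + 1) else 0)
      - ∑ H ∈ A, (1 + ψ H)| ≤ (t ^ K * y ^ s + 2 * y ^ 80) * #A := by
    rw [← sum_sub_distrib]
    calc _ ≤ ∑ H ∈ A, (t ^ K * y ^ s + 2 * if ¬ good (mov k l F H + 1) then 1 else 0) := by
          refine (abs_sum_le_sum_abs _ _).trans (sum_le_sum fun H hH => ?_)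
          by_cases hg : good (mov k l F H + 1)
          · have h3 := hpos _ hg
            have h4 := h1 H hH hg
            have e1 : mov l k F H * (1 / (mov k l F H + 1)) - (1 + ψ H) =
                (mov l k F H - mov k l F H - 1) / (mov k l F H + 1) - ψ H := by
              field_simp; ring
            simp only [hg, if_true, not_true, if_false]
            rw [e1]
            simpa [Bd] using h4
          · simp only [hg, if_false, not_false_eq_true, if_true, mul_zero, zero_sub, abs_neg]
            have h4 : |ψ H| ≤ 1 := (h2 H hH).trans hKy
            have h5 := abs_le.mp h4
            have h6 : |1 + ψ H| ≤ 2 := by rw [abs_le]; constructor <;> linarith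
            linarith
      _ = t ^ K * y ^ s * #A + 2 * #(A.filter fun H => ¬ good (mov k l F H + 1)) := by
          rw [sum_add_distrib, sum_const, nsmul_eq_mul, card_filter]; push_cast
          rw [mul_sum]; ring
      _ ≤ _ := by linarith
  have id' : ∑ H ∈ A, mov l k F H * (if good (mov k l F H + 1) then 1 / (mov k l F H + 1) else 0)
      = ∑ H ∈ B, mov k l F H * (if good (mov k l F H) then 1 / mov k l F H else 0) := id
  rw [id', eB] at eA
  have sA : ∑ H ∈ A, (1 + ψ H) = #A * (1 + Ex (d - ev k) F ψ) := by
    rw [sum_add_distrib, mul_add, mul_comm _ (Ex _ _ _), Ex_mul_card]; simp [hA]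
  rw [sA] at eA
  have y80 : y ^ 80 ≤ y ^ s := pow_le_pow_of_le_one hy.le P.y_one (by linarith)
  have y80' : y ^ 80 ≤ 1 / 1000 := by
    calc y ^ 80 ≤ y ^ 1 := pow_le_pow_of_le_one hy.le P.y_one (by norm_num)
      _ ≤ _ := by linarith [P.y_small]
  have hys : 0 < y ^ s := pow_pos hy s
  have tK : 1 ≤ t ^ K := one_le_pow₀ P.t_one
  have hyt : t ^ K * y ^ s ≤ t ^ K := by
    have := pow_le_one₀ hy.le P.y_one (n := s); nlinarith
  rcases A.eq_empty_or_nonempty with hemp | hne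
  · refine ⟨R, ?_, ?_⟩
    · rw [hemp] at eA ⊢
      simp only [card_empty, Nat.cast_zero, zero_mul, sub_zero, mul_zero] at eA ⊢
      rw [abs_le] at eA
      have hBn := Nat.cast_nonneg (α := ℝ) #B
      nlinarith
    · rw [sub_self, abs_zero]; have := P.t_pos; positivity
  · have hApos : (0 : ℝ) < #A := by exact_mod_cast hne.card_pos
    refine ⟨#B / #A - 1, by field_simp; ring, ?_⟩
    have hEψ : |Ex (d - ev k) F ψ| ≤ 1 := (bd_Ex P h2).trans hKy
    have hExR : Ex (d - ev k) F (fun H => ψ H - R) = Ex (d - ev k) F ψ - R := by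
      rw [Ex_sub, Ex_const hne]
    rw [hExR] at hR
    set E := Ex (d - ev k) F ψ
    have h3 := abs_le.mp eA
    have h4 := abs_le.mp hEψ
    have hy80 : 0 < y ^ 80 := pow_pos hy 80
    have hys1 : y ^ s ≤ 1 := pow_le_one₀ hy.le P.y_one
    have hBA : (#B : ℝ) ≤ 8 * t ^ K * #A := by
      have g1 := mul_le_mul_of_nonneg_right hyt hApos.le
      have g2 := mul_le_mul_of_nonneg_right tK hApos.le
      have g3 := mul_le_mul_of_nonneg_right y80' (Nat.cast_nonneg (α := ℝ) #B)
      have g4 := mul_le_mul_of_nonneg_right y80' hApos.le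
      have g5 := mul_le_mul_of_nonneg_left h4.2 hApos.le
      linarith
    have hyB : y ^ 80 * #B ≤ 8 * t ^ K * y ^ s * #A := by
      calc y ^ 80 * #B ≤ y ^ s * (8 * t ^ K * #A) := by gcongr
        _ = _ := by ring
    have hyA : y ^ 80 * #A ≤ t ^ K * y ^ s * #A := by
      have : y ^ 80 ≤ t ^ K * y ^ s := by nlinarith
      gcongr
    have h5 : |(#B : ℝ) - #A * (1 + E)| ≤ 11 * (t ^ K * y ^ s) * #A := by
      rw [abs_le]; constructor <;> linarith
    have h6 : |(#B : ℝ) / #A - 1 - E| ≤ 11 * (t ^ K * y ^ s) := by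
      have e1 : (#B : ℝ) / #A - 1 - E = (#B - #A * (1 + E)) / #A := by field_simp; ring
      rw [e1, abs_div, abs_of_pos hApos, div_le_iff₀ hApos]
      exact h5
    have h7 : 11 * (t ^ K * y ^ s) ≤ t ^ (K + 1) * y ^ s := by
      rw [pow_succ]; nlinarith
    have h8 := abs_le.mp h6
    have h9 := abs_le.mp hR
    rw [abs_le]; constructor <;> linarith

end

section

variable {n : ℕ} {d : Fin n → ℝ} {F H : SimpleGraph (Fin n)}

lemma gap_addE {j k : Fin n} (hjk : j ≠ k) (hF : ¬ F.Adj j k) (u v : Fin n) :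
    gap (addE F j k) u v = gap F u v - (ev j u * ev k v + ev k u * ev j v) := by
  unfold gap; rw [adj_addE hjk hF]; ring

lemma adj_mul_gap (hH : H ∈ cls d F) (u v : Fin n) : gap F u v * adj H u v = adj H u v := by
  rw [adj_eq_gap hH 0]; unfold zt
  rcases gap_cases F u v with ⟨h, -⟩ | ⟨h, -⟩ <;> rw [h] <;> ring

lemma card_cls_eq (d : Fin n → ℝ) (F : SimpleGraph (Fin n)) :
    (#(cls d F) : ℝ) = ∑ _H ∈ cls d F, (1 : ℝ) := by simp

/-- Double counting around a pair `jk`, comparing with all pairs `jl`. -/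
lemma pair_identity (hne : (cls d F).Nonempty) {j k : Fin n} (hjk : j ≠ k) (hF : ¬ F.Adj j k)
    (p : ℝ) (r : Fin n → ℝ)
    (hr : ∀ l, j ≠ l → ¬ (addE F j k).Adj j l →
      (#(cls (d - ev j - ev l) (addE (addE F j k) j l)) : ℝ) =
        #(cls (d - ev j - ev k) (addE (addE F j k) j l)) * (1 + r l)) :
    (n - 1 - fdeg F j) * Ex d F (fun H => zt p F H j k) = (d j - p * (n - 1 - fdeg F j)) -
      ∑ l, gap (addE F j k) j l * Ex d F (fun H => adj H j k * (1 - adj H j l)) * r l := by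
  set F' := addE F j k with hF'
  have hN : (#(cls d F) : ℝ) ≠ 0 := by exact_mod_cast hne.card_pos.ne'
  have s2 : ∀ l, j ≠ l → ¬ F'.Adj j l → ∑ H ∈ cls d F, adj H j k * (1 - adj H j l) =
      #(cls (d - ev j - ev k) (addE F' j l)) := by
    intro l hl hFl
    have hkl : l ≠ k := by rintro rfl; exact hFl (by rw [hF', addE_adj hjk]; tauto)
    rw [sum_cls_adj hjk hF, card_cls_eq, ← sum_cls_nadj hl]
    refine sum_congr rfl fun H hH => ?_
    have h0 : ¬ H.Adj j k := (mem_cls.mp hH).2 j k (by rw [addE_adj hjk]; tauto)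
    rw [adj_addE hjk h0]; simp [ev, hkl, hjk]
  have s3 : ∀ l, j ≠ l → ¬ F'.Adj j l → ∑ H ∈ cls d F', adj H j l =
      #(cls (d - ev j - ev l) (addE F' j l)) := by
    intro l hl hFl
    rw [card_cls_eq, ← sum_cls_adj hl hFl (fun _ => 1)]; simp
  have s4 : ∑ l, gap F' j l * ∑ H ∈ cls d F', adj H j l = d j * #(cls d F') := by
    simp only [mul_sum]
    rw [sum_comm]
    rw [sum_congr rfl (fun H hH => (sum_congr rfl (fun l _ => adj_mul_gap hH j l)).trans
      ((mem_cls.mp hH).1 j))]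
    simp [mul_comm]
  have s5 : ∑ l, gap F' j l * ∑ H ∈ cls d F, adj H j k * (1 - adj H j l) =
      (n - 1 - fdeg F j - d j) * ∑ H ∈ cls d F, adj H j k := by
    simp only [mul_sum]
    rw [sum_comm]
    refine sum_congr rfl fun H hH => ?_
    have e1 : ∀ l, gap F' j l * (adj H j k * (1 - adj H j l)) =
        adj H j k * (gap F j l - ev k l - gap F j l * adj H j l + ev k l * adj H j l) := fun l => by
      rw [hF', gap_addE hjk hF]
      have h1 : ev j j = 1 := ev_self j
      have h2 : ev k j = 0 := ev_ne hjk
      rw [h1, h2]; ring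
    simp only [e1]
    rw [← mul_sum, sum_add_distrib, sum_sub_distrib, sum_sub_distrib, sum_gap, sum_ev, sum_ev_mul,
      sum_congr rfl (fun l _ => adj_mul_gap hH j l)]
    have h3 : ∑ l, adj H j l = d j := (mem_cls.mp hH).1 j
    rw [h3]
    linear_combination adj_sq H j k
  have s6 : (#(cls d F') : ℝ) = ∑ H ∈ cls d F, (1 - adj H j k) := by
    rw [card_cls_eq, ← sum_cls_nadj hjk]; simp
  have s7 : ∀ l, gap F' j l * ∑ H ∈ cls d F', adj H j l = gap F' j l *
      (∑ H ∈ cls d F, adj H j k * (1 - adj H j l)) + gap F' j l *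
      (∑ H ∈ cls d F, adj H j k * (1 - adj H j l)) * r l := by
    intro l
    rcases gap_cases F' j l with ⟨h, h1, h2⟩ | ⟨h, -⟩
    · rw [s2 l h1 h2, s3 l h1 h2, hr l h1 h2]; ring
    · rw [h]; ring
  have s8 : ∑ l, gap F' j l * ∑ H ∈ cls d F', adj H j l = ∑ l, gap F' j l *
      (∑ H ∈ cls d F, adj H j k * (1 - adj H j l)) + ∑ l, gap F' j l *
      (∑ H ∈ cls d F, adj H j k * (1 - adj H j l)) * r l := by
    rw [← sum_add_distrib]; exact sum_congr rfl fun l _ => s7 l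
  rw [s4, s5, s6, sum_sub_distrib, ← card_cls_eq] at s8
  have e2 : Ex d F (fun H => zt p F H j k) = (∑ H ∈ cls d F, adj H j k) / #(cls d F) - p := by
    have : ∀ H, zt p F H j k = adj H j k - p := fun H => by
      unfold zt gap; rw [adj_of_not hF, ev_ne hjk.symm]; ring
    simp only [this]
    rw [Ex_sub, Ex_const hne]; rfl
  have e3 : ∑ l, gap F' j l * Ex d F (fun H => adj H j k * (1 - adj H j l)) * r l =
      (∑ l, gap F' j l * (∑ H ∈ cls d F, adj H j k * (1 - adj H j l)) * r l) / #(cls d F) := by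
    rw [sum_div]; refine sum_congr rfl fun l _ => ?_
    unfold Ex; ring
  rw [e2, e3]
  field_simp
  linear_combination -s8

/-- Conditioning on whether `jk` is an edge. -/
lemma sum_zt_mul {j k : Fin n} (hjk : j ≠ k) (hF : ¬ F.Adj j k) (p : ℝ)
    (g : SimpleGraph (Fin n) → ℝ) :
    ∑ H ∈ cls d F, zt p F H j k * g H =
      (1 - p) * ∑ H ∈ cls (d - ev j - ev k) (addE F j k), g (addE H j k) -
        p * ∑ H ∈ cls d (addE F j k), g H := by
  rw [← sum_cls_adj hjk hF, ← sum_cls_nadj hjk, mul_sum, mul_sum, ← sum_sub_distrib]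
  refine sum_congr rfl fun H _ => ?_
  have : zt p F H j k = adj H j k - p := by
    unfold zt gap; rw [adj_of_not hF, ev_ne hjk.symm]; ring
  rw [this]; ring

lemma zt_addE {j k u v : Fin n} (hjk : j ≠ k) (hF : ¬ F.Adj j k) (p : ℝ)
    (h1 : ¬ (u = j ∧ v = k)) (h2 : ¬ (u = k ∧ v = j)) (H : SimpleGraph (Fin n)) :
    zt p (addE F j k) H u v = zt p F H u v := by
  have e : ev j u * ev k v + ev k u * ev j v = 0 := by
    unfold ev
    by_cases a1 : u = j <;> by_cases a2 : v = k <;> by_cases a3 : u = k <;> by_cases a4 : v = j <;>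
      simp_all
  unfold zt; rw [gap_addE hjk hF, e, sub_zero]

lemma zt_addE_addE {j k u v : Fin n} (hjk : j ≠ k) (hF : ¬ F.Adj j k) (p : ℝ)
    (h1 : ¬ (u = j ∧ v = k)) (h2 : ¬ (u = k ∧ v = j)) (hH : H ∈ cls d (addE F j k)) :
    zt p F (addE H j k) u v = zt p (addE F j k) H u v := by
  rw [zt_addE hjk hF p h1 h2]
  have e : ev j u * ev k v + ev k u * ev j v = 0 := by
    unfold ev
    by_cases a1 : u = j <;> by_cases a2 : v = k <;> by_cases a3 : u = k <;> by_cases a4 : v = j <;>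
      simp_all
  unfold zt
  rw [adj_addE hjk ((mem_cls.mp hH).2 j k (by rw [addE_adj hjk]; tauto)), e, add_zero]

end

section

variable {n : ℕ} {t y p c : ℝ} {d : Fin n → ℝ} {F H : SimpleGraph (Fin n)}

lemma dl_sub_ev (y p : ℝ) (d : Fin n → ℝ) (F : SimpleGraph (Fin n)) (k v : Fin n) :
    dl y p (d - ev k) F v = dl y p d F v - ev k v * y ^ 2 := by
  unfold dl; rw [Pi.sub_apply]; ring

lemma dl_addE (y p : ℝ) (d : Fin n → ℝ) {j k : Fin n} (hjk : j ≠ k) (hF : ¬ F.Adj j k)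
    (v : Fin n) : dl y p d (addE F j k) v = dl y p d F v + p * (ev j v + ev k v) * y ^ 2 := by
  unfold dl; rw [fdeg_addE hjk hF]; ring

/-- Normalised difference of the numbers of moves. -/
def dd (y : ℝ) (F : SimpleGraph (Fin n)) (k l : Fin n) (H : SimpleGraph (Fin n)) : ℝ :=
  (mov l k F H - mov k l F H - 1) * y ^ 2

/-- Normalised number of moves. -/
def kk (y : ℝ) (F : SimpleGraph (Fin n)) (k l : Fin n) (H : SimpleGraph (Fin n)) : ℝ :=
  (mov k l F H + 1) * y ^ 2

/-- Correction to the difference of the numbers of moves caused by forbidden pairs. -/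
def cr (y p : ℝ) (F : SimpleGraph (Fin n)) (k l : Fin n) (H : SimpleGraph (Fin n)) : ℝ :=
  y ^ 2 * ∑ v, adj F l v * zt p F H k v - y ^ 2 * ∑ v, adj F k v * zt p F H l v

lemma sum_zt_sub_ev {k : Fin n} (hH : H ∈ cls (d - ev k) F) (u : Fin n) :
    y ^ 2 * ∑ v, zt p F H u v = dl y p d F u - ev k u * y ^ 2 := by
  rw [sum_zt hH]; unfold dl; rw [Pi.sub_apply]; ring

lemma dd_eq {k l : Fin n} (hkl : k ≠ l) (hH : H ∈ cls (d - ev k) F) :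
    dd y F k l H = dl y p d F l - dl y p d F k + cr y p F k l H := by
  unfold dd cr
  rw [mov_sub_mov hH p]
  have h1 := sum_zt_sub_ev (y := y) (p := p) hH l
  have h2 := sum_zt_sub_ev (y := y) (p := p) hH k
  rw [ev_ne hkl.symm] at h1
  rw [ev_self] at h2
  linear_combination h1 - h2

lemma bd_zt (P : Par n t y p) (u v : Fin n) : Bd t y 0 0 (zt p F H u v) :=
  bd_of_le_one (abs_zt_le P.p_pos.le (by linarith [P.q_pos]) u v)

lemma bd_cr (N : Near t y p c d F) (k l : Fin n) (H : SimpleGraph (Fin n)) :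
    Bd t y 3 1 (cr y p F k l H) :=
  N.par.bd_sub (N.bd_adj_sum l fun v => bd_zt N.par k v) (N.bd_adj_sum k fun v => bd_zt N.par l v)

lemma bd_dd (N : Near t y p c d F) {k l : Fin n} (hkl : k ≠ l) (hH : H ∈ cls (d - ev k) F) :
    Bd t y 6 1 (dd y F k l H) :=
  (N.par.bd_mono (N.par.bd_add (N.par.bd_sub (N.bd_dl l) (N.bd_dl k)) (bd_cr N k l H))
    (by norm_num) (by norm_num)).of_eq (dd_eq hkl hH)

lemma bd_good_inv (P : Par n t y p) {x : ℝ} (hx : |x - p * (1 - p)| ≤ t ^ 3 * y) :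
    0 < x ∧ Bd t y 3 0 x⁻¹ := by
  have h1 := P.kap_ge
  have h2 := P.pow_y (K := 6) (by norm_num)
  have h3 := P.t_pos
  have h4 := (abs_le.mp hx).1
  have h5 : 1 / 2 ≤ t ^ 2 * x := by
    have h6 : t * (t ^ 2 * (t ^ 3 * y)) ≤ 1 := by linarith
    have h7 : t ^ 2 * (t ^ 3 * y) ≤ 1 / 2 := by
      have : 0 < t ^ 2 * (t ^ 3 * y) := by have := P.hy; positivity
      nlinarith [P.ht]
    have := mul_le_mul_of_nonneg_left h4 (pow_pos h3 2).le
    linarith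
  have h8 : 0 < x := by
    by_contra hcon
    have := mul_nonpos_of_nonneg_of_nonpos (pow_pos h3 2).le (not_lt.mp hcon)
    linarith
  refine ⟨h8, ?_⟩
  unfold Bd
  rw [abs_of_pos (inv_pos.mpr h8), inv_le_iff_one_le_mul₀ h8, pow_zero, mul_one]
  nlinarith [P.ht]

lemma dd_div_kk (P : Par n t y p) (k l : Fin n) (H : SimpleGraph (Fin n)) :
    (mov l k F H - mov k l F H - 1) / (mov k l F H + 1) = dd y F k l H * (kk y F k l H)⁻¹ := by
  unfold dd kk
  have := (pow_pos P.hy 2).ne'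
  rw [← div_eq_mul_inv, mul_div_mul_right _ _ this]

/-- First-order form of the comparison of classes. -/
lemma ratio_one (N : Near t y p c d F) (hc : c + 1 ≤ 100) {k l : Fin n} (hkl : k ≠ l)
    {R e : ℝ} (he : 0 ≤ e)
    (hR : |Ex (d - ev k) F (fun H => dd y F k l H * (p * (1 - p))⁻¹ - R)| ≤ e) :
    ∃ r, (#(cls (d - ev l) F) : ℝ) = #(cls (d - ev k) F) * (1 + r) ∧
      |r - R| ≤ e + t ^ 16 * y ^ 2 := by
  have P := N.par
  refine ratio_core N hc hkl (K := 15) (s := 2) (by norm_num) (by norm_num)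
    (fun H => dd y F k l H * (p * (1 - p))⁻¹) (fun H hH hg => ?_) (fun H hH => ?_) he hR
  · obtain ⟨h1, h2⟩ := bd_good_inv P hg
    have h3 : Bd t y 3 1 (kk y F k l H - p * (1 - p)) := by unfold Bd; rw [pow_one]; exact hg
    have h4 := (((bd_dd N hkl hH).mul h2).mul P.bd_kinv).mul h3.neg
    refine (P.bd_mono h4 (by norm_num) (by norm_num)).of_eq ?_
    rw [dd_div_kk P]
    have h5 := P.kap_pos.ne'
    unfold kk
    have h6 := h1.ne'
    have e1 : ((mov k l F H + 1) * y ^ 2)⁻¹ - (p * (1 - p))⁻¹ = ((mov k l F H + 1) * y ^ 2)⁻¹ *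
      (p * (1 - p))⁻¹ * -((mov k l F H + 1) * y ^ 2 - p * (1 - p)) := by
      rw [inv_sub_inv h6 h5, div_eq_mul_inv, mul_inv]; ring
    linear_combination dd y F k l H * e1
  · exact P.bd_mono ((bd_dd N hkl hH).mul P.bd_kinv) (by norm_num) (by norm_num)

lemma bd_two_terms (P : Par n t y p) {K K' M s : ℕ} {x : ℝ} (hK : K + 1 ≤ M) (hK' : K' + 1 ≤ M)
    {s' : ℕ} (hs : s ≤ s') (h : |x| ≤ t ^ K * y ^ s + t ^ K' * y ^ s') : Bd t y M s x := by
  have := P.hy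
  have := P.t_pos
  have h1 : Bd t y K s (t ^ K * y ^ s) := by
    unfold Bd; rw [abs_of_nonneg (by positivity)]
  have h2 : Bd t y K' s' (t ^ K' * y ^ s') := by
    unfold Bd; rw [abs_of_nonneg (by positivity)]
  have h3 : Bd t y M s (t ^ K * y ^ s + t ^ K' * y ^ s') :=
    P.bd_mono (P.bd_add h1 h2) (by omega) (by omega)
  exact h.trans ((le_abs_self _).trans h3)

lemma ratio_zero (N : Near t y p c d F) (hc : c + 1 ≤ 100) {k l : Fin n} (hkl : k ≠ l) :
    ∃ r, (#(cls (d - ev l) F) : ℝ) = #(cls (d - ev k) F) * (1 + r) ∧ Bd t y 18 1 r := by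
  have P := N.par
  have h1 : Bd t y 8 1 (Ex (d - ev k) F (fun H => dd y F k l H * (p * (1 - p))⁻¹ - 0)) :=
    bd_Ex P fun H hH => by
      rw [sub_zero]
      exact P.bd_mono ((bd_dd N hkl hH).mul P.bd_kinv) (by norm_num) (by norm_num)
  obtain ⟨r, h2, h3⟩ := ratio_one N hc hkl ((abs_nonneg _).trans h1) h1
  rw [sub_zero] at h3
  exact ⟨r, h2, bd_two_terms P (by norm_num) (by norm_num) (by norm_num) h3⟩

lemma Ex_empty (h : ¬ (cls d F).Nonempty) (g : SimpleGraph (Fin n) → ℝ) : Ex d F g = 0 := by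
  rw [not_nonempty_iff_eq_empty] at h
  unfold Ex; rw [h]; simp

lemma Ex_zero : Ex d F (fun _ => 0) = 0 := by unfold Ex; simp

lemma zt_eq_zero {u v : Fin n} (h : u = v ∨ F.Adj u v) (p : ℝ) (H : SimpleGraph (Fin n)) :
    zt p F H u v = 0 := by
  unfold zt
  rcases gap_cases F u v with ⟨-, h1, h2⟩ | ⟨h1, -⟩
  · exact absurd h (by tauto)
  · rw [h1, zero_mul]

lemma adj_addE_ne {j k l : Fin n} (hjk : j ≠ k) (h : ¬ (addE F j k).Adj j l) : k ≠ l := by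
  rintro rfl; exact h (by rw [addE_adj hjk]; tauto)

/-- Summing ratio estimates over all pairs `jl`. -/
lemma pair_step (N : Near t y p c d F) (hne : (cls d F).Nonempty)
    {j k : Fin n} (hjk : j ≠ k) (hF : ¬ F.Adj j k) (r : Fin n → ℝ)
    (hr : ∀ l, j ≠ l → ¬ (addE F j k).Adj j l →
      (#(cls (d - ev j - ev l) (addE (addE F j k) j l)) : ℝ) =
        #(cls (d - ev j - ev k) (addE (addE F j k) j l)) * (1 + r l)) :
    Ex d F (fun H => zt p F H j k) = dl y p d F j -
      y ^ 2 * ∑ l, gap (addE F j k) j l * Ex d F (fun H => adj H j k * (1 - adj H j l)) * r l +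
      (y ^ 2 + fdeg F j * y ^ 2) * Ex d F (fun H => zt p F H j k) := by
  have h1 := pair_identity hne hjk hF p r hr
  unfold dl
  linear_combination y ^ 2 * h1 - Ex d F (fun H => zt p F H j k) * N.par.hny

lemma bd_gap (F : SimpleGraph (Fin n)) (u v : Fin n) : Bd t y 0 0 (gap F u v) := by
  refine bd_of_le_one ?_
  rcases gap_cases F u v with ⟨h, -⟩ | ⟨h, -⟩ <;> rw [h] <;> simp

lemma bd_adj_adj (H : SimpleGraph (Fin n)) (j k l : Fin n) :
    Bd t y 0 0 (adj H j k * (1 - adj H j l)) := by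
  refine bd_of_le_one ?_
  have h1 := adj_nonneg H j k
  have h2 := adj_le_one H j k
  have h3 := adj_nonneg H j l
  have h4 := adj_le_one H j l
  rw [abs_of_nonneg (mul_nonneg h1 (by linarith))]
  exact mul_le_one₀ h2 (by linarith) (by linarith)

lemma Ex_zt_zero (N : Near t y p c d F) (hc : c + 6 ≤ 100) (j k : Fin n) :
    Bd t y 20 1 (Ex d F (fun H => zt p F H j k)) := by
  have P := N.par
  by_cases hne : (cls d F).Nonempty
  swap; · rw [Ex_empty hne]; exact P.bd_zero
  by_cases h0 : j = k ∨ F.Adj j k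
  · rw [Ex_congr fun H _ => zt_eq_zero h0 p H, Ex_zero]; exact P.bd_zero
  rw [not_or] at h0
  obtain ⟨hjk, hF⟩ := h0
  have hr : ∀ l, ∃ r, (j ≠ l → ¬ (addE F j k).Adj j l →
      (#(cls (d - ev j - ev l) (addE (addE F j k) j l)) : ℝ) =
        #(cls (d - ev j - ev k) (addE (addE F j k) j l)) * (1 + r)) ∧ Bd t y 18 1 r := by
    intro l
    by_cases h : j ≠ l ∧ ¬ (addE F j k).Adj j l
    · have hkl := adj_addE_ne hjk h.2
      have N' := (((N.sub_ev (by linarith) j).addE (by linarith) hjk hF).addE (by linarith) h.1 h.2)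
      obtain ⟨r, h1, h2⟩ := ratio_zero N' (by linarith) hkl
      exact ⟨r, fun _ _ => h1, h2⟩
    · exact ⟨0, fun h1 h2 => absurd ⟨h1, h2⟩ h, P.bd_zero⟩
  choose r hr1 hr2 using hr
  have h1 := pair_step N hne hjk hF r hr1
  set E := Ex d F (fun H => zt p F H j k)
  have h2 : Bd t y 18 1 (y ^ 2 * ∑ l, gap (addE F j k) j l *
      Ex d F (fun H => adj H j k * (1 - adj H j l)) * r l) :=
    P.bd_sum fun l => P.bd_mono (((bd_gap _ j l).mul (bd_Ex P fun H _ => bd_adj_adj H j k l)).mul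
      (hr2 l)) (by norm_num) (by norm_num)
  set W := y ^ 2 * ∑ l, gap (addE F j k) j l *
      Ex d F (fun H => adj H j k * (1 - adj H j l)) * r l
  have h3 : Bd t y 19 1 (dl y p d F j - W) := P.bd_mono (P.bd_sub (N.bd_dl j) h2) (by norm_num)
    (by norm_num)
  have h4 : |y ^ 2 + fdeg F j * y ^ 2| ≤ 1 / 2 := by
    have h5 := (N.hf j).trans N.cy
    have h6 := mul_nonneg (fdeg_nonneg F j) (pow_pos P.hy 2).le
    have h7 := P.y_small
    have h8 := P.pow_y (K := 2) (by norm_num)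
    rw [abs_of_nonneg (by positivity)]
    have : 1000 * (t * y) ≤ 1 := by nlinarith [mul_pos P.t_pos P.hy, P.ht]
    nlinarith [P.hy]
  have h5 : |E| ≤ 2 * |dl y p d F j - W| := by
    have h6 : |E| ≤ |dl y p d F j - W| + 1 / 2 * |E| := by
      calc |E| = |(dl y p d F j - W) + (y ^ 2 + fdeg F j * y ^ 2) * E| := by rw [← h1]
        _ ≤ |dl y p d F j - W| + |y ^ 2 + fdeg F j * y ^ 2| * |E| := by
            rw [← abs_mul]; exact abs_add_le _ _
        _ ≤ _ := by gcongr
    linarith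
  have h6 : |(2 : ℝ)| ≤ 1000 := by norm_num
  have h7 := (P.bd_const h6).mul h3
  refine P.bd_mono (h5.trans ?_) le_rfl le_rfl
  unfold Bd at h7
  rw [abs_mul, abs_two] at h7
  exact h7.trans (by norm_num)

/-- Conditioning on the pair `jk`. -/
lemma cond_step (P : Par n t y p) {j k : Fin n} (hjk : j ≠ k) (hF : ¬ F.Adj j k)
    {g g' : SimpleGraph (Fin n) → ℝ}
    (hA : ∀ H ∈ cls (d - ev j - ev k) (addE F j k), g (addE H j k) = g' H)
    (hB : ∀ H ∈ cls d (addE F j k), g H = g' H) {K r : ℕ}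
    (h1 : Bd t y K r (Ex (d - ev j - ev k) (addE F j k) g'))
    (h2 : Bd t y K r (Ex d (addE F j k) g')) :
    Bd t y K r (Ex d F (fun H => zt p F H j k * g H)) := by
  refine abs_Ex_le_of_sum ((abs_nonneg _).trans h1) ?_
  rw [sum_zt_mul hjk hF, sum_congr rfl hA, sum_congr rfl hB, ← Ex_mul_card, ← Ex_mul_card]
  have h3 : (#(cls d F) : ℝ) = #(cls (d - ev j - ev k) (addE F j k)) + #(cls d (addE F j k)) := by
    have e1 := sum_cls_adj hjk hF (d := d) (fun _ => 1)
    have e2 := sum_cls_nadj hjk (d := d) (F := F) (fun _ => 1)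
    rw [card_cls_eq, card_cls_eq, card_cls_eq, ← e1, ← e2, ← sum_add_distrib]
    exact sum_congr rfl fun _ _ => by ring
  rw [h3, mul_add]
  set a := Ex (d - ev j - ev k) (addE F j k) g'
  set b := Ex d (addE F j k) g'
  have hp := P.p_pos
  have hq := P.q_pos
  have hca := Nat.cast_nonneg (α := ℝ) #(cls (d - ev j - ev k) (addE F j k))
  have hcb := Nat.cast_nonneg (α := ℝ) #(cls d (addE F j k))
  refine (abs_sub _ _).trans (add_le_add ?_ ?_)
  · rw [abs_mul, abs_mul, abs_of_pos hq, abs_of_nonneg hca]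
    calc _ ≤ 1 * (|a| * (#(cls (d - ev j - ev k) (addE F j k)) : ℝ)) := by gcongr; linarith
      _ ≤ _ := by rw [one_mul]; exact mul_le_mul_of_nonneg_right h1 hca
  · rw [abs_mul, abs_mul, abs_of_pos hp, abs_of_nonneg hcb]
    calc _ ≤ 1 * (|b| * (#(cls d (addE F j k)) : ℝ)) := by gcongr; linarith
      _ ≤ _ := by rw [one_mul]; exact mul_le_mul_of_nonneg_right h2 hcb

end

section

variable {n : ℕ} {t y p c : ℝ} {d : Fin n → ℝ} {F H : SimpleGraph (Fin n)}

lemma Ex_sum_adj (G : SimpleGraph (Fin n)) (y : ℝ) (k : Fin n)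
    (g : Fin n → SimpleGraph (Fin n) → ℝ) :
    Ex d F (fun H => y ^ 2 * ∑ v, adj G k v * g v H) =
      y ^ 2 * ∑ v, adj G k v * Ex d F (g v) := by
  rw [Ex_mul, Ex_sum]
  congr 1
  exact sum_congr rfl fun v _ => Ex_mul _

lemma Ex_cr (N : Near t y p c d F) (hc : c + 7 ≤ 100) (k l : Fin n) :
    Bd t y 23 2 (Ex (d - ev k) F (cr y p F k l)) := by
  have P := N.par
  have Nk := N.sub_ev (by linarith) k
  have e : Ex (d - ev k) F (cr y p F k l) =
      y ^ 2 * ∑ v, adj F l v * Ex (d - ev k) F (fun H => zt p F H k v) -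
      y ^ 2 * ∑ v, adj F k v * Ex (d - ev k) F (fun H => zt p F H l v) := by
    rw [← Ex_sum_adj F y l (fun v H => zt p F H k v), ← Ex_sum_adj F y k (fun v H => zt p F H l v),
      ← Ex_sub]; rfl
  rw [e]
  exact P.bd_mono (P.bd_sub (N.bd_adj_sum l fun v => Ex_zt_zero Nk (by linarith) k v)
    (N.bd_adj_sum k fun v => Ex_zt_zero Nk (by linarith) l v)) (by norm_num) (by norm_num)

/-- Comparison of classes with second-order error. -/
lemma ratio_lin (N : Near t y p c d F) (hc : c + 7 ≤ 100) {k l : Fin n} (hkl : k ≠ l) :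
    ∃ r, (#(cls (d - ev l) F) : ℝ) = #(cls (d - ev k) F) * (1 + r) ∧
      Bd t y 28 2 (r - (dl y p d F l - dl y p d F k) * (p * (1 - p))⁻¹) := by
  have P := N.par
  have h1 : Bd t y 25 2 (Ex (d - ev k) F (fun H => dd y F k l H * (p * (1 - p))⁻¹ -
      (dl y p d F l - dl y p d F k) * (p * (1 - p))⁻¹)) := by
    refine (P.bd_kinv.mul (Ex_cr N hc k l)).of_eq ?_
    rw [← Ex_mul]
    exact Ex_congr fun H hH => by rw [dd_eq hkl hH]; ring
  obtain ⟨r, h2, h3⟩ := ratio_one N (by linarith) hkl ((abs_nonneg _).trans h1) h1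
  exact ⟨r, h2, bd_two_terms P (by norm_num) (by norm_num) (by norm_num) h3⟩

lemma dl_shift (y p : ℝ) (d : Fin n → ℝ) {j k l : Fin n} (hjk : j ≠ k) (hF : ¬ F.Adj j k)
    (hjl : j ≠ l) (hFl : ¬ (addE F j k).Adj j l) (v : Fin n) :
    dl y p (d - ev j) (addE (addE F j k) j l) v = dl y p d F v - ev j v * y ^ 2 +
      p * (2 * ev j v + ev k v + ev l v) * y ^ 2 := by
  rw [dl_addE y p _ hjl hFl, dl_addE y p _ hjk hF, dl_sub_ev]; ring

lemma near_two (N : Near t y p c d F) (hc : c + 5 ≤ 100) {j k l : Fin n} (hjk : j ≠ k)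
    (hF : ¬ F.Adj j k) (hjl : j ≠ l) (hFl : ¬ (addE F j k).Adj j l) :
    Near t y p (c + 5) (d - ev j) (addE (addE F j k) j l) :=
  (((N.sub_ev (by linarith) j).addE (by linarith) hjk hF).addE (by linarith) hjl hFl).mono
    (by linarith) hc

lemma near_one (N : Near t y p c d F) (hc : c + 4 ≤ 100) {j k : Fin n} (hjk : j ≠ k)
    (hF : ¬ F.Adj j k) : Near t y p (c + 4) (d - ev j - ev k) (addE F j k) :=
  (((N.sub_ev (by linarith) j).sub_ev (by linarith) k).addE (by linarith) hjk hF).mono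
    (by linarith) hc

lemma Ex_zt_mul_zero (j k : Fin n) (h : j = k ∨ F.Adj j k) (p : ℝ)
    (g : SimpleGraph (Fin n) → ℝ) : Ex d F (fun H => zt p F H j k * g H) = 0 := by
  rw [Ex_congr (g' := fun _ => 0) fun H _ => by rw [zt_eq_zero h p H, zero_mul], Ex_zero]

/-- Weak decorrelation of two pairs. -/
lemma dec_weak (N : Near t y p c d F) (hc : c + 10 ≤ 100) {j k u v : Fin n}
    (h1 : ¬ (u = j ∧ v = k)) (h2 : ¬ (u = k ∧ v = j)) :
    Bd t y 20 1 (Ex d F (fun H => zt p F H j k * zt p F H u v)) := by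
  have P := N.par
  by_cases h0 : j = k ∨ F.Adj j k
  · rw [Ex_zt_mul_zero j k h0]; exact P.bd_zero
  rw [not_or] at h0
  obtain ⟨hjk, hF⟩ := h0
  exact cond_step P hjk hF (g' := fun H => zt p (addE F j k) H u v)
    (fun H hH => zt_addE_addE hjk hF p h1 h2 hH) (fun H _ => (zt_addE hjk hF p h1 h2 H).symm)
    (Ex_zt_zero (near_one N (by linarith) hjk hF) (by linarith) u v)
    (Ex_zt_zero (N.addE (by linarith) hjk hF) (by linarith) u v)

lemma Ex_adj_adj (hne : (cls d F).Nonempty) (p : ℝ) {j k l : Fin n} (hjk : j ≠ k)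
    (hF : ¬ F.Adj j k) (hjl : j ≠ l) (hFl : ¬ F.Adj j l) :
    Ex d F (fun H => adj H j k * (1 - adj H j l)) = p * (1 - p) +
      (1 - p) * Ex d F (fun H => zt p F H j k) - p * Ex d F (fun H => zt p F H j l) -
      Ex d F (fun H => zt p F H j k * zt p F H j l) := by
  rw [← Ex_const hne (p * (1 - p)), ← Ex_mul, ← Ex_mul, ← Ex_add, ← Ex_sub, ← Ex_sub]
  refine Ex_congr fun H _ => ?_
  unfold zt gap
  rw [adj_of_not hF, adj_of_not hFl, ev_ne hjk.symm, ev_ne hjl.symm]; ring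

lemma sum_gap_addE {j k : Fin n} (hjk : j ≠ k) (hF : ¬ F.Adj j k) (g : Fin n → ℝ) :
    ∑ l, gap (addE F j k) j l * g l = ∑ l, g l - ∑ l, adj F j l * g l - g j - g k := by
  have e : ∀ l, gap (addE F j k) j l * g l = g l - adj F j l * g l - ev j l * g l - ev k l * g l :=
    fun l => by
      rw [gap_addE hjk hF, ev_self, ev_ne hjk]; unfold gap; ring
  simp only [e, sum_sub_distrib, sum_ev_mul]

lemma not_addE {j k l : Fin n} (hjk : j ≠ k) (h : ¬ (addE F j k).Adj j l) : ¬ F.Adj j l :=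
  fun h' => h (by rw [addE_adj hjk]; exact Or.inl h')

/-- Expectation of a centred edge indicator, with second-order error. -/
lemma Ex_zt_one (N : Near t y p c d F) (hc : c + 12 ≤ 100) {j k : Fin n} (hjk : j ≠ k)
    (hF : ¬ F.Adj j k) :
    Bd t y 56 2 (Ex d F (fun H => zt p F H j k - (dl y p d F j + dl y p d F k))) := by
  have P := N.par
  by_cases hne : (cls d F).Nonempty
  swap; · rw [Ex_empty hne]; exact P.bd_zero
  rw [Ex_sub, Ex_const hne]
  have hr : ∀ l, ∃ r, (j ≠ l → ¬ (addE F j k).Adj j l →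
      (#(cls (d - ev j - ev l) (addE (addE F j k) j l)) : ℝ) =
        #(cls (d - ev j - ev k) (addE (addE F j k) j l)) * (1 + r)) ∧
      Bd t y 28 2 (r - (dl y p d F l - dl y p d F k) * (p * (1 - p))⁻¹) := by
    intro l
    by_cases h : j ≠ l ∧ ¬ (addE F j k).Adj j l
    · have hkl := adj_addE_ne hjk h.2
      obtain ⟨r, h1, h2⟩ := ratio_lin (near_two N (by linarith) hjk hF h.1 h.2) (by linarith) hkl
      refine ⟨r, fun _ _ => h1, h2.of_eq ?_⟩
      rw [dl_shift y p d hjk hF h.1 h.2, dl_shift y p d hjk hF h.1 h.2, ev_ne hjk.symm,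
        ev_ne h.1.symm, ev_self, ev_self, ev_ne hkl, ev_ne hkl.symm]
      ring
    · exact ⟨_, fun h1 h2 => absurd ⟨h1, h2⟩ h, by rw [sub_self]; exact P.bd_zero⟩
  choose r hr1 hr2 using hr
  have h1 := pair_step N hne hjk hF r hr1
  have hz := Ex_zt_zero N (by linarith) j k
  have hκ := P.kap_pos.ne'
  have hrb : ∀ l, Bd t y 29 1 (r l) := fun l =>
    (P.bd_mono (P.bd_add (hr2 l) ((P.bd_sub (N.bd_dl l) (N.bd_dl k)).mul P.bd_kinv))
      (by norm_num) (by norm_num)).of_eq (by ring)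
  have h2 : ∀ l, Bd t y 53 2 (gap (addE F j k) j l *
      (Ex d F (fun H => adj H j k * (1 - adj H j l)) * r l - (dl y p d F l - dl y p d F k))) := by
    intro l
    rcases gap_cases (addE F j k) j l with ⟨h, hjl, hFl'⟩ | ⟨h, -⟩
    swap; · rw [h, zero_mul]; exact P.bd_zero
    have hFl := not_addE hjk hFl'
    have hkl := adj_addE_ne hjk hFl'
    rw [h, one_mul, Ex_adj_adj hne p hjk hF hjl hFl]
    have g1 := P.bd_sub (P.bd_sub (P.bd_q.mul hz)
      (P.bd_p.mul (Ex_zt_zero N (by linarith) j l)))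
      (dec_weak N (by linarith) (j := j) (k := k) (u := j) (v := l) (by tauto) (by tauto))
    have g2 := P.bd_add (g1.mul (hrb l)) ((P.bd_p.mul P.bd_q).mul (hr2 l))
    refine (P.bd_mono g2 (by norm_num) (by norm_num)).of_eq ?_
    have hk : p * (1 - p) * (p * (1 - p))⁻¹ = 1 := mul_inv_cancel₀ hκ
    linear_combination (dl y p d F l - dl y p d F k) * hk
  have h3 := P.bd_sum h2
  have e1 : y ^ 2 * ∑ l, gap (addE F j k) j l *
      Ex d F (fun H => adj H j k * (1 - adj H j l)) * r l = y ^ 2 * ∑ l, gap (addE F j k) j l *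
      (Ex d F (fun H => adj H j k * (1 - adj H j l)) * r l - (dl y p d F l - dl y p d F k)) +
      y ^ 2 * ∑ l, gap (addE F j k) j l * (dl y p d F l - dl y p d F k) := by
    rw [← mul_add, ← sum_add_distrib]
    congr 1
    exact sum_congr rfl fun l _ => by ring
  have e2 : ∑ l, (dl y p d F l - dl y p d F k) = ∑ l, dl y p d F l - n * dl y p d F k := by
    rw [sum_sub_distrib]; simp
  have e3 : ∑ l, adj F j l * (dl y p d F l - dl y p d F k) =
      ∑ l, adj F j l * dl y p d F l - fdeg F j * dl y p d F k := by
    simp only [mul_sub, sum_sub_distrib, ← sum_mul]; rfl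
  have e4 := sum_gap_addE hjk hF (fun l => dl y p d F l - dl y p d F k)
  rw [e2, e3] at e4
  rw [e1, e4] at h1
  have g3 := P.bd_add (P.bd_sub (P.bd_add (P.bd_add (P.bd_sub (N.bd_adj_sum j N.bd_dl) N.bd_S)
    ((P.bd_y 2).mul (P.bd_sub (N.bd_dl j) (N.bd_dl k)))) ((P.bd_add (P.bd_y 2) (N.bd_f j)).mul hz))
    ((N.bd_f j).mul (N.bd_dl k))) h3.neg
  refine (P.bd_mono g3 (by norm_num) (by norm_num)).of_eq ?_
  linear_combination h1 + dl y p d F k * P.hny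

end

section

variable {n : ℕ} {t y p c : ℝ} {d : Fin n → ℝ} {F H : SimpleGraph (Fin n)}

lemma bd_ev (j v : Fin n) : Bd t y 0 0 (ev j v) :=
  bd_of_le_one (by rw [abs_of_nonneg (ev_nonneg _ _)]; exact ev_le_one _ _)

lemma bd_adj (F : SimpleGraph (Fin n)) (j v : Fin n) : Bd t y 0 0 (adj F j v) :=
  bd_of_le_one (by rw [abs_of_nonneg (adj_nonneg _ _ _)]; exact adj_le_one _ _ _)

/-- `Ex_zt_one` with an approximate centre. -/
lemma Ex_zt_near (N : Near t y p c d F) (hc : c + 12 ≤ 100) {j k : Fin n} (hjk : j ≠ k)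
    (hF : ¬ F.Adj j k) {a : ℝ} (ha : Bd t y 4 2 (dl y p d F j + dl y p d F k - a)) :
    Bd t y 57 2 (Ex d F (fun H => zt p F H j k - a)) := by
  have P := N.par
  have h1 := Ex_zt_one N hc hjk hF
  have h2 : Bd t y 4 2 (Ex d F (fun _ => dl y p d F j + dl y p d F k - a)) := bd_Ex P fun _ _ => ha
  refine (P.bd_mono (P.bd_add h1 h2) (by norm_num) (by norm_num)).of_eq ?_
  rw [← Ex_add]
  exact Ex_congr fun H _ => by ring

/-- Decorrelation of two pairs. -/
lemma dec_two (N : Near t y p c d F) (hc : c + 16 ≤ 100) {j k u v : Fin n}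
    (h1 : ¬ (u = j ∧ v = k)) (h2 : ¬ (u = k ∧ v = j)) :
    Bd t y 58 2 (Ex d F (fun H => zt p F H j k * zt p F H u v)) := by
  have P := N.par
  by_cases h0 : j = k ∨ F.Adj j k
  · rw [Ex_zt_mul_zero j k h0]; exact P.bd_zero
  by_cases h0' : u = v ∨ F.Adj u v
  · rw [Ex_congr fun H _ => mul_comm _ _, Ex_zt_mul_zero u v h0']; exact P.bd_zero
  rw [not_or] at h0 h0'
  obtain ⟨hjk, hF⟩ := h0
  obtain ⟨huv, hF'⟩ := h0'
  have hF2 : ¬ (addE F j k).Adj u v := by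
    rw [addE_adj hjk]; rintro (h | h | h)
    · exact hF' h
    · exact h1 h
    · exact h2 h
  have e1 : Bd t y 57 2 (Ex d F (fun H => zt p F H j k *
      (zt p F H u v - (dl y p d F u + dl y p d F v)))) := by
    refine cond_step P hjk hF
      (g' := fun H => zt p (addE F j k) H u v - (dl y p d F u + dl y p d F v))
      (fun H hH => by rw [zt_addE_addE hjk hF p h1 h2 hH])
      (fun H _ => by rw [zt_addE hjk hF p h1 h2 H]) ?_ ?_
    · refine Ex_zt_near (near_one N (by linarith) hjk hF) (by linarith) huv hF2 ?_
      rw [dl_addE y p _ hjk hF, dl_addE y p _ hjk hF]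
      simp only [dl_sub_ev]
      have b1 := P.bd_add (P.bd_add (bd_ev (t := t) (y := y) j u) (bd_ev k u))
        (P.bd_add (bd_ev (t := t) (y := y) j v) (bd_ev k v))
      refine (P.bd_mono ((P.bd_q.mul b1).mul (P.bd_y 2)).neg (by norm_num) (by norm_num)).of_eq ?_
      ring
    · refine Ex_zt_near (N.addE (by linarith) hjk hF) (by linarith) huv hF2 ?_
      rw [dl_addE y p _ hjk hF, dl_addE y p _ hjk hF]
      have b1 := P.bd_add (P.bd_add (bd_ev (t := t) (y := y) j u) (bd_ev k u))
        (P.bd_add (bd_ev (t := t) (y := y) j v) (bd_ev k v))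
      refine (P.bd_mono ((P.bd_p.mul b1).mul (P.bd_y 2)) (by norm_num) (by norm_num)).of_eq ?_
      ring
  have e2 := (P.bd_add (N.bd_dl u) (N.bd_dl v)).mul (Ex_zt_zero N (by linarith) j k)
  refine (P.bd_mono (P.bd_add e1 e2) (by norm_num) (by norm_num)).of_eq ?_
  rw [← Ex_mul, ← Ex_add]
  exact Ex_congr fun H _ => by ring

/-- Decorrelation of three pairs, the first of which involves a forbidden one. -/
lemma dec_three (N : Near t y p c d F) (hc : c + 20 ≤ 100) {k l u v : Fin n} (hkl : k ≠ l)
    (hkv : F.Adj k v) :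
    Bd t y 58 2 (Ex d F (fun H => zt p F H l v * (zt p F H k u * zt p F H l u))) := by
  have P := N.par
  by_cases h0 : l = v ∨ F.Adj l v
  · rw [Ex_zt_mul_zero l v h0]; exact P.bd_zero
  rw [not_or] at h0
  obtain ⟨hlv, hF⟩ := h0
  by_cases h1 : k = u ∨ F.Adj k u
  · rw [Ex_congr (g' := fun _ => 0) fun H _ => by rw [zt_eq_zero h1 p H]; ring, Ex_zero]
    exact P.bd_zero
  by_cases h2 : l = u ∨ F.Adj l u
  · rw [Ex_congr (g' := fun _ => 0) fun H _ => by rw [zt_eq_zero h2 p H]; ring, Ex_zero]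
    exact P.bd_zero
  rw [not_or] at h1 h2
  have huv : u ≠ v := by rintro rfl; exact h1.2 hkv
  have a1 : ¬ (k = l ∧ u = v) := fun h => huv h.2
  have a2 : ¬ (k = v ∧ u = l) := fun h => h2.1 h.2.symm
  have a3 : ¬ (l = l ∧ u = v) := fun h => huv h.2
  have a4 : ¬ (l = v ∧ u = l) := fun h => h2.1 h.2.symm
  refine cond_step P hlv hF
    (g' := fun H => zt p (addE F l v) H k u * zt p (addE F l v) H l u)
    (fun H hH => by rw [zt_addE_addE hlv hF p a1 a2 hH, zt_addE_addE hlv hF p a3 a4 hH])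
    (fun H _ => by rw [zt_addE hlv hF p a1 a2 H, zt_addE hlv hF p a3 a4 H]) ?_ ?_
  · exact dec_two (near_one N (by linarith) hlv hF) (by linarith) (fun h => hkl h.1.symm)
      (fun h => h2.1 h.1)
  · exact dec_two (N.addE (by linarith) hlv hF) (by linarith) (fun h => hkl h.1.symm)
      (fun h => h2.1 h.1)

lemma abs_Ex_mul_le {g h : SimpleGraph (Fin n) → ℝ} {b : ℝ}
    (hg : ∀ H ∈ cls d F, |g H| ≤ b) :
    |Ex d F (fun H => g H * h H)| ≤ b * Ex d F (fun H => |h H|) := by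
  unfold Ex
  rw [abs_div, abs_of_nonneg (Nat.cast_nonneg (α := ℝ) _), ← mul_div_assoc, mul_sum]
  refine div_le_div_of_nonneg_right ?_ (Nat.cast_nonneg _)
  refine (abs_sum_le_sum_abs _ _).trans (sum_le_sum fun H hH => ?_)
  rw [abs_mul]
  exact mul_le_mul_of_nonneg_right (hg H hH) (abs_nonneg _)

lemma bd_kk (N : Near t y p c d F) (H : SimpleGraph (Fin n)) (k l : Fin n) :
    Bd t y 4 0 (kk y F k l H - p * (1 - p)) := by
  have P := N.par
  have h1 : Bd t y 0 0 (y ^ 2 * ∑ v, adj H k v * gap F l v * (1 - adj H l v)) := by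
    refine P.bd_sum fun v => ?_
    refine bd_of_le_one ?_
    have h1 := adj_nonneg H k v
    have h2 := adj_le_one H k v
    have h3 := adj_nonneg H l v
    have h4 := adj_le_one H l v
    rcases gap_cases F l v with ⟨h, -⟩ | ⟨h, -⟩ <;> rw [h]
    · rw [mul_one, abs_of_nonneg (mul_nonneg h1 (by linarith))]
      exact mul_le_one₀ h2 (by linarith) (by linarith)
    · simp
  refine (P.bd_mono (P.bd_sub (P.bd_add h1 (P.bd_y 2)) (P.bd_p.mul P.bd_q)) (by norm_num)
    (by norm_num)).of_eq ?_
  unfold kk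
  rw [mov_eq]
  have : ∀ v, adj H k v * gap F l v * (1 - adj H l v) = adj H k v * (1 - adj H l v) * gap F l v :=
    fun v => by ring
  simp only [this]
  ring

lemma Ex_abs_kk (N : Near t y p c d F) {k l : Fin n} (hkl : k ≠ l) :
    Bd t y 5 1 (Ex d F (fun H => |kk y F k l H - p * (1 - p)|)) := by
  have P := N.par
  have hy := P.hy
  have ht := P.t_pos
  have h1 := conc N hkl
  refine abs_Ex_le_of_sum (by positivity) ?_
  rw [abs_of_nonneg (sum_nonneg fun _ _ => abs_nonneg _)]
  rw [← sum_filter_add_sum_filter_not (cls d F) (fun H => t ^ 2 * y < |cod H k l * y ^ 2 - p ^ 2|)]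
  have h2 : ∑ H ∈ (cls d F).filter (fun H => t ^ 2 * y < |cod H k l * y ^ 2 - p ^ 2|),
      |kk y F k l H - p * (1 - p)| ≤ t ^ 4 * (y ^ 80 * #(cls d F)) := by
    refine (sum_le_card_nsmul _ _ (t ^ 4) fun H _ => ?_).trans ?_
    · simpa [Bd] using bd_kk N H k l
    · rw [nsmul_eq_mul, mul_comm]
      exact mul_le_mul_of_nonneg_left h1 (by positivity)
  have h3 : ∑ H ∈ (cls d F).filter (fun H => ¬ t ^ 2 * y < |cod H k l * y ^ 2 - p ^ 2|),
      |kk y F k l H - p * (1 - p)| ≤ t ^ 3 * y * #(cls d F) := by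
    refine (sum_le_card_nsmul _ _ (t ^ 3 * y) fun H hH => ?_).trans ?_
    · exact (mov_close N (mem_filter.mp hH).1 (not_lt.mp (mem_filter.mp hH).2)).2
    · rw [nsmul_eq_mul, mul_comm]
      refine mul_le_mul_of_nonneg_left ?_ (by positivity)
      exact_mod_cast card_le_card (filter_subset _ _)
  have h4 : y ^ 80 ≤ y ^ 1 := pow_le_pow_of_le_one hy.le P.y_one (by norm_num)
  have h5 : t ^ 3 + t ^ 4 ≤ t ^ 5 := by
    have := P.ht
    nlinarith [pow_pos ht 3, pow_pos ht 4]
  calc _ ≤ t ^ 4 * (y ^ 80 * #(cls d F)) + t ^ 3 * y * #(cls d F) := add_le_add h2 h3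
    _ ≤ t ^ 4 * (y ^ 1 * #(cls d F)) + t ^ 3 * y * #(cls d F) := by gcongr
    _ = (t ^ 3 + t ^ 4) * (y * #(cls d F)) := by ring
    _ ≤ t ^ 5 * (y * #(cls d F)) := by gcongr
    _ = _ := by ring

end

section

variable {n : ℕ} {t y p c : ℝ} {d : Fin n → ℝ} {F H : SimpleGraph (Fin n)}

lemma sum_gap_mul_gap (F : SimpleGraph (Fin n)) {k l : Fin n} (hkl : k ≠ l) :
    ∑ v, gap F k v * gap F l v =
      n - 2 - fdeg F k - fdeg F l + ∑ v, adj F k v * adj F l v + 2 * adj F k l := by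
  have e : ∀ v, gap F k v * gap F l v = gap F k v - adj F l v + adj F k v * adj F l v -
      ev l v * gap F k v + ev k v * adj F l v := fun v => by unfold gap; ring
  simp only [e, sum_add_distrib, sum_sub_distrib, sum_ev_mul, sum_gap]
  have h1 : gap F k l = 1 - adj F k l := by unfold gap; rw [ev_ne hkl.symm]; ring
  rw [h1, adj_comm F l k]
  have h2 : ∑ v, adj F l v = fdeg F l := rfl
  rw [h2]; ring

/-- Linear part of the normalised number of moves. -/
def lin (y p : ℝ) (d : Fin n → ℝ) (F : SimpleGraph (Fin n)) (k l : Fin n) : ℝ :=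
  (1 - p) * dl y p d F k - p * dl y p d F l - p * (1 - p) * (fdeg F k * y ^ 2)

/-- Negligible part of the normalised number of moves. -/
def neg (y p : ℝ) (F : SimpleGraph (Fin n)) (k l : Fin n) (H : SimpleGraph (Fin n)) : ℝ :=
  y ^ 2 * (p * (1 - p) * (2 * adj F k l + ∑ v, adj F k v * adj F l v - fdeg F l - 2) + p -
    (1 - 2 * p) * zt p F H k l) - (1 - p) * (y ^ 2 * ∑ v, adj F l v * zt p F H k v)

lemma kk_expand {k l : Fin n} (hkl : k ≠ l) (hny : (n : ℝ) * y ^ 2 = 1)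
    (hH : H ∈ cls (d - ev k) F) :
    kk y F k l H - p * (1 - p) = lin y p d F k l + neg y p F k l H +
      p * (y ^ 2 * ∑ v, adj F k v * zt p F H l v) -
      y ^ 2 * ∑ v, zt p F H k v * zt p F H l v := by
  have h1 := sum_zt_sub_ev (y := y) (p := p) hH l
  have h2 := sum_zt_sub_ev (y := y) (p := p) hH k
  rw [ev_ne hkl.symm] at h1
  rw [ev_self] at h2
  unfold kk lin neg
  rw [mov_expand hH p, sum_gap_mul_gap F hkl]
  linear_combination p * (1 - p) * hny + (1 - p) * h2 - p * h1

lemma bd_wt (P : Par n t y p) (F : SimpleGraph (Fin n)) (l : Fin n) :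
    Bd t y 0 0 (1 + fdeg F l)⁻¹ ∧ Bd t y 0 0 ((1 + fdeg F l)⁻¹ * fdeg F l) ∧
    (∀ {K r : ℕ} {g : Fin n → ℝ}, (∀ v, Bd t y K r (g v)) →
      Bd t y K (r + 2) ((1 + fdeg F l)⁻¹ * (y ^ 2 * ∑ v, adj F l v * g v))) := by
  have h0 := fdeg_nonneg F l
  have h1 : (1 + fdeg F l)⁻¹ * (1 + fdeg F l) = 1 := inv_mul_cancel₀ (by positivity)
  have h2 : 0 < (1 + fdeg F l)⁻¹ := by positivity
  have h3 : (1 + fdeg F l)⁻¹ * fdeg F l ≤ 1 := by linarith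
  refine ⟨bd_of_le_one ?_, bd_of_le_one ?_, fun {K r g} hg => ?_⟩
  · rw [abs_of_pos h2]; nlinarith
  · rw [abs_of_nonneg (by positivity)]; exact h3
  · have hy := P.hy
    have ht := P.t_pos
    unfold Bd at *
    rw [abs_mul, abs_of_pos h2, abs_mul, abs_of_pos (pow_pos hy 2)]
    have h4 : |∑ v, adj F l v * g v| ≤ fdeg F l * (t ^ K * y ^ r) := by
      refine (abs_sum_le_sum_abs _ _).trans ?_
      unfold fdeg
      rw [sum_mul]
      refine sum_le_sum fun v _ => ?_
      rw [abs_mul, abs_of_nonneg (adj_nonneg _ _ _)]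
      exact mul_le_mul_of_nonneg_left (hg v) (adj_nonneg _ _ _)
    calc _ ≤ (1 + fdeg F l)⁻¹ * (y ^ 2 * (fdeg F l * (t ^ K * y ^ r))) := by gcongr
      _ = ((1 + fdeg F l)⁻¹ * fdeg F l) * (t ^ K * y ^ (r + 2)) := by ring
      _ ≤ 1 * (t ^ K * y ^ (r + 2)) := by gcongr
      _ = _ := one_mul _

lemma bd_neg (P : Par n t y p) (F H : SimpleGraph (Fin n)) (k l : Fin n) :
    Bd t y 10 2 ((1 + fdeg F l)⁻¹ * neg y p F k l H) := by
  obtain ⟨h1, h2, h3⟩ := bd_wt P F l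
  have h4 : Bd t y 0 0 ((1 + fdeg F l)⁻¹ * ∑ v, adj F k v * adj F l v) := by
    refine bd_of_le_one ?_
    have h0 := fdeg_nonneg F l
    have h5 : 0 ≤ ∑ v, adj F k v * adj F l v :=
      sum_nonneg fun v _ => mul_nonneg (adj_nonneg _ _ _) (adj_nonneg _ _ _)
    have h6 : ∑ v, adj F k v * adj F l v ≤ fdeg F l :=
      sum_le_sum fun v _ => mul_le_of_le_one_left (adj_nonneg _ _ _) (adj_le_one _ _ _)
    rw [abs_of_nonneg (by positivity), inv_mul_le_iff₀ (by positivity)]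
    linarith
  have c2 : Bd t y 1 0 (2 : ℝ) := P.bd_const (by norm_num)
  have c1 : Bd t y 1 0 (1 : ℝ) := P.bd_const (by norm_num)
  have hk := P.bd_p.mul P.bd_q
  have g1 := P.bd_add (P.bd_sub (P.bd_sub (P.bd_add ((hk.mul (c2.mul (bd_adj F k l))).mul h1)
    (hk.mul h4)) (hk.mul h2)) ((hk.mul c2).mul h1)) (P.bd_p.mul h1)
  have g2 := P.bd_sub g1 (((P.bd_sub c1 (c2.mul P.bd_p)).mul (bd_zt (F := F) (H := H) P k l)).mul h1)
  have g3 := P.bd_sub ((P.bd_y 2).mul g2) (P.bd_q.mul (h3 fun v => bd_zt (F := F) (H := H) P k v))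
  refine (P.bd_mono g3 (by norm_num) (by norm_num)).of_eq ?_
  unfold neg; ring

end

section

variable {n : ℕ} {t y p c : ℝ} {d : Fin n → ℝ} {F H : SimpleGraph (Fin n)}

/-- Second-order estimate for the mean of the correction term. -/
lemma Ex_cr_two (N : Near t y p c d F) (hc : c + 20 ≤ 100) {k l : Fin n}
    (hne : (cls (d - ev k) F).Nonempty) :
    Bd t y 70 3 ((1 + fdeg F l)⁻¹ * (Ex (d - ev k) F (cr y p F k l) +
      (fdeg F k * y ^ 2 * dl y p d F l + y ^ 2 * ∑ v, adj F k v * dl y p d F v))) := by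
  have P := N.par
  have Nk := N.sub_ev (by linarith) k
  obtain ⟨w1, -, w3⟩ := bd_wt P F l
  set s := (1 + fdeg F l)⁻¹
  set z : Fin n → ℝ := fun v => Ex (d - ev k) F (fun H => zt p F H l v - (dl y p d F l + dl y p d F v))
    with hz
  have z1 : ∀ v, Bd t y 21 1 (z v) := fun v => by
    refine (P.bd_mono (P.bd_sub (Ex_zt_zero Nk (by linarith) l v)
      (P.bd_add (N.bd_dl l) (N.bd_dl v))) (by norm_num) (by norm_num)).of_eq ?_
    rw [hz, ← Ex_const hne (dl y p d F l + dl y p d F v), ← Ex_sub]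
  have z2 : ∀ v, Bd t y 57 2 (gap F l v * z v) := fun v => by
    rcases gap_cases F l v with ⟨h, hlv, hF⟩ | ⟨h, -⟩
    swap; · rw [h, zero_mul]; exact P.bd_zero
    rw [h, one_mul]
    refine Ex_zt_near Nk (by linarith) hlv hF ?_
    simp only [dl_sub_ev]
    have b1 := (P.bd_add (bd_ev (t := t) (y := y) k l) (bd_ev k v)).mul (P.bd_y 2)
    refine (P.bd_mono b1.neg (by norm_num) (by norm_num)).of_eq ?_
    ring
  have e1 : Ex (d - ev k) F (cr y p F k l) +
      (fdeg F k * y ^ 2 * dl y p d F l + y ^ 2 * ∑ v, adj F k v * dl y p d F v) =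
      y ^ 2 * ∑ v, adj F l v * Ex (d - ev k) F (fun H => zt p F H k v) -
      (y ^ 2 * ∑ v, adj F k v * (gap F l v * z v) + y ^ 2 * ∑ v, adj F l v * (adj F k v * z v) +
      y ^ 2 * (adj F k l * z l)) := by
    have e2 : Ex (d - ev k) F (cr y p F k l) =
        y ^ 2 * ∑ v, adj F l v * Ex (d - ev k) F (fun H => zt p F H k v) -
        y ^ 2 * ∑ v, adj F k v * Ex (d - ev k) F (fun H => zt p F H l v) := by
      rw [← Ex_sum_adj F y l (fun v H => zt p F H k v),
        ← Ex_sum_adj F y k (fun v H => zt p F H l v), ← Ex_sub]; rfl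
    have e3 : ∀ v, Ex (d - ev k) F (fun H => zt p F H l v) =
        z v + (dl y p d F l + dl y p d F v) := fun v => by
      rw [hz]; simp only []
      rw [Ex_sub, Ex_const hne]; ring
    have e4 : ∀ v, adj F k v * Ex (d - ev k) F (fun H => zt p F H l v) =
        adj F k v * (gap F l v * z v) + adj F l v * (adj F k v * z v) + ev l v * (adj F k v * z v) +
        adj F k v * dl y p d F l + adj F k v * dl y p d F v := fun v => by
      rw [e3]; unfold gap; ring
    rw [e2]
    simp only [e4, sum_add_distrib, sum_ev_mul, ← sum_mul]
    have h2 : ∑ v, adj F k v = fdeg F k := rfl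
    rw [h2]; ring
  rw [e1]
  have g := P.bd_sub (w3 fun v => Ex_zt_zero Nk (by linarith) k v)
    (P.bd_add (P.bd_add (w1.mul (N.bd_adj_sum k z2)) (w3 fun v => (bd_adj F k v).mul (z1 v)))
      (w1.mul ((P.bd_y 2).mul ((bd_adj F k l).mul (z1 l)))))
  refine (P.bd_mono g (by norm_num) (by norm_num)).of_eq ?_
  ring

lemma Ex_kk_one (N : Near t y p c d F) (hc : c + 20 ≤ 100) {k l : Fin n} (hkl : k ≠ l) :
    Bd t y 60 2 ((1 + fdeg F l)⁻¹ * Ex (d - ev k) F (fun H =>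
      kk y F k l H - p * (1 - p) - lin y p d F k l)) := by
  have P := N.par
  have Nk := N.sub_ev (by linarith) k
  obtain ⟨w1, -, -⟩ := bd_wt P F l
  have g1 : Bd t y 10 2 (Ex (d - ev k) F (fun H => (1 + fdeg F l)⁻¹ * neg y p F k l H)) :=
    bd_Ex P fun H _ => bd_neg P F H k l
  have g2 := N.bd_adj_sum k fun v => Ex_zt_zero Nk (by linarith) l v
  have g3 := P.bd_sum fun v => dec_two Nk (by linarith) (j := k) (k := v) (u := l) (v := v)
    (fun h => hkl h.1.symm) (fun h => hkl (h.1.trans h.2).symm)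
  refine (P.bd_mono (P.bd_sub (P.bd_add g1 (w1.mul (P.bd_p.mul g2))) (w1.mul g3)) (by norm_num)
    (by norm_num)).of_eq ?_
  rw [← Ex_sum_adj F y k (fun v H => zt p F H l v), ← Ex_sum, ← Ex_mul, ← Ex_mul, ← Ex_mul,
    ← Ex_mul, ← Ex_mul, ← Ex_add, ← Ex_sub]
  refine Ex_congr fun H hH => ?_
  rw [kk_expand hkl P.hny hH]; ring

lemma Ex_cr_kk (N : Near t y p c d F) (hc : c + 22 ≤ 100) {k l : Fin n} (hkl : k ≠ l) :
    Bd t y 70 3 ((1 + fdeg F l)⁻¹ * Ex (d - ev k) F (fun H =>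
      cr y p F k l H * (kk y F k l H - p * (1 - p)))) := by
  have P := N.par
  have Nk := N.sub_ev (by linarith) k
  obtain ⟨w1, -, w3⟩ := bd_wt P F l
  set s := (1 + fdeg F l)⁻¹
  set X : SimpleGraph (Fin n) → ℝ := fun H => y ^ 2 * ∑ v, adj F k v * zt p F H l v with hX
  have a1 : Bd t y 5 3 (Ex (d - ev k) F (fun H => (s * (y ^ 2 * ∑ v, adj F l v * zt p F H k v)) *
      (kk y F k l H - p * (1 - p)))) := by
    have h1 : ∀ H ∈ cls (d - ev k) F, |s * (y ^ 2 * ∑ v, adj F l v * zt p F H k v)| ≤ y ^ 2 :=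
      fun H _ => by simpa [Bd] using w3 fun v => bd_zt (F := F) (H := H) P k v
    refine (abs_Ex_mul_le h1).trans ?_
    have h2 := (P.bd_y 2).mul (Ex_abs_kk Nk hkl)
    have h3 := (le_abs_self _).trans h2
    simpa using h3
  have a2 : Bd t y 22 2 (Ex (d - ev k) F X) := by
    rw [hX, Ex_sum_adj F y k (fun v H => zt p F H l v)]
    exact N.bd_adj_sum k fun v => Ex_zt_zero Nk (by linarith) l v
  have a3 : Bd t y 12 3 (Ex (d - ev k) F (fun H => X H * (s * neg y p F k l H))) :=
    bd_Ex P fun H _ => (N.bd_adj_sum k fun v => bd_zt P l v).mul (bd_neg P F H k l)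
  have a4 : Bd t y 25 3 (Ex (d - ev k) F (fun H => X H * X H)) := by
    have h1 : ∀ v, Bd t y 23 2 (Ex (d - ev k) F (fun H => zt p F H l v * X H)) := fun v => by
      set q : Fin n → ℝ := fun u => Ex (d - ev k) F (fun H => zt p F H l v * zt p F H l u) with hq
      have q0 : ∀ u, Bd t y 0 0 (q u) := fun u =>
        bd_Ex P fun H _ => (bd_zt P l v).mul (bd_zt P l u)
      have q1 : ∀ u, Bd t y 20 1 ((1 - ev v u) * q u) := fun u => by
        by_cases h : u = v
        · rw [h, ev_self, sub_self, zero_mul]; exact P.bd_zero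
        · rw [ev_ne h, sub_zero, one_mul]
          by_cases h' : u = l ∧ l = v
          · exact absurd (h'.1.trans h'.2) h
          · exact dec_weak Nk (by linarith) (fun h2 => h h2.2) (fun h2 => h' ⟨h2.2, h2.1⟩)
      refine (P.bd_mono (P.bd_add (N.bd_adj_sum k q1) ((P.bd_y 2).mul ((bd_adj F k v).mul (q0 v))))
        (by norm_num) (by norm_num)).of_eq ?_
      have e1 : Ex (d - ev k) F (fun H => zt p F H l v * X H) = y ^ 2 * ∑ u, adj F k u * q u := by
        rw [hq, ← Ex_sum_adj F y k (fun u H => zt p F H l v * zt p F H l u)]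
        refine Ex_congr fun H _ => ?_
        simp only [hX, mul_sum]
        exact sum_congr rfl fun u _ => by ring
      have e2 : ∀ u, adj F k u * q u = adj F k u * ((1 - ev v u) * q u) +
        ev v u * (adj F k u * q u) := fun u => by ring
      rw [e1, sum_congr rfl fun u _ => e2 u, sum_add_distrib, sum_ev_mul]; ring
    refine (N.bd_adj_sum k h1).of_eq ?_
    rw [← Ex_sum_adj F y k (fun v H => zt p F H l v * X H)]
    refine Ex_congr fun H _ => ?_
    conv_lhs => rw [hX]
    simp only [hX, mul_sum, sum_mul]
    refine sum_congr rfl fun u _ => sum_congr rfl fun v _ => by ring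
  have a5 : Bd t y 60 3 (Ex (d - ev k) F (fun H => X H *
      (y ^ 2 * ∑ u, zt p F H k u * zt p F H l u))) := by
    have h1 : ∀ v, Bd t y 58 2 (adj F k v * (y ^ 2 * ∑ u, Ex (d - ev k) F (fun H =>
        zt p F H l v * (zt p F H k u * zt p F H l u)))) := fun v => by
      by_cases h : F.Adj k v
      · rw [adj_of h, one_mul]
        exact P.bd_sum fun u => dec_three Nk (by linarith) hkl h
      · rw [adj_of_not h, zero_mul]; exact P.bd_zero
    refine (N.bd_adj_sum k h1).of_eq ?_
    have e1 : ∀ v, adj F k v * (adj F k v * (y ^ 2 * ∑ u, Ex (d - ev k) F (fun H =>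
        zt p F H l v * (zt p F H k u * zt p F H l u)))) = adj F k v * Ex (d - ev k) F (fun H =>
        zt p F H l v * (y ^ 2 * ∑ u, zt p F H k u * zt p F H l u)) := fun v => by
      rw [← mul_assoc, adj_sq, ← Ex_sum, ← Ex_mul]
      congr 1
      refine Ex_congr fun H _ => ?_
      rw [← mul_sum]; ring
    rw [sum_congr rfl fun v _ => e1 v, ← Ex_sum_adj F y k (fun v H => zt p F H l v *
      (y ^ 2 * ∑ u, zt p F H k u * zt p F H l u))]
    refine Ex_congr fun H _ => ?_
    rw [hX]
    simp only [← mul_assoc, ← sum_mul]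
  have g := P.bd_sub a1 (P.bd_sub (P.bd_add (P.bd_add
    (w1.mul (a2.mul (P.bd_sub (P.bd_sub (P.bd_q.mul (N.bd_dl k)) (P.bd_p.mul (N.bd_dl l)))
      ((P.bd_p.mul P.bd_q).mul (N.bd_f k))))) a3) (w1.mul (P.bd_p.mul a4))) (w1.mul a5))
  refine (P.bd_mono g (by norm_num) (by norm_num)).of_eq ?_
  have e : ∀ x, x * ((1 - p) * dl y p d F k - p * dl y p d F l -
    p * (1 - p) * (fdeg F k * y ^ 2)) = lin y p d F k l * x := fun x => by unfold lin; ring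
  rw [e, ← Ex_mul, ← Ex_mul, ← Ex_mul, ← Ex_mul, ← Ex_mul, ← Ex_mul, ← Ex_add, ← Ex_add, ← Ex_sub,
    ← Ex_sub]
  refine Ex_congr fun H hH => ?_
  have e5 := kk_expand (p := p) hkl P.hny hH
  have e6 : cr y p F k l H = y ^ 2 * ∑ v, adj F l v * zt p F H k v - X H := rfl
  have e7 : y ^ 2 * ∑ v, adj F k v * zt p F H l v = X H := rfl
  rw [e7] at e5
  rw [e6]
  linear_combination (-s * X H) * e5

end

section

variable {n : ℕ} {t y p c : ℝ} {d : Fin n → ℝ} {F H : SimpleGraph (Fin n)}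

/-- Normalised sum of the excess degrees of the neighbours. -/
def nb (y p : ℝ) (d : Fin n → ℝ) (F : SimpleGraph (Fin n)) (k : Fin n) : ℝ :=
  y ^ 2 * ∑ v, adj F k v * dl y p d F v

/-- Second-order prediction for the relative change in the size of a class. -/
def rho (y p : ℝ) (d : Fin n → ℝ) (F : SimpleGraph (Fin n)) (k l : Fin n) : ℝ :=
  (dl y p d F l - dl y p d F k - (fdeg F k * y ^ 2 * dl y p d F l + nb y p d F k)) *
      (p * (1 - p))⁻¹ -
    (dl y p d F l - dl y p d F k) * lin y p d F k l * (p * (1 - p))⁻¹ * (p * (1 - p))⁻¹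

/-- Comparison of classes with third-order error. -/
lemma ratio_quad (N : Near t y p c d F) (hc : c + 22 ≤ 100) {k l : Fin n} (hkl : k ≠ l) :
    ∃ r, (#(cls (d - ev l) F) : ℝ) = #(cls (d - ev k) F) * (1 + r) ∧
      Bd t y 80 3 ((1 + fdeg F l)⁻¹ * (r - rho y p d F k l)) := by
  have P := N.par
  have hy := P.hy
  have ht := P.t_pos
  have h0 := fdeg_nonneg F l
  have hs : 0 < (1 + fdeg F l)⁻¹ := by positivity
  set κ := (p * (1 - p))⁻¹ with hκ
  set Δ := dl y p d F l - dl y p d F k with hΔ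
  set ψ : SimpleGraph (Fin n) → ℝ := fun H => dd y F k l H * κ -
    dd y F k l H * (kk y F k l H - p * (1 - p)) * κ * κ with hψ
  have bk := P.bd_kinv
  have h1 : Bd t y 78 3 ((1 + fdeg F l)⁻¹ *
      Ex (d - ev k) F (fun H => ψ H - rho y p d F k l)) := by
    by_cases hne : (cls (d - ev k) F).Nonempty
    swap; · rw [Ex_empty hne, mul_zero]; exact P.bd_zero
    have g1 := bk.mul (Ex_cr_two N (by linarith) (l := l) hne)
    have g2 := (bk.mul bk).mul ((P.bd_sub (N.bd_dl l) (N.bd_dl k)).mul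
      (Ex_kk_one N (by linarith) hkl))
    have g3 := (bk.mul bk).mul (Ex_cr_kk N hc hkl)
    refine (P.bd_mono (P.bd_sub (P.bd_sub g1 g2) g3) (by norm_num) (by norm_num)).of_eq ?_
    rw [← Ex_const hne (fdeg F k * y ^ 2 * dl y p d F l + y ^ 2 * ∑ v, adj F k v * dl y p d F v),
      ← Ex_add]
    simp only [← Ex_mul]
    rw [← Ex_sub, ← Ex_sub]
    refine Ex_congr fun H hH => ?_
    rw [hψ]
    simp only []
    rw [dd_eq hkl hH]
    unfold rho nb
    rw [← hκ, ← hΔ]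
    ring
  have h2 : |Ex (d - ev k) F (fun H => ψ H - rho y p d F k l)| ≤
      (1 + fdeg F l) * (t ^ 78 * y ^ 3) := by
    unfold Bd at h1
    rw [abs_mul, abs_of_pos hs, inv_mul_le_iff₀ (by positivity)] at h1
    exact h1
  have hA : ∀ H ∈ cls (d - ev k) F, |(mov k l F H + 1) * y ^ 2 - p * (1 - p)| ≤ t ^ 3 * y →
      Bd t y 30 3 ((mov l k F H - mov k l F H - 1) / (mov k l F H + 1) - ψ H) := by
    intro H hH hg
    obtain ⟨g1, g2⟩ := bd_good_inv P hg
    have g3 : Bd t y 3 1 (kk y F k l H - p * (1 - p)) := by unfold Bd; rw [pow_one]; exact hg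
    rw [dd_div_kk P]
    have g4 := (((bd_dd N hkl hH).mul (g3.mul g3)).mul (bk.mul bk)).mul g2
    refine (P.bd_mono g4 (by norm_num) (by norm_num)).of_eq ?_
    rw [hψ]
    have hk1 : p * (1 - p) * κ = 1 := mul_inv_cancel₀ P.kap_pos.ne'
    have hk2 : kk y F k l H * (kk y F k l H)⁻¹ = 1 := mul_inv_cancel₀ g1.ne'
    have e : ∀ x z a κ : ℝ, z * x = 1 → a * κ = 1 →
        (z - a) * (z - a) * (κ * κ) * x = x - κ + (z - a) * κ * κ := by
      intro x z a κ hk2 hk1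
      linear_combination (z * κ * κ - 2 * a * κ * κ) * hk2 + (a * κ * x + x - κ) * hk1
    have e' := e _ _ _ _ hk2 hk1
    have hk3 : ((mov k l F H + 1) * y ^ 2)⁻¹ = (kk y F k l H)⁻¹ := rfl
    rw [hk3]
    simp only []
    linear_combination (-dd y F k l H) * e'
  have hB : ∀ H ∈ cls (d - ev k) F, Bd t y 30 1 (ψ H) := by
    intro H hH
    refine (P.bd_mono (P.bd_sub ((bd_dd N hkl hH).mul bk)
      ((((bd_dd N hkl hH).mul (bd_kk (N.sub_ev (by linarith) k) H k l)).mul bk).mul bk))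
      (by norm_num) (by norm_num))
  obtain ⟨r, h3, h4⟩ := ratio_core N (by linarith) hkl (by norm_num) (by norm_num) ψ hA hB
    (by positivity) h2
  refine ⟨r, h3, ?_⟩
  unfold Bd
  rw [abs_mul, abs_of_pos hs, inv_mul_le_iff₀ (by positivity)]
  refine h4.trans ?_
  have h5 : t ^ (30 + 1) ≤ t ^ 78 := pow_le_pow_right₀ P.t_one (by norm_num)
  have h6 : 2 * t ^ 78 ≤ t ^ 80 := by nlinarith [P.ht, pow_pos ht 78, pow_pos ht 79]
  have h7 : 0 < t ^ 78 := by positivity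
  calc _ ≤ (1 + fdeg F l) * (t ^ 78 * y ^ 3) + (1 + fdeg F l) * (t ^ 78 * y ^ 3) := by
        refine add_le_add le_rfl ?_
        have : t ^ (30 + 1) * y ^ 3 ≤ t ^ 78 * y ^ 3 := by gcongr
        nlinarith [mul_nonneg h0 (mul_pos h7 (pow_pos hy 3)).le]
    _ = (1 + fdeg F l) * ((2 * t ^ 78) * y ^ 3) := by ring
    _ ≤ _ := by gcongr

end

section

variable {n : ℕ} {t y p c : ℝ} {d : Fin n → ℝ} {F H : SimpleGraph (Fin n)}

lemma bd_nb (N : Near t y p c d F) (k : Fin n) : Bd t y 6 2 (nb y p d F k) :=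
  N.bd_adj_sum k N.bd_dl

lemma bd_lin (N : Near t y p c d F) (k l : Fin n) : Bd t y 6 1 (lin y p d F k l) := by
  have P := N.par
  exact P.bd_mono (P.bd_sub (P.bd_sub (P.bd_q.mul (N.bd_dl k)) (P.bd_p.mul (N.bd_dl l)))
    ((P.bd_p.mul P.bd_q).mul (N.bd_f k))) (by norm_num) (by norm_num)

lemma rho_shift (N : Near t y p c d F) {j k l : Fin n} (hjk : j ≠ k) (hF : ¬ F.Adj j k)
    (hjl : j ≠ l) (hFl : ¬ (addE F j k).Adj j l) :
    Bd t y 20 3 (rho y p (d - ev j) (addE (addE F j k) j l) k l - rho y p d F k l) := by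
  have P := N.par
  have hkl := adj_addE_ne hjk hFl
  have c1 : Bd t y 1 0 (1 : ℝ) := P.bd_const (by norm_num)
  have c2 : Bd t y 1 0 (2 : ℝ) := P.bd_const (by norm_num)
  set F' := addE (addE F j k) j l with hF'
  have hs := dl_shift y p d hjk hF hjl hFl
  have hdk : dl y p (d - ev j) F' k = dl y p d F k + p * y ^ 2 := by
    rw [hs, ev_ne hjk.symm, ev_self, ev_ne hkl]; ring
  have hdl : dl y p (d - ev j) F' l = dl y p d F l + p * y ^ 2 := by
    rw [hs, ev_ne hjl.symm, ev_self, ev_ne hkl.symm]; ring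
  have hdj : dl y p (d - ev j) F' j = dl y p d F j + (2 * p - 1) * y ^ 2 := by
    rw [hs, ev_ne hjl, ev_self, ev_ne hjk]; ring
  have hfk : fdeg F' k = fdeg F k + 1 := by
    rw [hF', fdeg_addE hjl hFl, fdeg_addE hjk hF, ev_ne hjk.symm, ev_self, ev_ne hkl]; ring
  have hnb : nb y p (d - ev j) F' k - nb y p d F k =
      y ^ 2 * ∑ v, adj F k v * (dl y p (d - ev j) F' v - dl y p d F v) +
        y ^ 2 * (dl y p d F j + (2 * p - 1) * y ^ 2) := by
    have e : ∀ v, adj F' k v * dl y p (d - ev j) F' v =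
        adj F k v * (dl y p (d - ev j) F' v - dl y p d F v) + adj F k v * dl y p d F v +
        ev j v * dl y p (d - ev j) F' v := fun v => by
      rw [hF', adj_addE hjl hFl, adj_addE hjk hF, ev_ne hjk.symm, ev_self, ev_ne hkl]; ring
    unfold nb
    simp only [e, sum_add_distrib, sum_ev_mul]
    rw [hdj]; ring
  have hb : ∀ v, Bd t y 6 2 (dl y p (d - ev j) F' v - dl y p d F v) := fun v => by
    have b1 := P.bd_sub (P.bd_p.mul (P.bd_add (P.bd_add (c2.mul (bd_ev j v)) (bd_ev k v))
      (bd_ev l v))) (bd_ev j v)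
    refine (P.bd_mono (b1.mul (P.bd_y 2)) (by norm_num) (by norm_num)).of_eq ?_
    rw [hs]; ring
  have hnb' : Bd t y 9 3 (nb y p (d - ev j) F' k - nb y p d F k) := by
    have b1 := P.bd_add (N.bd_adj_sum k hb) ((P.bd_y 2).mul (P.bd_add (N.bd_dl j)
      ((P.bd_sub (c2.mul P.bd_p) c1).mul (P.bd_y 2))))
    exact (P.bd_mono b1 (by norm_num) (by norm_num)).of_eq hnb
  have g1 := P.bd_add (P.bd_add (P.bd_add ((N.bd_f k).mul (P.bd_p.mul (P.bd_y 2)))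
    ((P.bd_y 2).mul (N.bd_dl l))) ((P.bd_y 2).mul (P.bd_p.mul (P.bd_y 2)))) hnb'
  have g2 := (P.bd_sub (N.bd_dl l) (N.bd_dl k)).mul ((P.bd_sub (P.bd_sub (P.bd_q.mul P.bd_p)
    (P.bd_p.mul P.bd_p)) (P.bd_p.mul P.bd_q)).mul (P.bd_y 2))
  have bk := P.bd_kinv
  refine (P.bd_mono (P.bd_sub (g1.mul bk).neg ((g2.mul bk).mul bk)) (by norm_num)
    (by norm_num)).of_eq ?_
  unfold rho lin
  rw [hdk, hdl, hfk]
  ring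

/-- Prediction for one term in the double count around a pair. -/
def tau (y p : ℝ) (d : Fin n → ℝ) (F : SimpleGraph (Fin n)) (j k l : Fin n) : ℝ :=
  dl y p d F l - dl y p d F k - nb y p d F k - fdeg F k * y ^ 2 * dl y p d F k +
    (1 - 2 * p) * (dl y p d F l - dl y p d F k) * dl y p d F j * (p * (1 - p))⁻¹

lemma tau_close (N : Near t y p c d F) (hc : c + 16 ≤ 100) (hne : (cls d F).Nonempty)
    {j k l : Fin n} (hjk : j ≠ k) (hF : ¬ F.Adj j k) (hjl : j ≠ l)
    (hFl : ¬ (addE F j k).Adj j l) {s r : ℝ} (hs : Bd t y 0 0 s)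
    (hr : Bd t y 82 3 (s * (r - rho y p d F k l))) :
    Bd t y 86 3 (s * (Ex d F (fun H => adj H j k * (1 - adj H j l)) * r - tau y p d F j k l)) := by
  have P := N.par
  have hkl := adj_addE_ne hjk hFl
  have hFl' := not_addE hjk hFl
  have bk := P.bd_kinv
  have c1 : Bd t y 1 0 (1 : ℝ) := P.bd_const (by norm_num)
  set C := Ex d F (fun H => adj H j k * (1 - adj H j l)) with hC
  have bC : Bd t y 0 0 C := bd_Ex P fun H _ => bd_adj_adj H j k l
  set C1 := (1 - p) * (dl y p d F j + dl y p d F k) - p * (dl y p d F j + dl y p d F l) with hC1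
  have bC1 : Bd t y 6 1 C1 := P.bd_mono (P.bd_sub (P.bd_q.mul (P.bd_add (N.bd_dl j) (N.bd_dl k)))
    (P.bd_p.mul (P.bd_add (N.bd_dl j) (N.bd_dl l)))) (by norm_num) (by norm_num)
  have bC2 : Bd t y 60 2 (C - p * (1 - p) - C1) := by
    have h1 := Ex_zt_one N (by linarith) hjk hF
    have h2 := Ex_zt_one N (by linarith) hjl hFl'
    have h3 := dec_two N (by linarith) (j := j) (k := k) (u := j) (v := l) (by tauto) (by tauto)
    rw [Ex_sub, Ex_const hne] at h1 h2
    refine (P.bd_mono (P.bd_sub (P.bd_sub (P.bd_q.mul h1) (P.bd_p.mul h2)) h3) (by norm_num)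
      (by norm_num)).of_eq ?_
    rw [hC, Ex_adj_adj hne p hjk hF hjl hFl', hC1]; ring
  have bΔ := P.bd_sub (N.bd_dl l) (N.bd_dl k)
  set ρ := rho y p d F k l with hρ
  have bρ2 : Bd t y 18 2 (ρ - (dl y p d F l - dl y p d F k) * (p * (1 - p))⁻¹) := by
    have g := P.bd_sub ((P.bd_add ((N.bd_f k).mul (N.bd_dl l)) (bd_nb N k)).neg.mul bk)
      (((bΔ.mul (bd_lin N k l)).mul bk).mul bk)
    refine (P.bd_mono g (by norm_num) (by norm_num)).of_eq ?_
    rw [hρ]; unfold rho; ring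
  have bρ : Bd t y 20 1 ρ :=
    (P.bd_mono (P.bd_add bρ2 (bΔ.mul bk)) (by norm_num) (by norm_num)).of_eq (by ring)
  have g := P.bd_add (bC.mul hr) (hs.mul (P.bd_add (bC2.mul bρ) (bC1.mul bρ2)))
  refine (P.bd_mono g (by norm_num) (by norm_num)).of_eq ?_
  have hk : p * (1 - p) * (p * (1 - p))⁻¹ = 1 := mul_inv_cancel₀ P.kap_pos.ne'
  have e : ρ * (p * (1 - p)) + C1 * ((dl y p d F l - dl y p d F k) * (p * (1 - p))⁻¹) =
      tau y p d F j k l := by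
    rw [hρ, hC1]; unfold rho tau lin
    generalize (p * (1 - p))⁻¹ = x at *
    linear_combination (dl y p d F l - dl y p d F k - (fdeg F k * y ^ 2 * dl y p d F l +
      nb y p d F k) - x * (dl y p d F l - dl y p d F k) * ((1 - p) * dl y p d F k -
      p * dl y p d F l - p * (1 - p) * (fdeg F k * y ^ 2)) + 
      (dl y p d F l - dl y p d F k) * (fdeg F k * y ^ 2)) * hk
  rw [← e]; ring

end

section

variable {n : ℕ} {t y p c : ℝ} {d : Fin n → ℝ} {F H : SimpleGraph (Fin n)}

/-- Second-order prediction for the mean of a centred edge indicator. -/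
def prd (y p : ℝ) (d : Fin n → ℝ) (F : SimpleGraph (Fin n)) (j k : Fin n) : ℝ :=
  dl y p d F j + dl y p d F k - y ^ 2 * ∑ v, dl y p d F v + nb y p d F j + nb y p d F k +
    fdeg F j * y ^ 2 * dl y p d F j + fdeg F k * y ^ 2 * dl y p d F k +
    (1 - 2 * p) * dl y p d F j * dl y p d F k * (p * (1 - p))⁻¹

lemma bd_tau (N : Near t y p c d F) (j k l : Fin n) : Bd t y 20 1 (tau y p d F j k l) := by
  have P := N.par
  have c1 : Bd t y 1 0 (1 : ℝ) := P.bd_const (by norm_num)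
  have c2 : Bd t y 1 0 (2 : ℝ) := P.bd_const (by norm_num)
  have bΔ := P.bd_sub (N.bd_dl l) (N.bd_dl k)
  exact P.bd_mono (P.bd_add (P.bd_sub (P.bd_sub bΔ (bd_nb N k)) ((N.bd_f k).mul (N.bd_dl k)))
    ((((P.bd_sub c1 (c2.mul P.bd_p)).mul bΔ).mul (N.bd_dl j)).mul P.bd_kinv)) (by norm_num)
    (by norm_num)

/-- The sum of the predictions around a pair. -/
lemma sum_tau (N : Near t y p c d F) {j k : Fin n} (hjk : j ≠ k) (hF : ¬ F.Adj j k) :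
    Bd t y 40 3 (y ^ 2 * ∑ l, gap (addE F j k) j l * tau y p d F j k l -
      (dl y p d F j + fdeg F j * y ^ 2 * (dl y p d F j + dl y p d F k) - prd y p d F j k)) := by
  have P := N.par
  have c1 : Bd t y 1 0 (1 : ℝ) := P.bd_const (by norm_num)
  have c2 : Bd t y 1 0 (2 : ℝ) := P.bd_const (by norm_num)
  have bk := P.bd_kinv
  have bq := ((P.bd_sub c1 (c2.mul P.bd_p)).mul (N.bd_dl j)).mul bk
  have g1 := bq.mul N.bd_S
  have g2 := bq.mul (P.bd_sub (bd_nb N j) ((N.bd_f j).mul (N.bd_dl k)))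
  have g3 := (N.bd_f j).mul (P.bd_add (bd_nb N k) ((N.bd_f k).mul (N.bd_dl k)))
  have g4 := (P.bd_y 2).mul (P.bd_add (bd_tau N j k j) (bd_tau N j k k))
  refine (P.bd_mono (P.bd_sub (P.bd_add (P.bd_sub g1 g2) g3) g4) (by norm_num) (by norm_num)).of_eq
    ?_
  rw [sum_gap_addE hjk hF]
  have e : ∀ l, tau y p d F j k l = (1 + (1 - 2 * p) * dl y p d F j * (p * (1 - p))⁻¹) *
      dl y p d F l - ((1 + (1 - 2 * p) * dl y p d F j * (p * (1 - p))⁻¹) * dl y p d F k +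
        nb y p d F k + fdeg F k * y ^ 2 * dl y p d F k) := fun l => by unfold tau; ring
  have e1 : ∑ l, tau y p d F j k l = (1 + (1 - 2 * p) * dl y p d F j * (p * (1 - p))⁻¹) *
      ∑ l, dl y p d F l - n * ((1 + (1 - 2 * p) * dl y p d F j * (p * (1 - p))⁻¹) * dl y p d F k +
        nb y p d F k + fdeg F k * y ^ 2 * dl y p d F k) := by
    simp only [e, sum_sub_distrib, ← mul_sum, sum_const, card_univ, Fintype.card_fin, nsmul_eq_mul]
  have e2 : y ^ 2 * ∑ l, adj F j l * tau y p d F j k l =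
      (1 + (1 - 2 * p) * dl y p d F j * (p * (1 - p))⁻¹) * nb y p d F j -
      fdeg F j * y ^ 2 * ((1 + (1 - 2 * p) * dl y p d F j * (p * (1 - p))⁻¹) * dl y p d F k +
        nb y p d F k + fdeg F k * y ^ 2 * dl y p d F k) := by
    have h : ∀ v, adj F j v * tau y p d F j k v =
      (1 + (1 - 2 * p) * dl y p d F j * (p * (1 - p))⁻¹) * (adj F j v * dl y p d F v) -
      adj F j v * ((1 + (1 - 2 * p) * dl y p d F j * (p * (1 - p))⁻¹) * dl y p d F k +
        nb y p d F k + fdeg F k * y ^ 2 * dl y p d F k) := fun v => by rw [e]; ring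
    simp only [h, sum_sub_distrib, ← mul_sum, ← sum_mul]
    have h2 : ∑ v, adj F j v = fdeg F j := rfl
    rw [h2]
    conv_rhs => rw [nb]
    ring
  have e3 : y ^ 2 * (∑ l, tau y p d F j k l - ∑ l, adj F j l * tau y p d F j k l -
      tau y p d F j k j - tau y p d F j k k) = y ^ 2 * ∑ l, tau y p d F j k l -
      y ^ 2 * ∑ l, adj F j l * tau y p d F j k l - y ^ 2 * (tau y p d F j k j + tau y p d F j k k) :=
    by ring
  rw [e3, e2, e1]
  unfold prd
  linear_combination (-((1 + (1 - 2 * p) * dl y p d F j * (p * (1 - p))⁻¹) * dl y p d F k +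
        nb y p d F k + fdeg F k * y ^ 2 * dl y p d F k)) * P.hny

/-- Expectation of a centred edge indicator, with third-order error. -/
lemma Ex_zt_two (N : Near t y p c d F) (hc : c + 30 ≤ 100) {j k : Fin n} (hjk : j ≠ k)
    (hF : ¬ F.Adj j k) :
    Bd t y 95 3 (Ex d F (fun H => zt p F H j k - prd y p d F j k)) := by
  have P := N.par
  have hy := P.hy
  have ht := P.t_pos
  by_cases hne : (cls d F).Nonempty
  swap; · rw [Ex_empty hne]; exact P.bd_zero
  have bz := Ex_zt_one N (by linarith) hjk hF
  rw [Ex_sub, Ex_const hne] at bz ⊢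
  have hr : ∀ l, ∃ r, (j ≠ l → ¬ (addE F j k).Adj j l →
      (#(cls (d - ev j - ev l) (addE (addE F j k) j l)) : ℝ) =
        #(cls (d - ev j - ev k) (addE (addE F j k) j l)) * (1 + r)) ∧
      Bd t y 82 3 ((1 + fdeg F l)⁻¹ * (r - rho y p d F k l)) := by
    intro l
    by_cases h : j ≠ l ∧ ¬ (addE F j k).Adj j l
    · have hkl := adj_addE_ne hjk h.2
      obtain ⟨r, h1, h2⟩ := ratio_quad (near_two N (by linarith) hjk hF h.1 h.2) (by linarith) hkl
      refine ⟨r, fun _ _ => h1, ?_⟩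
      obtain ⟨w1, w2, -⟩ := bd_wt P F l
      have c2 : Bd t y 1 0 (2 : ℝ) := P.bd_const (by norm_num)
      have hf : fdeg (addE (addE F j k) j l) l = fdeg F l + 1 := by
        rw [fdeg_addE h.1 h.2, fdeg_addE hjk hF, ev_ne h.1.symm, ev_self, ev_ne hkl.symm]; ring
      rw [hf] at h2
      have h3 : Bd t y 1 0 ((1 + fdeg F l)⁻¹ * (1 + (fdeg F l + 1))) := by
        have h0 := fdeg_nonneg F l
        refine P.bd_const ?_
        rw [abs_of_nonneg (by positivity), inv_mul_le_iff₀ (by positivity)]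
        linarith
      refine (P.bd_mono (P.bd_add (h3.mul h2) (w1.mul (rho_shift N hjk hF h.1 h.2)))
        (by norm_num) (by norm_num)).of_eq ?_
      have h4 : (1 + (fdeg F l + 1)) * (1 + (fdeg F l + 1))⁻¹ = 1 :=
        mul_inv_cancel₀ (by have := fdeg_nonneg F l; positivity)
      linear_combination (-(1 + fdeg F l)⁻¹ *
        (r - rho y p (d - ev j) (addE (addE F j k) j l) k l)) * h4
    · exact ⟨_, fun h1 h2 => absurd ⟨h1, h2⟩ h, by rw [sub_self, mul_zero]; exact P.bd_zero⟩
  choose r hr1 hr2 using hr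
  have h1 := pair_step N hne hjk hF r hr1
  have h2 : ∀ l, Bd t y 86 3 ((1 + fdeg F l)⁻¹ * (gap (addE F j k) j l *
      (Ex d F (fun H => adj H j k * (1 - adj H j l)) * r l - tau y p d F j k l))) := by
    intro l
    rcases gap_cases (addE F j k) j l with ⟨h, hjl, hFl⟩ | ⟨h, -⟩
    · rw [h, one_mul]
      exact tau_close N (by linarith) hne hjk hF hjl hFl (bd_wt P F l).1 (hr2 l)
    · rw [h, zero_mul, mul_zero]; exact P.bd_zero
  have h3 : Bd t y 90 3 (y ^ 2 * ∑ l, gap (addE F j k) j l *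
      (Ex d F (fun H => adj H j k * (1 - adj H j l)) * r l - tau y p d F j k l)) := by
    have g1 : |y ^ 2 * ∑ l, gap (addE F j k) j l *
        (Ex d F (fun H => adj H j k * (1 - adj H j l)) * r l - tau y p d F j k l)| ≤
        (y ^ 2 * ∑ l, (1 + fdeg F l)) * (t ^ 86 * y ^ 3) := by
      rw [abs_mul, abs_of_pos (pow_pos hy 2), mul_assoc, sum_mul]
      refine mul_le_mul_of_nonneg_left ?_ (pow_pos hy 2).le
      refine (abs_sum_le_sum_abs _ _).trans (sum_le_sum fun l _ => ?_)
      have h0 := fdeg_nonneg F l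
      have := h2 l
      unfold Bd at this
      rwa [abs_mul, abs_of_pos (by positivity), inv_mul_le_iff₀ (by positivity)] at this
    have g2 : Bd t y 4 0 (y ^ 2 * ∑ l, (1 + fdeg F l)) := by
      have c1 : Bd t y 1 0 (1 : ℝ) := P.bd_const (by norm_num)
      refine (P.bd_mono (P.bd_add c1 N.bd_F) (by norm_num) (by norm_num)).of_eq ?_
      rw [sum_add_distrib]; simp only [sum_const, card_univ, Fintype.card_fin, nsmul_eq_mul]
      linear_combination P.hny
    refine g1.trans ?_
    have g3 := (le_abs_self _).trans g2
    calc _ ≤ (t ^ 4 * y ^ 0) * (t ^ 86 * y ^ 3) := by gcongr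
      _ = _ := by ring
  have h4 := sum_tau N hjk hF
  have e1 : y ^ 2 * ∑ l, gap (addE F j k) j l *
      Ex d F (fun H => adj H j k * (1 - adj H j l)) * r l = y ^ 2 * ∑ l, gap (addE F j k) j l *
      (Ex d F (fun H => adj H j k * (1 - adj H j l)) * r l - tau y p d F j k l) +
      y ^ 2 * ∑ l, gap (addE F j k) j l * tau y p d F j k l := by
    rw [← mul_add, ← sum_add_distrib]
    congr 1
    exact sum_congr rfl fun l _ => by ring
  rw [e1] at h1
  have g := P.bd_add (P.bd_sub (P.bd_sub ((N.bd_f j).mul bz) h3) h4)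
    ((P.bd_y 2).mul (Ex_zt_zero N (by linarith) j k))
  refine (P.bd_mono g (by norm_num) (by norm_num)).of_eq ?_
  linear_combination h1

end

section

variable {n : ℕ} {t y p c : ℝ} {d : Fin n → ℝ} {F H : SimpleGraph (Fin n)}

/-- The potential whose increments are the logarithms of conditional edge probabilities. -/
def phi (y p : ℝ) (D : Fin n → ℝ) (F : SimpleGraph (Fin n)) : ℝ :=
  (p * (1 - p))⁻¹ * (-(n * ∑ v, D v ^ 2) / 2 +
    (1 - 2 * p) * (p * (1 - p))⁻¹ * (n * ∑ v, D v ^ 3) / 6 + (∑ v, D v) ^ 2 / 4 -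
    (∑ v, fdeg F v * D v ^ 2) / 2 - (∑ u, ∑ v, adj F u v * (D u * D v)) / 2 -
    (1 - 2 * p) * (∑ v, D v) / 2) + y ^ 2 * (∑ v, fdeg F v) / 2

lemma sum_shift {j k : Fin n} (hjk : j ≠ k) (G : Fin n → ℝ → ℝ) (D : Fin n → ℝ) (h : ℝ) :
    ∑ v, G v (D v - h * (ev j v + ev k v)) = ∑ v, G v (D v) + (G j (D j - h) - G j (D j)) +
      (G k (D k - h) - G k (D k)) := by
  have e : ∀ v, G v (D v - h * (ev j v + ev k v)) = G v (D v) +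
      ev j v * (G v (D v - h) - G v (D v)) + ev k v * (G v (D v - h) - G v (D v)) := by
    intro v
    by_cases h1 : v = j
    · subst h1; rw [ev_self, ev_ne hjk, add_zero, mul_one]; ring
    · by_cases h2 : v = k
      · subst h2; rw [ev_self, ev_ne h1, zero_add, mul_one]; ring
      · rw [ev_ne h1, ev_ne h2, add_zero, mul_zero, sub_zero]; ring
  simp only [e, sum_add_distrib, sum_ev_mul]

lemma sum_adj_shift {j k : Fin n} (hF : ¬ F.Adj j k) (D : Fin n → ℝ) (h : ℝ) :
    ∑ u, ∑ v, adj F u v * ((D u - h * (ev j u + ev k u)) * (D v - h * (ev j v + ev k v))) =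
      ∑ u, ∑ v, adj F u v * (D u * D v) -
        2 * h * (∑ v, adj F j v * D v + ∑ v, adj F k v * D v) := by
  have h1 : ∀ u, ∑ v, adj F u v * ((D u - h * (ev j u + ev k u)) *
      (D v - h * (ev j v + ev k v))) = (D u - h * (ev j u + ev k u)) *
      (∑ v, adj F u v * D v - h * (adj F u j + adj F u k)) := by
    intro u
    have e : ∀ v, adj F u v * ((D u - h * (ev j u + ev k u)) * (D v - h * (ev j v + ev k v))) =
      (D u - h * (ev j u + ev k u)) * (adj F u v * D v - h * (adj F u v * ev j v) -
        h * (adj F u v * ev k v)) := fun v => by ring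
    simp only [e, ← mul_sum, sum_sub_distrib, sum_mul_ev]
    ring
  have h2 : ∀ u, (D u - h * (ev j u + ev k u)) *
      (∑ v, adj F u v * D v - h * (adj F u j + adj F u k)) =
      ∑ v, adj F u v * (D u * D v) - h * (adj F j u * D u) - h * (adj F k u * D u) -
      h * (ev j u * (∑ v, adj F u v * D v - h * (adj F u j + adj F u k))) -
      h * (ev k u * (∑ v, adj F u v * D v - h * (adj F u j + adj F u k))) := by
    intro u
    have e : ∑ v, adj F u v * (D u * D v) = D u * ∑ v, adj F u v * D v := by
      rw [mul_sum]; exact sum_congr rfl fun v _ => by ring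
    rw [e, adj_comm F j u, adj_comm F k u]; ring
  simp only [h1, h2, sum_sub_distrib, ← mul_sum, sum_ev_mul, adj_self, adj_of_not hF,
    adj_comm F k j]
  ring

/-- The increment of the potential when a pair is exposed. -/
lemma phi_step (N : Near t y p c d F) {j k : Fin n} (hjk : j ≠ k) (hF : ¬ F.Adj j k) {ξ : ℝ}
    (hξ : ξ ^ 2 = (1 - 2 * p) * ξ + p * (1 - p)) (hξ1 : |ξ| ≤ 1) :
    Bd t y 20 3 (phi y p (fun v => dl y p d F v - ξ * y ^ 2 * (ev j v + ev k v)) (addE F j k) -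
      phi y p (dl y p d F) F - (ξ * prd y p d F j k * (p * (1 - p))⁻¹ -
        (ξ * (dl y p d F j + dl y p d F k) * (p * (1 - p))⁻¹) ^ 2 / 2)) := by
  have P := N.par
  have c1 : Bd t y 1 0 (1 : ℝ) := P.bd_const (by norm_num)
  have c2 : Bd t y 1 0 (2 : ℝ) := P.bd_const (by norm_num)
  have ch : Bd t y 1 0 (1/2 : ℝ) := P.bd_const (by norm_num)
  have c3 : Bd t y 1 0 (1/3 : ℝ) := P.bd_const (by norm_num)
  have bξ : Bd t y 0 0 ξ := bd_of_le_one hξ1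
  have bk := P.bd_kinv
  have b2 := P.bd_y 2
  have bh := bξ.mul b2
  have ba := N.bd_dl j
  have bb := N.bd_dl k
  have e1 := sum_shift hjk (fun _ x => x ^ 2) (dl y p d F) (ξ * y ^ 2)
  have e2 := sum_shift hjk (fun _ x => x ^ 3) (dl y p d F) (ξ * y ^ 2)
  have e3 := sum_shift hjk (fun _ x => x) (dl y p d F) (ξ * y ^ 2)
  have e4 := sum_shift hjk (fun v x => fdeg F v * x ^ 2) (dl y p d F) (ξ * y ^ 2)
  have e5 := sum_adj_shift hF (dl y p d F) (ξ * y ^ 2)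
  set D := dl y p d F with hD
  have e6 : ∑ v, fdeg (addE F j k) v * (D v - ξ * y ^ 2 * (ev j v + ev k v)) ^ 2 =
      ∑ v, fdeg F v * (D v - ξ * y ^ 2 * (ev j v + ev k v)) ^ 2 + (D j - ξ * y ^ 2) ^ 2 +
        (D k - ξ * y ^ 2) ^ 2 := by
    have e : ∀ v, fdeg (addE F j k) v * (D v - ξ * y ^ 2 * (ev j v + ev k v)) ^ 2 =
      fdeg F v * (D v - ξ * y ^ 2 * (ev j v + ev k v)) ^ 2 +
      ev j v * (D v - ξ * y ^ 2 * (ev j v + ev k v)) ^ 2 +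
      ev k v * (D v - ξ * y ^ 2 * (ev j v + ev k v)) ^ 2 := fun v => by
        rw [fdeg_addE hjk hF]; ring
    simp only [e, sum_add_distrib, sum_ev_mul, ev_self, ev_ne hjk, ev_ne hjk.symm, add_zero,
      zero_add, mul_one]
  have e7 : ∑ u, ∑ v, adj (addE F j k) u v * ((D u - ξ * y ^ 2 * (ev j u + ev k u)) *
      (D v - ξ * y ^ 2 * (ev j v + ev k v))) =
      ∑ u, ∑ v, adj F u v * ((D u - ξ * y ^ 2 * (ev j u + ev k u)) *
      (D v - ξ * y ^ 2 * (ev j v + ev k v))) +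
      2 * ((D j - ξ * y ^ 2) * (D k - ξ * y ^ 2)) := by
    have e : ∀ u v, adj (addE F j k) u v * ((D u - ξ * y ^ 2 * (ev j u + ev k u)) *
      (D v - ξ * y ^ 2 * (ev j v + ev k v))) =
      adj F u v * ((D u - ξ * y ^ 2 * (ev j u + ev k u)) *
      (D v - ξ * y ^ 2 * (ev j v + ev k v))) +
      ev j u * (D u - ξ * y ^ 2 * (ev j u + ev k u)) *
        (ev k v * (D v - ξ * y ^ 2 * (ev j v + ev k v))) +
      ev k u * (D u - ξ * y ^ 2 * (ev j u + ev k u)) *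
        (ev j v * (D v - ξ * y ^ 2 * (ev j v + ev k v))) := fun u v => by
        rw [adj_addE hjk hF]; ring
    simp only [e, sum_add_distrib, ← mul_sum, ← sum_mul, sum_ev_mul, ev_self, ev_ne hjk,
      ev_ne hjk.symm, add_zero, zero_add, mul_one]
    ring
  have e8 : ∑ v, fdeg (addE F j k) v = ∑ v, fdeg F v + 2 := by
    simp only [fdeg_addE hjk hF, sum_add_distrib, sum_ev]; ring
  have hny := P.hny
  have hk0 := P.kap_pos.ne'
  unfold phi
  rw [e8, e7, e6, e5, e4, e3, e2, e1]
  have hnj : ∑ v, adj F j v * D v = n * nb y p d F j := by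
    unfold nb; rw [← hD]; linear_combination (-∑ v, adj F j v * D v) * hny
  have hnk : ∑ v, adj F k v * D v = n * nb y p d F k := by
    unfold nb; rw [← hD]; linear_combination (-∑ v, adj F k v * D v) * hny
  rw [hnj, hnk]
  unfold prd
  rw [← hD]
  set κ := p * (1 - p) with hκ
  have hkk : κ * κ⁻¹ = 1 := mul_inv_cancel₀ hk0
  have g1 := (P.bd_sub c1 (c2.mul P.bd_p)).mul (bk.mul (P.bd_sub
    ((ch.mul (bξ.mul bh)).mul (P.bd_add ba bb)) (c3.mul ((bξ.mul bh).mul bh))))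
  have g2 := P.bd_sub (P.bd_add (P.bd_add (bh.mul bh) (bh.mul (P.bd_add ba bb)))
    (bh.mul (P.bd_add ba bb))) (bh.mul bh)
  have g3 := P.bd_add (ch.mul (bh.mul (bξ.mul ((N.bd_f j))))) (ch.mul (bh.mul (bξ.mul (N.bd_f k))))
  have g := bk.mul (P.bd_sub (P.bd_add g1 g2) (P.bd_add g3 (bh.mul bh)))
  refine (P.bd_mono g (by norm_num) (by norm_num)).of_eq ?_
  linear_combination (κ⁻¹ * (ξ * (D j + D k) - ξ ^ 2 * y ^ 2 +
    ξ * (nb y p d F j + nb y p d F k) + (1 - 2 * p) * κ⁻¹ * (-ξ * (D j ^ 2 + D k ^ 2) / 2 +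
      ξ * (ξ * y ^ 2) * (D j + D k) / 2 - ξ * (ξ * y ^ 2) ^ 2 / 3))) * hny +
    (κ⁻¹ ^ 2 * (D j + D k) ^ 2 / 2 - κ⁻¹ * y ^ 2) * hξ +
    (κ⁻¹ * (D j + D k) ^ 2 / 2 - y ^ 2) * hkk

end

section

variable {n : ℕ} {t y p c : ℝ} {d : Fin n → ℝ} {F H : SimpleGraph (Fin n)}

lemma Par.bd_log (P : Par n t y p) {K : ℕ} (hK : K ≤ 900) {u : ℝ} (hu : Bd t y K 1 u) :
    0 < 1 + u ∧ Bd t y (3 * K + 1) 3 (Real.log (1 + u) - (u - u ^ 2 / 2)) := by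
  have ht := P.t_pos
  have hy := P.hy
  have h1 : |u| ≤ 1 / 2 := by
    have h2 := P.pow_y (K := K + 1) (by omega)
    have h3 : (1000 : ℝ) * (t ^ K * y) ≤ t * (t ^ K * y) :=
      mul_le_mul_of_nonneg_right P.ht (by positivity)
    unfold Bd at hu
    rw [pow_one] at hu
    have h4 : t * (t ^ K * y) = t ^ (K + 1) * y := by ring
    linarith
  refine ⟨by linarith [(abs_le.mp h1).1], ?_⟩
  have h5 := Real.abs_log_sub_add_sum_range_le (x := -u) (by rw [abs_neg]; linarith) 2
  rw [sum_range_succ, sum_range_one, abs_neg, sub_neg_eq_add] at h5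
  have h6 : |u| ^ 3 / (1 - |u|) ≤ 2 * |u| ^ 3 := by
    rw [div_le_iff₀ (by linarith)]
    nlinarith [pow_nonneg (abs_nonneg u) 3]
  have h7 : Real.log (1 + u) - (u - u ^ 2 / 2) =
      (-u) ^ (0 + 1) / ((0 : ℕ) + 1) + (-u) ^ (1 + 1) / ((1 : ℕ) + 1) + Real.log (1 + u) := by
    push_cast; ring
  unfold Bd
  rw [h7]
  refine (h5.trans h6).trans ?_
  have h8 : |u| ^ 3 ≤ (t ^ K * y ^ 1) ^ 3 := pow_le_pow_left₀ (abs_nonneg _) hu 3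
  have h9 : 0 ≤ (t ^ K * y ^ 1) ^ 3 := by positivity
  calc 2 * |u| ^ 3 ≤ t * (t ^ K * y ^ 1) ^ 3 :=
        mul_le_mul (by linarith [P.ht]) h8 (by positivity) ht.le
    _ = _ := by ring

/-- The conditional probability factor at a pair, in exponential form. -/
lemma exp_step (N : Near t y p c d F) (hc : c + 30 ≤ 100) (hne : (cls d F).Nonempty)
    {j k : Fin n} (hjk : j ≠ k) (hF : ¬ F.Adj j k) {ξ : ℝ}
    (hξ : ξ ^ 2 = (1 - 2 * p) * ξ + p * (1 - p)) (hξ1 : |ξ| ≤ 1) :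
    ∃ e, Bd t y 110 3 e ∧ 1 + ξ * Ex d F (fun H => zt p F H j k) * (p * (1 - p))⁻¹ =
      Real.exp (phi y p (fun v => dl y p d F v - ξ * y ^ 2 * (ev j v + ev k v)) (addE F j k) -
        phi y p (dl y p d F) F + e) := by
  have P := N.par
  have bξ : Bd t y 0 0 ξ := bd_of_le_one hξ1
  have ch : Bd t y 1 0 (1/2 : ℝ) := P.bd_const (by norm_num)
  have bk := P.bd_kinv
  have h0 := Ex_zt_zero N (by linarith) j k
  have h1 := Ex_zt_one N (by linarith) hjk hF
  have h2 := Ex_zt_two N (by linarith) hjk hF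
  have h3 := phi_step N hjk hF hξ hξ1
  rw [Ex_sub, Ex_const hne] at h1 h2
  set z := Ex d F (fun H => zt p F H j k) with hz
  set a := dl y p d F j + dl y p d F k with hA
  have ba : Bd t y 5 1 a := P.bd_add (N.bd_dl j) (N.bd_dl k)
  have bu : Bd t y 22 1 (ξ * z * (p * (1 - p))⁻¹) :=
    P.bd_mono ((bξ.mul h0).mul bk) (by norm_num) (by norm_num)
  obtain ⟨h4, h5⟩ := P.bd_log (by norm_num) bu
  have b6 := ch.mul (((bξ.mul h1).mul bk).mul ((bξ.mul (P.bd_add h0 ba)).mul bk))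
  have b7 := (bξ.mul h2).mul bk
  refine ⟨Real.log (1 + ξ * z * (p * (1 - p))⁻¹) -
    (phi y p (fun v => dl y p d F v - ξ * y ^ 2 * (ev j v + ev k v)) (addE F j k) -
        phi y p (dl y p d F) F), ?_, ?_⟩
  · refine (P.bd_mono (P.bd_sub (P.bd_add h5 (P.bd_sub b7 b6)) h3) (by norm_num)
      (by norm_num)).of_eq ?_
    ring
  · rw [add_sub_cancel, Real.exp_log h4]

/-- Exposing a present edge. -/
lemma card_step_adj (N : Near t y p c d F) (hc : c + 30 ≤ 100) (hne : (cls d F).Nonempty)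
    {j k : Fin n} (hjk : j ≠ k) (hF : ¬ F.Adj j k) :
    ∃ e, Bd t y 110 3 e ∧ (#(cls (d - ev j - ev k) (addE F j k)) : ℝ) = #(cls d F) * p *
      Real.exp (phi y p (dl y p (d - ev j - ev k) (addE F j k)) (addE F j k) -
        phi y p (dl y p d F) F + e) := by
  have P := N.par
  have hp := P.p_pos
  have hq := P.q_pos
  obtain ⟨e, h1, h2⟩ := exp_step N hc hne hjk hF (ξ := 1 - p) (by ring)
    (by rw [abs_of_pos hq]; linarith)
  refine ⟨e, h1, ?_⟩
  have h3 : dl y p (d - ev j - ev k) (addE F j k) =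
      fun v => dl y p d F v - (1 - p) * y ^ 2 * (ev j v + ev k v) := by
    funext v; rw [dl_addE y p _ hjk hF, dl_sub_ev, dl_sub_ev]; ring
  rw [h3, ← h2]
  have h4 := sum_cls_adj (d := d) hjk hF (fun _ => 1)
  simp only [mul_one, sum_const, nsmul_eq_mul] at h4
  rw [← h4, ← Ex_mul_card]
  have h5 : Ex d F (fun H => adj H j k) = p + Ex d F (fun H => zt p F H j k) := by
    rw [← Ex_const hne p, ← Ex_add, Ex_const hne p]
    refine Ex_congr fun H _ => ?_
    unfold zt gap; rw [adj_of_not hF, ev_ne hjk.symm]; ring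
  rw [h5]
  field_simp

/-- Exposing an absent edge. -/
lemma card_step_nadj (N : Near t y p c d F) (hc : c + 30 ≤ 100) (hne : (cls d F).Nonempty)
    {j k : Fin n} (hjk : j ≠ k) (hF : ¬ F.Adj j k) :
    ∃ e, Bd t y 110 3 e ∧ (#(cls d (addE F j k)) : ℝ) = #(cls d F) * (1 - p) *
      Real.exp (phi y p (dl y p d (addE F j k)) (addE F j k) -
        phi y p (dl y p d F) F + e) := by
  have P := N.par
  have hp := P.p_pos
  have hq := P.q_pos
  obtain ⟨e, h1, h2⟩ := exp_step N hc hne hjk hF (ξ := -p) (by ring)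
    (by rw [abs_neg, abs_of_pos hp]; linarith)
  refine ⟨e, h1, ?_⟩
  have h3 : dl y p d (addE F j k) =
      fun v => dl y p d F v - -p * y ^ 2 * (ev j v + ev k v) := by
    funext v; rw [dl_addE y p _ hjk hF]; ring
  rw [h3, ← h2]
  have h4 := sum_cls_nadj (d := d) (F := F) hjk (fun _ => 1)
  simp only [mul_one, sum_const, nsmul_eq_mul] at h4
  rw [← h4, ← Ex_mul_card]
  have h5 : Ex d F (fun H => 1 - adj H j k) = (1 - p) - Ex d F (fun H => zt p F H j k) := by
    have h6 := Ex_const hne (1 - p)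
    rw [← h6, ← Ex_sub]
    refine Ex_congr fun H _ => ?_
    unfold zt gap; rw [adj_of_not hF, ev_ne hjk.symm]; ring
  rw [h5]
  field_simp
  ring

end

section

variable {n : ℕ} {t y p c : ℝ} {d : Fin n → ℝ} {F H : SimpleGraph (Fin n)}

lemma xEdges_addE {j k : Fin n} (hjk : j ≠ k) (hF : ¬ F.Adj j k) :
    xEdges (addE F j k) = xEdges F + 1 := by
  unfold xEdges addE
  rw [Nat.card_eq_fintype_card, Nat.card_eq_fintype_card, ← SimpleGraph.edgeFinset_card,
    ← SimpleGraph.edgeFinset_card]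
  exact SimpleGraph.card_edgeFinset_sup_edge _ hF hjk

lemma xEdges_bot : xEdges (⊥ : SimpleGraph (Fin n)) = 0 := by
  unfold xEdges; rw [SimpleGraph.edgeSet_bot]; simp

lemma xEdges_mono {F H : SimpleGraph (Fin n)} (h : F ≤ H) : xEdges F ≤ xEdges H :=
  Nat.card_mono (Set.toFinite _) (SimpleGraph.edgeSet_mono h)

lemma exists_addE {j k : Fin n} (hjk : F.Adj j k) :
    ∃ F0 : SimpleGraph (Fin n), ¬ F0.Adj j k ∧ addE F0 j k = F := by
  refine ⟨F.deleteEdges {s(j, k)}, by simp, ?_⟩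
  ext u v
  rw [addE_adj hjk.ne, SimpleGraph.deleteEdges_adj]
  constructor
  · rintro (h | ⟨rfl, rfl⟩ | ⟨rfl, rfl⟩)
    · exact h.1
    · exact hjk
    · exact hjk.symm
  · intro h
    by_cases h4 : s(u, v) = s(j, k)
    · right; simpa using h4
    · exact Or.inl ⟨h, h4⟩

lemma graph_induction {P : SimpleGraph (Fin n) → Prop} (h0 : P ⊥)
    (h1 : ∀ F j k, j ≠ k → ¬ F.Adj j k → P F → P (addE F j k)) (F : SimpleGraph (Fin n)) : P F := by
  induction hN : xEdges F generalizing F with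
  | zero =>
    by_cases h : F = ⊥
    · exact h ▸ h0
    · obtain ⟨u, v, -, huv⟩ := SimpleGraph.ne_bot_iff_exists_adj.mp h |>.elim
        fun u ⟨v, huv⟩ => (⟨u, v, huv.ne, huv⟩ : ∃ u v, u ≠ v ∧ F.Adj u v)
      exfalso
      unfold xEdges at hN
      rw [Nat.card_eq_zero] at hN
      rcases hN with hN | hN
      · exact hN.false ⟨s(u, v), huv⟩
      · exact hN.not_finite (Set.toFinite _)
  | succ N ih =>
    have h : F ≠ ⊥ := fun h => by rw [h, xEdges_bot] at hN; omega
    obtain ⟨j, k, hjk⟩ := SimpleGraph.ne_bot_iff_exists_adj.mp h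
    obtain ⟨F0, h2, h3⟩ := exists_addE hjk
    rw [← h3]
    refine h1 F0 j k hjk.ne h2 (ih F0 ?_)
    have := xEdges_addE hjk.ne h2
    rw [h3] at this
    omega

lemma fdeg_bot (v : Fin n) : fdeg (⊥ : SimpleGraph (Fin n)) v = 0 := by simp [fdeg, adj]

/-- Exposing all pairs of a graph `F`, finding exactly the edges of `X`. -/
lemma card_chain {K : SimpleGraph (Fin n)} (X : SimpleGraph (Fin n)) (P : Par n t y p)
    (hN : ∀ F ≤ K, Near t y p 50 (d - fdeg (X ⊓ F)) F) (h0 : (cls d ⊥).Nonempty)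
    (F : SimpleGraph (Fin n)) (hFK : F ≤ K) :
    ∃ e, |e| ≤ xEdges F * (t ^ 110 * y ^ 3) ∧ (#(cls (d - fdeg (X ⊓ F)) F) : ℝ) =
      #(cls d ⊥) * (p ^ xEdges (X ⊓ F) * (1 - p) ^ (xEdges F - xEdges (X ⊓ F)) *
      Real.exp (phi y p (dl y p (d - fdeg (X ⊓ F)) F) F - phi y p (dl y p d ⊥) ⊥ + e)) := by
  have hp := P.p_pos
  have hq := P.q_pos
  have hc0 : (0 : ℝ) < #(cls d ⊥) := by exact_mod_cast h0.card_pos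
  have hE : ∀ e e' a b c : ℝ, Real.exp (a - c + (e + e')) =
      Real.exp (b - c + e) * Real.exp (a - b + e') := fun e e' a b c => by
    rw [← Real.exp_add]; congr 1; ring
  induction F using graph_induction with
  | h0 =>
    have e : d - fdeg (X ⊓ ⊥) = d := by
      funext v; rw [inf_bot_eq, Pi.sub_apply, fdeg_bot, sub_zero]
    exact ⟨0, by simp [xEdges_bot], by rw [e]; simp [xEdges_bot]⟩
  | h1 F j k hjk hF ih =>
    have hle : F ≤ addE F j k := le_sup_left
    obtain ⟨e, h1, h2⟩ := ih (hle.trans hFK)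
    have hne : (cls (d - fdeg (X ⊓ F)) F).Nonempty := by
      rw [← Finset.card_pos]
      have : (0 : ℝ) < #(cls (d - fdeg (X ⊓ F)) F) := by rw [h2]; positivity
      exact_mod_cast this
    have hNF := hN F (hle.trans hFK)
    have hXF := xEdges_mono (inf_le_right : X ⊓ F ≤ F)
    by_cases hX : X.Adj j k
    · have hXj : ¬ (X ⊓ F).Adj j k := fun h => hF h.2
      have e1 : X ⊓ addE F j k = addE (X ⊓ F) j k := by
        ext u v
        rw [SimpleGraph.inf_adj, addE_adj hjk, addE_adj hjk, SimpleGraph.inf_adj]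
        constructor
        · tauto
        · rintro (h | ⟨rfl, rfl⟩ | ⟨rfl, rfl⟩)
          · tauto
          · tauto
          · have := hX.symm; tauto
      have e2 : d - fdeg (X ⊓ addE F j k) = d - fdeg (X ⊓ F) - ev j - ev k := by
        funext v; rw [e1]; simp only [Pi.sub_apply]; rw [fdeg_addE hjk hXj]; ring
      obtain ⟨e', h3, h4⟩ := card_step_adj hNF (by norm_num) hne hjk hF
      refine ⟨e + e', ?_, ?_⟩
      · rw [xEdges_addE hjk hF]; push_cast
        unfold Bd at h3
        linarith [abs_add_le e e']
      · rw [e2, h4, h2, e1, xEdges_addE hjk hF, xEdges_addE hjk hXj, Nat.add_sub_add_right]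
        rw [hE e e' _ (phi y p (dl y p (d - fdeg (X ⊓ F)) F) F) _, pow_succ]
        ring
    · have e1 : X ⊓ addE F j k = X ⊓ F := by
        ext u v
        rw [SimpleGraph.inf_adj, addE_adj hjk, SimpleGraph.inf_adj]
        constructor
        · rintro ⟨h, h' | ⟨rfl, rfl⟩ | ⟨rfl, rfl⟩⟩
          · exact ⟨h, h'⟩
          · exact absurd h hX
          · exact absurd h.symm hX
        · tauto
      obtain ⟨e', h3, h4⟩ := card_step_nadj hNF (by norm_num) hne hjk hF
      refine ⟨e + e', ?_, ?_⟩
      · rw [xEdges_addE hjk hF]; push_cast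
        unfold Bd at h3
        linarith [abs_add_le e e']
      · rw [e1, h4, h2, xEdges_addE hjk hF, Nat.sub_add_comm hXF]
        rw [hE e e' _ (phi y p (dl y p (d - fdeg (X ⊓ F)) F) F) _, pow_succ]
        ring

end

section

variable {n : ℕ} {t y p c : ℝ} {d : Fin n → ℝ} {F H : SimpleGraph (Fin n)}

/-- The complete graph on the first `m` vertices. -/
def kg (n m : ℕ) : SimpleGraph (Fin n) where
  Adj u v := u ≠ v ∧ (u : ℕ) < m ∧ (v : ℕ) < m
  symm := ⟨fun _ _ h => ⟨h.1.symm, h.2.2, h.2.1⟩⟩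
  loopless := ⟨fun _ h => h.1 rfl⟩

lemma sum_fdeg (F : SimpleGraph (Fin n)) : ∑ v, fdeg F v = 2 * xEdges F := by
  induction F using graph_induction with
  | h0 => simp [fdeg_bot, xEdges_bot]
  | h1 F j k hjk hF ih =>
    rw [xEdges_addE hjk hF]
    simp only [fdeg_addE hjk hF, sum_add_distrib, sum_ev, ih]
    push_cast; ring

/-- Indicator of the first `m` vertices. -/
def chi (n m : ℕ) (v : Fin n) : ℝ := if (v : ℕ) < m then 1 else 0

lemma sum_chi {m : ℕ} (hm : m ≤ n) : ∑ v, chi n m v = m := by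
  simp only [chi, sum_boole, Nat.cast_inj]
  rw [Fin.card_filter_val_lt]; exact min_eq_right hm

lemma chi_sq (m : ℕ) (v : Fin n) : chi n m v * chi n m v = chi n m v := by
  unfold chi; split_ifs <;> norm_num

lemma adj_kg (m : ℕ) (u v : Fin n) : adj (kg n m) u v = chi n m u * chi n m v -
    ev u v * chi n m u := by
  unfold adj kg chi ev
  by_cases h : v = u
  · subst h; split_ifs <;> simp_all
  · by_cases h1 : (u : ℕ) < m <;> by_cases h2 : (v : ℕ) < m <;> simp [h, Ne.symm h, h1, h2]

lemma fdeg_kg {m : ℕ} (hm : m ≤ n) (u : Fin n) : fdeg (kg n m) u = chi n m u * (m - 1) := by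
  unfold fdeg
  simp only [adj_kg, sum_sub_distrib, ← mul_sum, ← sum_mul, sum_chi hm, sum_ev]
  ring

lemma xEdges_kg {m : ℕ} (hm : m ≤ n) : xEdges (kg n m) = m.choose 2 := by
  have h := sum_fdeg (kg n m)
  simp only [fdeg_kg hm, ← sum_mul, sum_chi hm] at h
  have h2 := Nat.cast_choose_two ℝ m
  have : (xEdges (kg n m) : ℝ) = m.choose 2 := by linarith
  exact_mod_cast this

/-- Moments over the first `m` vertices. -/
def mom (n m : ℕ) (α β : Fin n → ℝ) (k l : ℕ) : ℝ :=
  ∑ j : Fin n, if (j : ℕ) < m then α j ^ k * β j ^ l else 0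

lemma mom_eq (n m : ℕ) (α β : Fin n → ℝ) (k l : ℕ) :
    mom n m α β k l = ∑ j, chi n m j * (α j ^ k * β j ^ l) := by
  unfold mom chi; exact sum_congr rfl fun v _ => by split_ifs <;> simp

/-- The change of the potential from the empty graph to the complete graph. -/
lemma phi_end (P : Par n t y p) {m : ℕ} (hm : m ≤ n) (α β : Fin n → ℝ) (hα : ∑ v, α v = 0) :
    phi y p (fun v => y ^ 2 * (α v - chi n m v * β v)) (kg n m) -
      phi y p (fun v => y ^ 2 * α v) ⊥ =
      (p * (1 - p))⁻¹ * ((2 * mom n m α β 1 1 - mom n m α β 0 2) * y ^ 2 / 2 +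
        (1 - 2 * p) * mom n m α β 0 1 * y ^ 2 / 2 +
        (4 * mom n m α β 1 0 * mom n m α β 0 1 - mom n m α β 0 1 ^ 2 - 2 * mom n m α β 1 0 ^ 2) *
          y ^ 4 / 4 +
        (2 * mom n m α β 1 1 - mom n m α β 2 0 - mom n m α β 0 2) * m * y ^ 4 / 2 -
        (1 - 2 * p) * (mom n m α β 0 3 + 3 * mom n m α β 2 1 - 3 * mom n m α β 1 2) * y ^ 4 / 6 *
          (p * (1 - p))⁻¹) + (m : ℝ) ^ 2 * y ^ 2 / 2 +
      ((p * (1 - p))⁻¹ * (y ^ 4 * ∑ v, chi n m v * (α v - β v) ^ 2) - m * y ^ 2 / 2) := by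
  have hny := P.hny
  set χ := chi n m with hχ
  have s2 : ∀ v, χ v * χ v = χ v := chi_sq m
  have e1 : ∑ v, (y ^ 2 * (α v - χ v * β v)) ^ 2 =
      y ^ 4 * (∑ v, α v ^ 2 - 2 * mom n m α β 1 1 + mom n m α β 0 2) := by
    rw [mom_eq, mom_eq]
    simp only [mul_sum, ← sum_add_distrib, ← sum_sub_distrib]
    refine sum_congr rfl fun v _ => ?_
    rw [← hχ]
    linear_combination y ^ 4 * β v ^ 2 * s2 v
  have e2 : ∑ v, (y ^ 2 * (α v - χ v * β v)) ^ 3 =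
      y ^ 6 * (∑ v, α v ^ 3 - 3 * mom n m α β 2 1 + 3 * mom n m α β 1 2 - mom n m α β 0 3) := by
    rw [mom_eq, mom_eq, mom_eq]
    simp only [mul_sum, ← sum_add_distrib, ← sum_sub_distrib]
    refine sum_congr rfl fun v _ => ?_
    rw [← hχ]
    linear_combination (3 * y ^ 6 * α v * β v ^ 2 - y ^ 6 * β v ^ 3 * (1 + χ v)) * s2 v
  have e3 : ∑ v, y ^ 2 * (α v - χ v * β v) = -(y ^ 2 * mom n m α β 0 1) := by
    rw [← mul_sum, sum_sub_distrib, hα, mom_eq, ← hχ]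
    simp
  have hQ : ∑ v, χ v * (α v - β v) ^ 2 =
      mom n m α β 2 0 - 2 * mom n m α β 1 1 + mom n m α β 0 2 := by
    rw [mom_eq, mom_eq, mom_eq]
    simp only [mul_sum, ← sum_add_distrib, ← sum_sub_distrib]
    refine sum_congr rfl fun v _ => ?_
    rw [← hχ]; ring
  have e4 : ∑ v, fdeg (kg n m) v * (y ^ 2 * (α v - χ v * β v)) ^ 2 =
      y ^ 4 * (m - 1) * ∑ v, χ v * (α v - β v) ^ 2 := by
    rw [mul_sum]
    refine sum_congr rfl fun v _ => ?_
    rw [fdeg_kg hm, ← hχ]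
    linear_combination y ^ 4 * (m - 1) * (-2 * α v * β v + β v ^ 2 * (χ v + 1)) * s2 v
  have hL : ∑ v, χ v * (α v - β v) = mom n m α β 1 0 - mom n m α β 0 1 := by
    rw [mom_eq, mom_eq]
    simp only [← sum_sub_distrib]
    refine sum_congr rfl fun v _ => ?_
    rw [← hχ]; ring
  have e5 : ∑ u, ∑ v, adj (kg n m) u v * ((y ^ 2 * (α u - χ u * β u)) *
      (y ^ 2 * (α v - χ v * β v))) = y ^ 4 * ((∑ v, χ v * (α v - β v)) ^ 2 -
        ∑ v, χ v * (α v - β v) ^ 2) := by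
    have h : ∀ u v, adj (kg n m) u v * ((y ^ 2 * (α u - χ u * β u)) *
        (y ^ 2 * (α v - χ v * β v))) = y ^ 4 * ((χ u * (α u - β u)) * (χ v * (α v - β v))) -
        ev u v * (χ u * (y ^ 2 * (α u - χ u * β u)) * (y ^ 2 * (α v - χ v * β v))) := by
      intro u v
      rw [adj_kg, ← hχ]
      linear_combination (-y ^ 4 * χ v * α v * β u + y ^ 4 * β u * β v * χ v * χ v) * s2 u +
        (-y ^ 4 * χ u * α u * β v + y ^ 4 * β u * β v * χ u) * s2 v
    simp only [h, sum_sub_distrib, ← mul_sum, sum_ev_mul]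
    simp only [mul_sub]
    have h2 : ∑ i, χ i * (α i - β i) * ∑ j, χ j * (α j - β j) = (∑ v, χ v * (α v - β v)) ^ 2 := by
      rw [← sum_mul, sq]
    have h3 : ∑ x, χ x * (y ^ 2 * (α x - χ x * β x)) * (y ^ 2 * (α x - χ x * β x)) =
        y ^ 4 * ∑ v, χ v * (α v - β v) ^ 2 := by
      rw [mul_sum]
      refine sum_congr rfl fun v _ => ?_
      linear_combination y ^ 4 * (-2 * α v * β v + β v ^ 2 * (χ v + 1)) * s2 v
    simp only [mul_sub] at h2 h3 ⊢
    rw [h2, h3]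
  have e6 : ∑ v, fdeg (kg n m) v = m * (m - 1) := by
    simp only [fdeg_kg hm, ← sum_mul, sum_chi hm]
  have f1 : ∑ v, (y ^ 2 * α v) ^ 2 = y ^ 4 * ∑ v, α v ^ 2 := by
    rw [mul_sum]; exact sum_congr rfl fun v _ => by ring
  have f2 : ∑ v, (y ^ 2 * α v) ^ 3 = y ^ 6 * ∑ v, α v ^ 3 := by
    rw [mul_sum]; exact sum_congr rfl fun v _ => by ring
  have f3 : ∑ v, y ^ 2 * α v = 0 := by rw [← mul_sum, hα, mul_zero]
  have f5 : ∀ u v, adj (⊥ : SimpleGraph (Fin n)) u v = 0 := fun u v => by simp [adj]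
  unfold phi
  rw [e1, e2, e3, e4, e5, e6, f1, f2, f3, hL, hQ]
  simp only [fdeg_bot, f5, zero_mul, sum_const_zero]
  set κ := (p * (1 - p))⁻¹
  linear_combination (κ * (-(y ^ 2 * (-2 * mom n m α β 1 1 + mom n m α β 0 2)) / 2 +
    (1 - 2 * p) * κ * y ^ 4 * (-3 * mom n m α β 2 1 + 3 * mom n m α β 1 2 - mom n m α β 0 3) / 6)) *
    hny

end

section

variable {n : ℕ} {t y p c : ℝ} {F H : SimpleGraph (Fin n)}

lemma fdeg_eq (H : SimpleGraph (Fin n)) (v : Fin n) : fdeg H v = xDeg H v := by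
  unfold fdeg adj xDeg
  rw [sum_boole, Nat.card_eq_fintype_card, SimpleGraph.card_neighborSet_eq_degree,
    ← SimpleGraph.card_neighborFinset_eq_degree, SimpleGraph.neighborFinset_eq_filter]

lemma exists_xEdges {E : ℕ} (hE : E ≤ n.choose 2) : ∃ G : SimpleGraph (Fin n), xEdges G = E := by
  rw [← xEdges_kg le_rfl] at hE
  generalize kg n n = K at hE
  induction K using graph_induction with
  | h0 => exact ⟨⊥, by rw [xEdges_bot] at hE ⊢; omega⟩
  | h1 F j k hjk hF ih =>
    by_cases h : E = xEdges (addE F j k)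
    · exact ⟨_, h.symm⟩
    · rw [xEdges_addE hjk hF] at hE h
      exact ih (by omega)

/-- A vertex of larger degree can pass an edge to one of smaller degree. -/
lemma exists_pass {u v : Fin n} (h : fdeg H v < fdeg H u) :
    ∃ G : SimpleGraph (Fin n), xEdges G = xEdges H ∧ ∀ w, fdeg G w = fdeg H w - ev u w + ev v w := by
  have h1 : ∃ w, H.Adj u w ∧ ¬ H.Adj v w ∧ w ≠ v := by
    by_contra! h2
    have h3 : ∀ w, adj H u w ≤ adj H v w + ev v w * adj H u v - ev u w * adj H v u := by
      intro w
      by_cases hv : w = v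
      · subst hv
        rw [adj_self, ev_self]
        by_cases huv : w = u
        · subst huv; simp
        · rw [ev_ne huv]; linarith
      · rw [ev_ne hv]
        by_cases hu : w = u
        · subst hu; rw [adj_self, ev_self]; linarith
        · rw [ev_ne hu]
          by_cases hw : H.Adj u w
          · have : H.Adj v w := by by_contra h4; exact hv (h2 w hw h4)
            rw [adj_of hw, adj_of this]; linarith
          · rw [adj_of_not hw]; linarith [adj_nonneg H v w]
    have h4 := sum_le_sum fun w (_ : w ∈ (univ : Finset (Fin n))) => h3 w
    rw [sum_sub_distrib, sum_add_distrib, ← sum_mul, ← sum_mul, sum_ev, sum_ev,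
      adj_comm H v u] at h4
    unfold fdeg at h
    linarith
  obtain ⟨w, hw1, hw2, hw3⟩ := h1
  obtain ⟨H0, h0, rfl⟩ := exists_addE hw1
  have hvw : ¬ H0.Adj v w := fun h => hw2 ((addE_adj hw1.ne).mpr (Or.inl h))
  refine ⟨addE H0 v w, ?_, fun x => ?_⟩
  · rw [xEdges_addE hw3.symm hvw, xEdges_addE hw1.ne h0]
  · rw [fdeg_addE hw3.symm hvw, fdeg_addE hw1.ne h0]; ring

/-- Nearly regular sequences with even sum are graphical. -/
lemma exists_cls (P : Par n t y p) (d : Fin n → ℕ) (heven : Even (∑ v, d v))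
    (hsum : ∑ v, (d v : ℝ) = p * (n * (n - 1))) (hd : ∀ v, |(d v : ℝ) * y ^ 2 - p| ≤ t * y) :
    (cls (fun v => (d v : ℝ)) ⊥).Nonempty := by
  have hy := P.hy
  have ht := P.t_pos
  have hy2 := pow_pos hy 2
  obtain ⟨E, hE⟩ := heven
  have hE2 : 2 * (E : ℝ) = ∑ v, (d v : ℝ) := by
    rw [← Nat.cast_sum, hE]; push_cast; ring
  have hn1 : (1 : ℝ) ≤ n := by
    have := P.n_pos
    exact_mod_cast (by exact_mod_cast this : 0 < n)
  have hE3 : E ≤ n.choose 2 := by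
    have h := Nat.cast_choose_two ℝ n
    have : (E : ℝ) ≤ n.choose 2 := by
      have : p * (n * (n - 1)) ≤ 1 * ((n : ℝ) * (n - 1)) :=
        mul_le_mul_of_nonneg_right (by linarith [P.q_pos]) (mul_nonneg (by linarith) (by linarith))
      linarith
    exact_mod_cast this
  obtain ⟨G0, hG0⟩ := exists_xEdges hE3
  obtain ⟨G, hG, hmin⟩ := exists_min_image
    (univ.filter fun G : SimpleGraph (Fin n) => xEdges G = E)
    (fun G => ∑ v, (fdeg G v - d v) ^ 2) ⟨G0, by simp [hG0]⟩
  rw [mem_filter] at hG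
  have key : ∀ G' : SimpleGraph (Fin n), xEdges G' = E → ∀ u v, fdeg G v < d v → d u < fdeg G u →
      (∀ w, fdeg G' w = fdeg G w - ev u w + ev v w) → False := by
    intro G' hG' u v hv hu h
    have h1 := hmin G' (by simp [hG'])
    have huv : v ≠ u := fun h => by subst h; linarith
    have h2 : ∀ w, (fdeg G' w - d w) ^ 2 = (fdeg G w - d w) ^ 2 -
        2 * (ev u w * (fdeg G w - d w)) + 2 * (ev v w * (fdeg G w - d w)) + ev u w * ev u w +
        ev v w * ev v w - 2 * (ev u w * ev v w) := fun w => by rw [h]; ring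
    simp only [h2, sum_add_distrib, sum_sub_distrib, ← mul_sum, sum_ev_mul, ev_self,
      ev_ne huv.symm] at h1
    rw [fdeg_eq] at hu hv h1
    rw [fdeg_eq G v] at h1
    have hu' : (d u : ℝ) + 1 ≤ xDeg G u := by exact_mod_cast (by exact_mod_cast hu : d u < xDeg G u)
    have hv' : (xDeg G v : ℝ) + 1 ≤ d v := by exact_mod_cast (by exact_mod_cast hv : xDeg G v < d v)
    linarith
  have hSG : ∑ v, fdeg G v = ∑ v, (d v : ℝ) := by rw [sum_fdeg, hG.2, hE2]
  by_cases hall : ∀ v, fdeg G v = d v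
  · exact ⟨G, mem_cls.mpr ⟨hall, by simp⟩⟩
  exfalso
  push Not at hall
  obtain ⟨x, hx⟩ := hall
  have hex : (∃ u, d u < fdeg G u) ∧ ∃ v, fdeg G v < d v := by
    constructor
    · by_contra! h
      exact (sum_lt_sum (fun v _ => h v) ⟨x, mem_univ x, lt_of_le_of_ne (h x) hx⟩).ne hSG
    · by_contra! h
      exact (sum_lt_sum (fun v _ => h v) ⟨x, mem_univ x, lt_of_le_of_ne (h x) hx.symm⟩).ne hSG.symm
  have hle : ∀ u v, d u < fdeg G u → fdeg G v < d v → fdeg G u ≤ fdeg G v := by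
    intro u v hu hv
    by_contra! h
    obtain ⟨G', h1, h2⟩ := exists_pass h
    exact key G' (h1.trans hG.2) u v hv hu h2
  obtain ⟨⟨u, hu⟩, v, hv⟩ := hex
  have hlo : ∀ w, p - t * y ≤ fdeg G w * y ^ 2 := by
    intro w
    have hw := (abs_le.mp (hd w)).1
    have hu' := (abs_le.mp (hd u)).1
    rcases le_or_gt (d w : ℝ) (fdeg G w) with h | h
    · nlinarith
    · have := hle u w hu h
      nlinarith
  have hhi : ∀ w, fdeg G w * y ^ 2 ≤ p + t * y := by
    intro w
    have hw := (abs_le.mp (hd w)).2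
    have hv' := (abs_le.mp (hd v)).2
    rcases le_or_gt (fdeg G w) (d w : ℝ) with h | h
    · nlinarith
    · have := hle w v h hv
      nlinarith
  have N : Near t y p 1 (fdeg G + ev v) ⊥ := by
    refine ⟨P, by norm_num, by norm_num, fun w => ?_, fun w => ?_, ?_, ?_⟩
    · rw [Pi.add_apply, abs_le]
      have := ev_nonneg v w
      have := ev_le_one v w
      constructor
      · nlinarith [hlo w]
      · nlinarith [hhi w]
    · rw [fdeg_bot, zero_mul]; positivity
    · simp only [fdeg_bot, sum_const_zero, zero_mul]; positivity
    · have e : ∑ w, ((fdeg G + ev v) w * y ^ 2 - p) = y ^ 2 - p := by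
        simp only [Pi.add_apply, sum_sub_distrib, ← sum_mul, sum_add_distrib, sum_ev, hSG, hsum,
          sum_const, card_univ, Fintype.card_fin, nsmul_eq_mul]
        linear_combination p * (n - 1) * P.hny
      rw [e]
      have h1 : |y ^ 2 - p| ≤ t ^ 2 := by
        have := P.p_pos
        have := P.q_pos
        have := P.y_one
        have := P.ht
        rw [abs_le]; constructor <;> nlinarith
      have : |y ^ 2 - p| * y ^ 2 ≤ t ^ 2 * y ^ 2 := mul_le_mul_of_nonneg_right h1 hy2.le
      have : 0 ≤ 1 * y ^ 4 := by positivity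
      linarith
  have huv : u ≠ v := fun h => by subst h; linarith
  obtain ⟨r, h1, h2⟩ := ratio_zero N (by norm_num) huv
  have hGc : G ∈ cls (fdeg G + ev v - ev v) ⊥ := mem_cls.mpr ⟨by simp, by simp⟩
  have h3 : (0 : ℝ) < #(cls (fdeg G + ev v - ev v) ⊥) := by
    exact_mod_cast Finset.card_pos.mpr ⟨G, hGc⟩
  have h4 : (cls (fdeg G + ev v - ev u) ⊥).Nonempty := by
    rw [Finset.nonempty_iff_ne_empty]
    intro h
    rw [h1, h] at h3
    simp at h3
  obtain ⟨G', hG'⟩ := h4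
  have hdeg := (mem_cls.mp hG').1
  have hG'E : xEdges G' = E := by
    have h5 := sum_fdeg G'
    simp only [hdeg, Pi.add_apply, Pi.sub_apply, sum_sub_distrib, sum_add_distrib, sum_ev,
      hSG] at h5
    have : (xEdges G' : ℝ) = E := by linarith
    exact_mod_cast this
  exact key G' hG'E u v hv hu fun w => by rw [hdeg]; simp only [Pi.add_apply, Pi.sub_apply]; ring

end

section

variable {n : ℕ} {t y p c : ℝ} {F H : SimpleGraph (Fin n)}

lemma fdeg_mono (h : F ≤ H) (v : Fin n) : fdeg F v ≤ fdeg H v := by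
  refine sum_le_sum fun w _ => ?_
  by_cases h1 : F.Adj v w
  · rw [adj_of h1, adj_of (h h1)]
  · rw [adj_of_not h1]; exact adj_nonneg _ _ _

lemma chi_nonneg (n m : ℕ) (v : Fin n) : 0 ≤ chi n m v := by unfold chi; split_ifs <;> norm_num

lemma fdeg_kg_le {m : ℕ} (hm : m ≤ n) (h : F ≤ kg n m) (v : Fin n) : fdeg F v ≤ m := by
  refine (fdeg_mono h v).trans ?_
  rw [fdeg_kg hm]
  unfold chi
  split_ifs
  · linarith
  · rw [zero_mul]; positivity

lemma sum_fdeg_kg_le {m : ℕ} (hm : m ≤ n) (h : F ≤ kg n m) : ∑ v, fdeg F v ≤ (m : ℝ) ^ 2 := by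
  refine (sum_le_sum fun v _ => fdeg_mono h v).trans ?_
  simp only [fdeg_kg hm, ← sum_mul, sum_chi hm]
  nlinarith [Nat.cast_nonneg (α := ℝ) m]

lemma gCount_eq (d : Fin n → ℕ) : gCount d ⊥ = #(cls (fun v => (d v : ℝ)) ⊥) := by
  unfold gCount
  rw [Nat.card_eq_fintype_card, Fintype.card_subtype]
  congr 1
  ext H
  rw [mem_filter, mem_cls]
  simp only [fdeg_eq, xDeg, Nat.cast_inj, SimpleGraph.edgeSet_bot, SimpleGraph.bot_adj]
  simp

lemma le_kg {X : SimpleGraph (Fin n)} {m : ℕ} (hX : ∀ j : Fin n, m ≤ (j : ℕ) → xDeg X j = 0) :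
    X ≤ kg n m := by
  have h : ∀ u v, X.Adj u v → (u : ℕ) < m := by
    intro u v huv
    by_contra! h1
    have h2 := hX u h1
    unfold xDeg at h2
    rw [Nat.card_eq_zero] at h2
    rcases h2 with h2 | h2
    · exact h2.false ⟨v, huv⟩
    · exact h2.not_finite (Set.toFinite _)
  intro u v huv
  exact ⟨huv.ne, h u v huv, h v u huv.symm⟩

lemma gInd_eq (d : Fin n → ℕ) {X : SimpleGraph (Fin n)} {m : ℕ}
    (hX : X ≤ kg n m) : gInd d X m = #(cls ((fun v => (d v : ℝ)) - fdeg X) (kg n m)) := by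
  unfold gInd
  rw [Nat.card_eq_fintype_card, Fintype.card_subtype]
  have hXm : ∀ u v, X.Adj u v → (u : ℕ) < m ∧ (v : ℕ) < m := fun u v h => (hX h).2
  refine card_bij' (fun H _ => H \ X) (fun H _ => H ⊔ X) ?_ ?_ ?_ ?_
  · intro H hH
    rw [mem_filter] at hH
    obtain ⟨-, h1, h2⟩ := hH
    rw [mem_cls]
    constructor
    · intro v
      have e : ∀ w, adj (H \ X) v w = adj H v w - adj X v w := by
        intro w
        by_cases h : X.Adj v w
        · have h3 : H.Adj v w := (h2 v w (hXm v w h).1 (hXm v w h).2).mpr h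
          rw [adj_of h, adj_of h3, adj_of_not fun h4 : (H \ X).Adj v w => h4.2 h]; ring
        · rw [adj_of_not h, sub_zero]
          unfold adj
          simp [SimpleGraph.sdiff_adj, h]
      have h5 : fdeg H v = d v := by rw [fdeg_eq]; exact_mod_cast h1 v
      rw [Pi.sub_apply, ← h5]
      unfold fdeg
      rw [← sum_sub_distrib]
      exact sum_congr rfl fun w _ => e w
    · intro u v huv h
      exact h.2 ((h2 u v huv.2.1 huv.2.2).mp h.1)
  · intro H hH
    rw [mem_cls] at hH
    obtain ⟨h1, h2⟩ := hH
    rw [mem_filter]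
    refine ⟨mem_univ _, fun v => ?_, fun j k hj hk => ?_⟩
    · have e : ∀ w, adj (H ⊔ X) v w = adj H v w + adj X v w := by
        intro w
        by_cases h : X.Adj v w
        · rw [adj_of h, adj_of_not (h2 v w (hX h)), adj_of (Or.inr h), zero_add]
        · rw [adj_of_not h, add_zero]
          unfold adj
          simp [SimpleGraph.sup_adj, h]
      have h3 : fdeg (H ⊔ X) v = d v := by
        have h4 : fdeg (H ⊔ X) v = fdeg H v + fdeg X v := by
          unfold fdeg
          rw [← sum_add_distrib]
          exact sum_congr rfl fun w _ => e w
        rw [h4, h1 v, Pi.sub_apply, sub_add_cancel]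
      rw [fdeg_eq] at h3
      exact_mod_cast h3
    · constructor
      · rintro (h | h)
        · exact absurd h (h2 j k ⟨h.ne, hj, hk⟩)
        · exact h
      · exact Or.inr
  · intro H hH
    rw [mem_filter] at hH
    exact sdiff_sup_cancel fun u v h =>
      (hH.2.2 u v (hXm u v h).1 (hXm u v h).2).mpr h
  · intro H hH
    rw [mem_cls] at hH
    ext u v
    simp only [SimpleGraph.sdiff_adj, SimpleGraph.sup_adj]
    constructor
    · tauto
    · exact fun h => ⟨Or.inl h, fun h3 => hH.2 u v (hX h3) h⟩

end

section

variable {n : ℕ} {t y p c : ℝ} {F H : SimpleGraph (Fin n)}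

lemma sum_sub_dBar (hn : 0 < n) (d : Fin n → ℕ) : ∑ v, ((d v : ℝ) - dBar d) = 0 := by
  have : (n : ℝ) ≠ 0 := by exact_mod_cast hn.ne'
  rw [sum_sub_distrib, sum_const, card_univ, Fintype.card_fin, nsmul_eq_mul]
  unfold dBar
  field_simp
  ring

lemma sum_chi_sq_le {m : ℕ} {α β : Fin n → ℝ} (hy : 0 < y) (ht : 0 < t) (hmn : m ≤ n)
    (hm : m * y ≤ t / 4) (hα : ∀ v, |α v| * y ≤ t / 4)
    (hβ : ∀ v : Fin n, (v : ℕ) < m → |β v| ≤ m) :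
    y ^ 4 * ∑ v, chi n m v * (α v - β v) ^ 2 ≤ t ^ 3 * y := by
  have hy2 := pow_pos hy 2
  have h1 : ∀ v, chi n m v * (y ^ 2 * (α v - β v)) ^ 2 ≤ chi n m v * (t * y) ^ 2 := by
    intro v
    by_cases hv : (v : ℕ) < m
    · refine mul_le_mul_of_nonneg_left ?_ (chi_nonneg n m v)
      rw [← sq_abs]
      refine pow_le_pow_left₀ (abs_nonneg _) ?_ 2
      rw [abs_mul, abs_of_pos hy2]
      have h4 : |α v - β v| ≤ |α v| + m := (abs_sub _ _).trans (by linarith [hβ v hv])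
      have h5 : |α v - β v| * y ≤ t := by
        have := mul_le_mul_of_nonneg_right h4 hy.le
        rw [add_mul] at this
        linarith [hα v]
      calc y ^ 2 * |α v - β v| = |α v - β v| * y * y := by ring
        _ ≤ t * y := mul_le_mul_of_nonneg_right h5 hy.le
    · unfold chi; rw [if_neg hv, zero_mul, zero_mul]
  have h2 : y ^ 4 * ∑ v, chi n m v * (α v - β v) ^ 2 =
      ∑ v, chi n m v * (y ^ 2 * (α v - β v)) ^ 2 := by
    rw [mul_sum]; exact sum_congr rfl fun v _ => by ring
  rw [h2]
  refine (sum_le_sum fun v _ => h1 v).trans ?_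
  rw [← sum_mul, sum_chi hmn]
  have hmt : (m : ℝ) * y ≤ t := by linarith
  calc (m : ℝ) * (t * y) ^ 2 = (m * y) * (t ^ 2 * y) := by ring
    _ ≤ t * (t ^ 2 * y) := by gcongr
    _ = _ := by ring

set_option maxHeartbeats 1600000 in
/-- The probability of an induced subgraph, for a single degree sequence. -/
lemma induced_formula (d : Fin n → ℕ) (X : SimpleGraph (Fin n)) (m : ℕ)
    (P : Par n t y (lamb d)) (heven : Even (∑ v, d v))
    (hd : ∀ v, |(d v : ℝ) - dBar d| * y ≤ t / 4) (hmn : m ≤ n) (hm : m * y ≤ t / 4)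
    (hX : ∀ j : Fin n, m ≤ (j : ℕ) → xDeg X j = 0) :
    ∃ err, |err| ≤ t ^ 113 * y ∧
      (gInd d X m : ℝ) / (gCount d ⊥ : ℝ)
            = lamb d ^ xEdges X
              * (1 - lamb d) ^ (m.choose 2 - xEdges X)
              * Real.exp (
                  (2 * omegaPar d X m 1 1 - omegaPar d X m 0 2)
                    / (4 * aPar d * (n : ℝ))
                + (m : ℝ)^2 / (2 * (n : ℝ))
                + (1 - 2 * lamb d) * omegaPar d X m 0 1
                    / (4 * aPar d * (n : ℝ))
                + (4 * omegaPar d X m 1 0 * omegaPar d X m 0 1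
                    - omegaPar d X m 0 1 ^ 2
                    - 2 * omegaPar d X m 1 0 ^ 2)
                    / (8 * aPar d * (n : ℝ)^2)
                + (2 * omegaPar d X m 1 1 - omegaPar d X m 2 0
                    - omegaPar d X m 0 2) * (m : ℝ)
                    / (4 * aPar d * (n : ℝ)^2)
                - (1 - 2 * lamb d) * (omegaPar d X m 0 3
                    + 3 * omegaPar d X m 2 1
                    - 3 * omegaPar d X m 1 2)
                    / (24 * aPar d^2 * (n : ℝ)^2)
                + err) := by
  have hy := P.hy
  have ht := P.t_pos
  have ht1 := P.t_one
  have hht := P.ht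
  have hy2 := pow_pos hy 2
  have hy1 := P.y_one
  have hny := P.hny
  have hp := P.p_pos
  have hq := P.q_pos
  have hn0 := P.n_pos
  have hκ := P.kap_pos
  set p := lamb d with hpdef
  have hn2 : (2 : ℝ) ≤ n := by
    have h1 := P.y_small
    have h2 : y * (1000 * y) ≤ 1 * 1 := by
      apply mul_le_mul hy1 h1 <;> linarith
    nlinarith
  have hdbar : dBar d = p * (n - 1) := by
    rw [hpdef]; unfold lamb; rw [div_mul_cancel₀]; linarith
  have hsum : ∑ v, (d v : ℝ) = p * (n * (n - 1)) := by
    have := hdbar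
    unfold dBar at this
    rw [div_eq_iff hn0.ne'] at this
    rw [this]; ring
  have hdb : |dBar d * y ^ 2 - p| ≤ y ^ 2 := by
    have : dBar d * y ^ 2 - p = -(p * y ^ 2) := by rw [hdbar]; linear_combination p * hny
    rw [this, abs_neg, abs_of_pos (by positivity)]
    nlinarith
  have hd' : ∀ v, |(d v : ℝ) * y ^ 2 - p| ≤ t * y / 4 + y ^ 2 := by
    intro v
    have e : (d v : ℝ) * y ^ 2 - p = ((d v : ℝ) - dBar d) * y * y + (dBar d * y ^ 2 - p) := by ring
    rw [e]
    refine (abs_add_le _ _).trans (add_le_add ?_ hdb)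
    rw [abs_mul, abs_mul, abs_of_pos hy]
    nlinarith [hd v]
  have hyt : y ^ 2 ≤ t * y / 4 := by nlinarith
  have hm2 : (m : ℝ) * y ^ 2 ≤ t * y / 4 := by nlinarith
  have hm0 : (0 : ℝ) ≤ m := Nat.cast_nonneg m
  have hmm : (m : ℝ) ^ 2 * y ^ 2 ≤ t ^ 2 / 16 := by
    have := pow_le_pow_left₀ (by positivity) hm 2
    calc _ = ((m : ℝ) * y) ^ 2 := by ring
      _ ≤ _ := this
      _ = _ := by ring
  have hne := exists_cls P d heven hsum fun v => (hd' v).trans (by linarith)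
  have hXK := le_kg hX
  have hN : ∀ F ≤ kg n m, Near t y p 50 ((fun v => (d v : ℝ)) - fdeg (X ⊓ F)) F := by
    intro F hF
    refine ⟨P, by norm_num, by norm_num, fun v => ?_, fun v => ?_, ?_, ?_⟩
    · have h1 : fdeg (X ⊓ F) v ≤ m := fdeg_kg_le hmn (inf_le_right.trans hF) v
      have h0 := fdeg_nonneg (X ⊓ F) v
      have e : ((fun v => (d v : ℝ)) - fdeg (X ⊓ F)) v * y ^ 2 - p =
          ((d v : ℝ) * y ^ 2 - p) + -(fdeg (X ⊓ F) v * y ^ 2) := by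
        rw [Pi.sub_apply]; ring
      rw [e]
      refine (abs_add_le _ _).trans ?_
      rw [abs_neg, abs_of_nonneg (by positivity : 0 ≤ fdeg (X ⊓ F) v * y ^ 2)]
      have := mul_le_mul_of_nonneg_right h1 hy2.le
      have := hd' v
      have : 0 < t * y := by positivity
      linarith
    · have := mul_le_mul_of_nonneg_right (fdeg_kg_le hmn hF v) hy2.le
      have : 0 < t * y := by positivity
      linarith
    · have h1 := sum_fdeg_kg_le hmn hF
      have h2 := mul_le_mul_of_nonneg_right h1 (pow_pos hy 4).le
      have h3 := mul_le_mul_of_nonneg_right hmm hy2.le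
      have : 0 < t ^ 2 * y ^ 2 := by positivity
      have : 0 < y ^ 4 := by positivity
      have e : (m : ℝ) ^ 2 * y ^ 4 = (m : ℝ) ^ 2 * y ^ 2 * y ^ 2 := by ring
      linarith
    · have h1 := sum_fdeg_kg_le hmn (inf_le_right.trans hF : X ⊓ F ≤ kg n m)
      have h0 : 0 ≤ ∑ v, fdeg (X ⊓ F) v := sum_nonneg fun v _ => fdeg_nonneg _ v
      have e : ∑ v, (((fun v => (d v : ℝ)) - fdeg (X ⊓ F)) v * y ^ 2 - p) =
          -(p + y ^ 2 * ∑ v, fdeg (X ⊓ F) v) := by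
        simp only [Pi.sub_apply, sum_sub_distrib, ← sum_mul, hsum, sum_const, card_univ,
          Fintype.card_fin, nsmul_eq_mul]
        linear_combination p * (n - 1) * hny
      rw [e, abs_neg, abs_of_nonneg (by positivity)]
      have h2 := mul_le_mul_of_nonneg_left h1 hy2.le
      have h3 : p + y ^ 2 * ∑ v, fdeg (X ⊓ F) v ≤ t ^ 2 := by nlinarith
      have := mul_le_mul_of_nonneg_right h3 hy2.le
      have : 0 < 50 * y ^ 4 := by positivity
      linarith
  obtain ⟨e, he, hcard⟩ := card_chain X P hN hne (kg n m) le_rfl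
  rw [inf_eq_left.mpr hXK, xEdges_kg hmn] at hcard
  rw [xEdges_kg hmn] at he
  set α : Fin n → ℝ := fun v => (d v : ℝ) - dBar d with hα
  set β : Fin n → ℝ := fun v => (xDeg X v : ℝ) - p * ((m : ℝ) - 1) with hβ
  have hm_eq : ∀ k l, omegaPar d X m k l = mom n m α β k l := fun k l => rfl
  have hfX : ∀ v, fdeg X v = chi n m v * xDeg X v := by
    intro v
    rw [fdeg_eq]
    unfold chi
    split_ifs with h
    · rw [one_mul]
    · rw [hX v (by omega)]; simp
  have e1 : dl y p ((fun v => (d v : ℝ)) - fdeg X) (kg n m) =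
      fun v => y ^ 2 * (α v - chi n m v * β v) := by
    funext v
    unfold dl
    rw [Pi.sub_apply, hfX, fdeg_kg hmn, hα, hβ]
    simp only [hdbar]
    ring
  have e2 : dl y p (fun v => (d v : ℝ)) ⊥ = fun v => y ^ 2 * α v := by
    funext v
    unfold dl
    rw [fdeg_bot, hα]
    simp only [hdbar]
    ring
  have hend := phi_end P hmn α β (sum_sub_dBar (by exact_mod_cast hn0) d)
  rw [e1, e2, hend] at hcard
  set Q := y ^ 4 * ∑ v, chi n m v * (α v - β v) ^ 2 with hQ
  have hQ0 : 0 ≤ Q := mul_nonneg (by positivity)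
    (sum_nonneg fun v _ => mul_nonneg (chi_nonneg n m v) (sq_nonneg _))
  have hmy : (m : ℝ) * y ≤ t := by linarith
  have hQ1 : Q ≤ t ^ 3 * y := by
    refine sum_chi_sq_le hy ht hmn hm hd fun v hv => ?_
    have hm1 : (1 : ℝ) ≤ m := by exact_mod_cast (by omega : 1 ≤ m)
    have h2 : (xDeg X v : ℝ) ≤ m := by rw [← fdeg_eq]; exact fdeg_kg_le hmn hXK v
    have : (0 : ℝ) ≤ xDeg X v := Nat.cast_nonneg _
    have h3 : 0 ≤ p * ((m : ℝ) - 1) := mul_nonneg hp.le (by linarith)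
    have h4 : p * ((m : ℝ) - 1) ≤ 1 * ((m : ℝ) - 1) :=
      mul_le_mul_of_nonneg_right (by linarith) (by linarith)
    simp only [hβ]
    rw [abs_le]
    constructor <;> linarith
  refine ⟨(p * (1 - p))⁻¹ * Q - m * y ^ 2 / 2 + e, ?_, ?_⟩
  · have h1 : (p * (1 - p))⁻¹ ≤ t ^ 2 := by
      rw [inv_le_iff_one_le_mul₀ hκ]; exact P.kap_ge
    have h2 : |(p * (1 - p))⁻¹ * Q| ≤ t ^ 112 * y := by
      rw [abs_of_nonneg (by positivity)]
      calc _ ≤ t ^ 2 * (t ^ 3 * y) := by gcongr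
        _ = t ^ 5 * y := by ring
        _ ≤ _ := by gcongr; norm_num [ht1]
    have h3 : |(m : ℝ) * y ^ 2 / 2| ≤ t ^ 112 * y := by
      rw [abs_of_nonneg (by positivity)]
      calc (m : ℝ) * y ^ 2 / 2 ≤ t ^ 1 * y := by rw [pow_one]; nlinarith
        _ ≤ _ := by gcongr; norm_num [ht1]
    have h4 : |e| ≤ t ^ 112 * y := by
      have h5 : ((m.choose 2 : ℕ) : ℝ) ≤ (m : ℝ) ^ 2 := by
        rw [Nat.cast_choose_two]; nlinarith
      calc |e| ≤ (m : ℝ) ^ 2 * (t ^ 110 * y ^ 3) := he.trans (by gcongr)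
        _ = (m * y) ^ 2 * (t ^ 110 * y) := by ring
        _ ≤ t ^ 2 * (t ^ 110 * y) := by gcongr
        _ = _ := by ring
    have h5 := abs_add_le ((p * (1 - p))⁻¹ * Q - m * y ^ 2 / 2) e
    have h6 := abs_sub ((p * (1 - p))⁻¹ * Q) (m * y ^ 2 / 2)
    have h7 : 3 * (t ^ 112 * y) ≤ t * (t ^ 112 * y) :=
      mul_le_mul_of_nonneg_right (by linarith) (by positivity)
    calc _ ≤ 3 * (t ^ 112 * y) := by linarith
      _ ≤ _ := h7
      _ = _ := by ring
  · rw [gInd_eq d hXK, gCount_eq, hcard, mul_div_cancel_left₀ _ (by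
      exact_mod_cast hne.card_pos.ne')]
    simp only [hm_eq]
    congr 2
    have hA : aPar d = p * (1 - p) / 2 := rfl
    have hyn : y ^ 2 = (n : ℝ)⁻¹ := by field_simp; linarith
    have hyn4 : y ^ 4 = (n : ℝ)⁻¹ ^ 2 := by rw [← hyn]; ring
    rw [hA, hyn, hyn4]
    have i1 : ∀ x : ℝ, x / (4 * (p * (1 - p) / 2) * n) = (p * (1 - p))⁻¹ * (x * (n : ℝ)⁻¹ / 2) :=
      fun x => by field_simp; ring
    have i2 : ∀ x : ℝ, x / (8 * (p * (1 - p) / 2) * n ^ 2) =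
      (p * (1 - p))⁻¹ * (x * (n : ℝ)⁻¹ ^ 2 / 4) := fun x => by field_simp; ring
    have i3 : ∀ x : ℝ, x / (4 * (p * (1 - p) / 2) * n ^ 2) =
      (p * (1 - p))⁻¹ * (x * (n : ℝ)⁻¹ ^ 2 / 2) := fun x => by field_simp; ring
    have i4 : ∀ x : ℝ, x / (24 * (p * (1 - p) / 2) ^ 2 * n ^ 2) =
      (p * (1 - p))⁻¹ * (x * (n : ℝ)⁻¹ ^ 2 / 6 * (p * (1 - p))⁻¹) :=
      fun x => by field_simp; ring
    have i5 : ∀ x : ℝ, x / (2 * n) = x * (n : ℝ)⁻¹ / 2 := fun x => by field_simp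
    rw [i1, i1, i2, i3, i4, i5]
    ring

end

section

lemma eventually_rpow_ge {c : ℝ} (hc : 0 < c) (K : ℝ) :
    ∀ᶠ n : ℕ in atTop, K ≤ (n : ℝ) ^ c :=
  ((tendsto_rpow_atTop hc).comp tendsto_natCast_atTop_atTop).eventually_ge_atTop K

lemma eventually_log_le {c : ℝ} (hc : 0 < c) {K : ℝ} (hK : 0 < K) :
    ∀ᶠ n : ℕ in atTop, K * Real.log n ≤ (n : ℝ) ^ c := by
  have h := tendsto_natCast_atTop_atTop.eventually
    ((isLittleO_log_rpow_atTop hc).bound (inv_pos.mpr hK))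
  filter_upwards [h, eventually_ge_atTop 1] with n hn h1
  have h1' : (1 : ℝ) ≤ n := by exact_mod_cast h1
  rw [Real.norm_of_nonneg (Real.log_nonneg h1'),
    Real.norm_of_nonneg (by positivity)] at hn
  calc K * Real.log n ≤ K * (K⁻¹ * (n : ℝ) ^ c) := by gcongr
    _ = _ := by field_simp

end

end DegEnum

/-- Theorem 2.4: probability of a given induced subgraph on the first `m` vertices. -/
theorem stmt7 (a b : ℝ) (ha : 0 < a) (hb : 0 < b) (hab : a + b < 1/2) :
    ∃ ε : ℝ, 0 < ε ∧
      ∀ (d : (n : ℕ) → Fin n → ℕ) (X : (n : ℕ) → SimpleGraph (Fin n)) (m : ℕ → ℕ),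
        (∀ n, Even (∑ j, d n j)) →
        (∃ C : ℝ, ∀ (n : ℕ) (j : Fin n),
            |(d n j : ℝ) - dBar (d n)| ≤ C * (n : ℝ) ^ ((1:ℝ)/2 + ε)) →
        (∃ C : ℝ, ∀ (n : ℕ) (j : Fin n),
            (xDeg (X n) j : ℝ) ≤ C * (n : ℝ) ^ ((1:ℝ)/2 + ε)) →
        (∃ C : ℝ, ∀ n : ℕ, (xEdges (X n) : ℝ) ≤ C * (n : ℝ) ^ ((1:ℝ) + 2*ε)) →
        (∀ᶠ n : ℕ in atTop,
            (n : ℝ) / (3 * a * Real.log n) ≤ min (dBar (d n)) ((n : ℝ) - dBar (d n) - 1)) →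
        (∀ n, m n ≤ n) →
        (∃ C : ℝ, ∀ n : ℕ, (m n : ℝ) ≤ C * (n : ℝ) ^ ((1:ℝ)/2 + ε)) →
        (∀ (n : ℕ) (j : Fin n), m n ≤ (j : ℕ) → xDeg (X n) j = 0) →
        ∃ C : ℝ, ∀ᶠ n : ℕ in atTop, ∃ err : ℝ, |err| ≤ C * (n : ℝ) ^ (-b) ∧
          (gInd (d n) (X n) (m n) : ℝ) / (gCount (d n) ⊥ : ℝ)
            = lamb (d n) ^ xEdges (X n)
              * (1 - lamb (d n)) ^ ((m n).choose 2 - xEdges (X n))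
              * Real.exp (
                  (2 * omegaPar (d n) (X n) (m n) 1 1 - omegaPar (d n) (X n) (m n) 0 2)
                    / (4 * aPar (d n) * (n : ℝ))
                + (m n : ℝ)^2 / (2 * (n : ℝ))
                + (1 - 2 * lamb (d n)) * omegaPar (d n) (X n) (m n) 0 1
                    / (4 * aPar (d n) * (n : ℝ))
                + (4 * omegaPar (d n) (X n) (m n) 1 0 * omegaPar (d n) (X n) (m n) 0 1
                    - omegaPar (d n) (X n) (m n) 0 1 ^ 2
                    - 2 * omegaPar (d n) (X n) (m n) 1 0 ^ 2)
                    / (8 * aPar (d n) * (n : ℝ)^2)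
                + (2 * omegaPar (d n) (X n) (m n) 1 1 - omegaPar (d n) (X n) (m n) 2 0
                    - omegaPar (d n) (X n) (m n) 0 2) * (m n : ℝ)
                    / (4 * aPar (d n) * (n : ℝ)^2)
                - (1 - 2 * lamb (d n)) * (omegaPar (d n) (X n) (m n) 0 3
                    + 3 * omegaPar (d n) (X n) (m n) 2 1
                    - 3 * omegaPar (d n) (X n) (m n) 1 2)
                    / (24 * aPar (d n)^2 * (n : ℝ)^2)
                + err) := by
  set s : ℝ := (1 / 2 - b) / 1000 with hs
  have hs0 : 0 < s := by rw [hs]; linarith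
  refine ⟨s / 2, by positivity, ?_⟩
  intro d X m heven ⟨C₁, hC₁⟩ _ _ hmin hmn ⟨C₂, hC₂⟩ hX
  refine ⟨1, ?_⟩
  have hpow : ∀ C : ℝ, ∀ᶠ n : ℕ in atTop,
      C * (n : ℝ) ^ (1 / 2 + s / 2) * (n : ℝ) ^ (-(1 / 2) : ℝ) ≤ (n : ℝ) ^ s / 4 := by
    intro C
    filter_upwards [DegEnum.eventually_rpow_ge (half_pos hs0) (4 * C), eventually_gt_atTop 0] with n h h0
    have h0' : (0 : ℝ) < n := by exact_mod_cast h0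
    have e1 : (n : ℝ) ^ (1 / 2 + s / 2) * (n : ℝ) ^ (-(1 / 2) : ℝ) = (n : ℝ) ^ (s / 2) := by
      rw [← Real.rpow_add h0']; ring_nf
    have e2 : (n : ℝ) ^ s = (n : ℝ) ^ (s / 2) * (n : ℝ) ^ (s / 2) := by
      rw [← Real.rpow_add h0']; ring_nf
    rw [mul_assoc, e1, e2]
    have := mul_le_mul_of_nonneg_right h (Real.rpow_nonneg h0'.le (s / 2))
    linarith
  filter_upwards [hpow C₁, hpow C₂, DegEnum.eventually_rpow_ge hs0 1000,
    DegEnum.eventually_log_le hs0 (by positivity : 0 < 3 * a),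
    DegEnum.eventually_log_le hs0 (by norm_num : (0 : ℝ) < 50),
    hmin, eventually_ge_atTop 3] with n h₁ h₂ h1000 hlog hlog50 hminn h3
  have h3' : (3 : ℝ) ≤ n := by exact_mod_cast h3
  have hn : (0 : ℝ) < n := by linarith
  have hyp : (0 : ℝ) < (n : ℝ) ^ (-(1 / 2) : ℝ) := Real.rpow_pos_of_pos hn _
  have htp : (0 : ℝ) < (n : ℝ) ^ s := Real.rpow_pos_of_pos hn _
  have hlog0 : 0 < Real.log n := Real.log_pos (by linarith)
  have hty : ∀ k : ℕ, ((n : ℝ) ^ s) ^ k * (n : ℝ) ^ (-(1 / 2) : ℝ)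
      = (n : ℝ) ^ (k * s - 1 / 2) := by
    intro k
    rw [← Real.rpow_natCast, ← Real.rpow_mul hn.le, ← Real.rpow_add hn]
    ring_nf
  obtain ⟨hmin1, hmin2⟩ := le_min_iff.mp hminn
  have hden : 0 < 3 * a * Real.log n := by positivity
  rw [div_le_iff₀ hden] at hmin1 hmin2
  have hlam : dBar (d n) = lamb (d n) * ((n : ℝ) - 1) := by
    unfold lamb; rw [div_mul_cancel₀]; linarith
  have key : ∀ q : ℝ, (n : ℝ) ≤ q * ((n : ℝ) - 1) * (3 * a * Real.log n) →
      1 ≤ (n : ℝ) ^ s * q := by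
    intro q h
    have hq : 0 < q := by
      by_contra hq
      have : q * ((n : ℝ) - 1) * (3 * a * Real.log n) ≤ 0 :=
        mul_nonpos_of_nonpos_of_nonneg
          (mul_nonpos_of_nonpos_of_nonneg (not_lt.mp hq) (by linarith)) hden.le
      linarith
    have h4 : (n : ℝ) * 1 ≤ n * (q * (3 * a * Real.log n)) := by
      have : 0 < q * (3 * a * Real.log n) := by positivity
      nlinarith
    have h5 := le_of_mul_le_mul_left h4 hn
    have h6 := mul_le_mul_of_nonneg_left hlog hq.le
    linarith
  have P : DegEnum.Par n ((n : ℝ) ^ s) ((n : ℝ) ^ (-(1 / 2) : ℝ)) (lamb (d n)) := by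
    refine ⟨h1000, hyp, ?_, ?_, key _ ?_, key _ ?_, ?_⟩
    · rw [← Real.rpow_natCast, ← Real.rpow_mul hn.le]
      norm_num
      rw [Real.rpow_neg_one, mul_inv_cancel₀ hn.ne']
    · rw [hty]
      refine Real.rpow_le_one_of_one_le_of_nonpos (by linarith) ?_
      rw [hs]; push_cast; linarith
    · rw [← hlam]; exact hmin1
    · rw [sub_mul, ← hlam]
      calc (n : ℝ) ≤ _ := hmin2
        _ = _ := by ring
    · rw [← Real.rpow_natCast, ← Real.rpow_mul hn.le,
        Real.rpow_def_of_pos hn (-(1 / 2) * _)]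
      apply Real.exp_le_exp.mpr
      norm_num
      linarith
  obtain ⟨err, herr, hform⟩ := DegEnum.induced_formula (d n) (X n) (m n) P (heven n)
    (fun v => (mul_le_mul_of_nonneg_right (hC₁ n v) hyp.le).trans h₁) (hmn n)
    ((mul_le_mul_of_nonneg_right (hC₂ n) hyp.le).trans h₂) (hX n)
  refine ⟨err, ?_, hform⟩
  rw [one_mul]
  refine herr.trans ?_
  rw [hty]
  refine Real.rpow_le_rpow_of_exponent_le (by linarith) ?_
  have : 1000 * s = 1 / 2 - b := by rw [hs]; ring
  push_cast
  linarith
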